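/- Fix an integer d ≥ 2, and for each N ≥ 1 let λ(N) ∈ [0,1] be any value satisfying ℙ_{λ(N)}(A^□) = 1/2 for bond percolation on the torus T^d_N. Then λ(N) → p̂_c(d) as N → ∞. -/

import Mathlib

/-!
Bond percolation on the torus `T^d_N`.  A configuration assigns `true`/`false`
(open/closed) to each edge of the graph on `(ℤ/Nℤ)^d` in which a vertex is joined
to its translates by standard basis vectors; edges are indexed by a vertex together
with a direction.  A configuration lifts `N`-periodically to `ℤ^d`, and the
giant-cycle event `A^□` asks for two distinct points of `ℤ^d`, congruent mod `N`,
joined by a path of open edges of the periodic lift.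
-/

namespace TorusPerc

/-- The standard basis vector `e i` of `ℤ^d`. -/
def stdVec (d : ℕ) (i : Fin d) : Fin d → ℤ := fun j => if j = i then 1 else 0

/-- An edge of the cubical torus: a vertex of `(ℤ/Nℤ)^d` together with a direction. -/
abbrev Edge (d N : ℕ) := (Fin d → ZMod N) × Fin d

/-- A bond configuration on the torus. -/
abbrev Config (d N : ℕ) := Edge d N → Bool

/-- Reduction of a point of `ℤ^d` modulo `N`. -/
def proj (d N : ℕ) (x : Fin d → ℤ) : Fin d → ZMod N := fun i => (x i : ZMod N)

/-- The edge of the periodic lift going from `x` in direction `i` is open. -/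
def liftOpen (d N : ℕ) (ω : Config d N) (x : Fin d → ℤ) (i : Fin d) : Prop :=
  ω (proj d N x, i) = true

/-- One step along an open edge of the periodic lift. -/
def step (d N : ℕ) (ω : Config d N) (x y : Fin d → ℤ) : Prop :=
  (∃ i, y = x + stdVec d i ∧ liftOpen d N ω x i) ∨
  (∃ i, x = y + stdVec d i ∧ liftOpen d N ω y i)

/-- Connectivity by paths of open edges in the periodic lift. -/
def connected (d N : ℕ) (ω : Config d N) : (Fin d → ℤ) → (Fin d → ℤ) → Prop :=
  Relation.ReflTransGen (step d N ω)

/-- The giant-cycle event `A^□`: some two distinct points of `ℤ^d` which are congruent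
modulo `N` are joined by an open path of the periodic lift. -/
def giantEvent (d N : ℕ) : Set (Config d N) :=
  {ω | ∃ x y : Fin d → ℤ, x ≠ y ∧ proj d N x = proj d N y ∧ connected d N ω x y}

/-- The set of winding vectors realized by a configuration. -/
def winding (d N : ℕ) (ω : Config d N) : Set (Fin d → ℤ) :=
  {w | ∃ x : Fin d → ℤ, connected d N ω x (x + (N : ℤ) • w)}

/-- The realized winding vectors, regarded as vectors in `ℚ^d`. -/
def windingQ (d N : ℕ) (ω : Config d N) : Set (Fin d → ℚ) :=
  (fun w : Fin d → ℤ => fun i => (w i : ℚ)) '' winding d N ω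

/-- The spanning event `S^□`: the realized winding vectors span `ℚ^d`. -/
def spanEvent (d N : ℕ) : Set (Config d N) :=
  {ω | Submodule.span ℚ (windingQ d N ω) = ⊤}

/-- The probability of an event under Bernoulli(`p`) bond percolation on the torus:
each edge is open independently with probability `p`. -/
noncomputable def prob (d N : ℕ) (p : ℝ) (S : Set (Config d N)) : ℝ :=
  ∑ᶠ ω ∈ S, ∏ᶠ e : Edge d N, (if ω e then p else 1 - p)

end TorusPerc


/-!
Bond percolation on `ℤ^d` and its critical probability `p̂_c(d)`.
The event that the origin lies in an infinite open cluster has probability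
`θ(p) = inf_M ℙ_p(0 ↔ ∂[-M,M]^d)`, where the connection event depends only on the
(finitely many) edges with both endpoints in the box `[-M,M]^d`, so that its
probability is a finite Bernoulli sum.  `p̂_c(d)` is the supremum of the `p ∈ [0,1]`
with `θ(p) = 0`.
-/

namespace ZLattice

/-- The edge of `ℤ^d` from `e.1` in direction `e.2` has both endpoints in `[-M,M]^d`. -/
def inBox (d M : ℕ) (e : (Fin d → ℤ) × Fin d) : Prop :=
  (∀ j, |e.1 j| ≤ (M : ℤ)) ∧ (∀ j, |(e.1 + TorusPerc.stdVec d e.2) j| ≤ (M : ℤ))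

/-- A bond configuration on the edges of the box `[-M,M]^d`. -/
abbrev BoxConfig (d M : ℕ) := {e : (Fin d → ℤ) × Fin d // inBox d M e} → Bool

/-- The edge from `x` in direction `i` lies in the box and is open. -/
def edgeOpen (d M : ℕ) (η : BoxConfig d M) (x : Fin d → ℤ) (i : Fin d) : Prop :=
  ∃ h : inBox d M (x, i), η ⟨(x, i), h⟩ = true

/-- One step along an open edge of the box. -/
def step (d M : ℕ) (η : BoxConfig d M) (x y : Fin d → ℤ) : Prop :=
  (∃ i, y = x + TorusPerc.stdVec d i ∧ edgeOpen d M η x i) ∨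
  (∃ i, x = y + TorusPerc.stdVec d i ∧ edgeOpen d M η y i)

/-- Connectivity by open paths inside the box. -/
def connected (d M : ℕ) (η : BoxConfig d M) : (Fin d → ℤ) → (Fin d → ℤ) → Prop :=
  Relation.ReflTransGen (step d M η)

/-- The origin is joined to the boundary of the box `[-M,M]^d` by an open path. -/
def reachBoundary (d M : ℕ) : Set (BoxConfig d M) :=
  {η | ∃ y : Fin d → ℤ, (∃ j, |y j| = (M : ℤ)) ∧ connected d M η 0 y}

/-- Probability of an event for Bernoulli(`p`) bond percolation on the box. -/
noncomputable def prob (d M : ℕ) (p : ℝ) (S : Set (BoxConfig d M)) : ℝ :=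
  ∑ᶠ η ∈ S, ∏ᶠ e : {e : (Fin d → ℤ) × Fin d // inBox d M e}, (if η e then p else 1 - p)

/-- `θ(p)`: the probability that the origin of `ℤ^d` lies in an infinite open cluster. -/
noncomputable def theta (d : ℕ) (p : ℝ) : ℝ := ⨅ M : ℕ, prob d M p (reachBoundary d M)

/-- The critical probability `p̂_c(d)` of Bernoulli bond percolation on `ℤ^d`. -/
noncomputable def hatPc (d : ℕ) : ℝ := sSup {p : ℝ | p ∈ Set.Icc (0 : ℝ) 1 ∧ theta d p = 0}

end ZLattice


open MeasureTheory ProbabilityTheory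

namespace Perc

/-! ### Part 0: probability framework -/

noncomputable section

/-- clamp to the unit interval -/
def cl (p : ℝ) : ℝ := max 0 (min p 1)

lemma cl_nonneg (p : ℝ) : 0 ≤ cl p := le_max_left _ _
lemma cl_le_one (p : ℝ) : cl p ≤ 1 := max_le zero_le_one (min_le_right _ _)
lemma cl_eq {p : ℝ} (h0 : 0 ≤ p) (h1 : p ≤ 1) : cl p = p := by
  simp [cl, h0, h1]
lemma cl_mono {p q : ℝ} (h : p ≤ q) : cl p ≤ cl q :=
  max_le_max le_rfl (min_le_min h le_rfl)

/-- Bernoulli law on `Bool`. -/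
def bern (p : ℝ) : Measure Bool :=
  ENNReal.ofReal (cl p) • Measure.dirac true + ENNReal.ofReal (1 - cl p) • Measure.dirac false

instance (p : ℝ) : IsProbabilityMeasure (bern p) := by
  constructor
  simp only [bern, Measure.coe_add, Measure.coe_smul, Pi.add_apply, Pi.smul_apply, smul_eq_mul,
    measure_univ, mul_one]
  rw [← ENNReal.ofReal_add (cl_nonneg p) (by linarith [cl_le_one p])]
  simp

lemma bern_true (p : ℝ) : (bern p).real {true} = cl p := by
  simp [bern, Measure.real, cl_nonneg]

lemma bern_false (p : ℝ) : (bern p).real {false} = 1 - cl p := by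
  have := cl_le_one p
  simp [bern, Measure.real, this]

lemma bern_real_singleton (p : ℝ) (b : Bool) :
    (bern p).real {b} = if b then cl p else 1 - cl p := by
  cases b
  · simp [bern_false]
  · simp [bern_true]

lemma bern_ext {μ : Measure Bool} [IsProbabilityMeasure μ] {p : ℝ} (h0 : 0 ≤ p) (h1 : p ≤ 1)
    (h : μ.real {false} = 1 - p) : μ = bern p := by
  have hf : μ {false} = bern p {false} := by
    have := bern_false p
    rw [cl_eq h0 h1, ← h] at this
    exact ((measureReal_eq_measureReal_iff).1 this).symm
  have ht : μ {true} = bern p {true} := by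
    have e : ({true} : Set Bool) = {false}ᶜ := by ext b; cases b <;> simp
    rw [e, prob_compl_eq_one_sub (by simp), prob_compl_eq_one_sub (by simp), hf]
  apply Measure.ext_of_singleton
  intro b; cases b
  · exact hf
  · exact ht

variable {ι κ : Type*}

/-- product Bernoulli measure -/
def pm (p : ι → ℝ) : Measure (ι → Bool) := Measure.infinitePi (fun i => bern (p i))

instance (p : ι → ℝ) : IsProbabilityMeasure (pm p) := by unfold pm; infer_instance

/-- probability of an event -/
def Pr (p : ι → ℝ) (A : Set (ι → Bool)) : ℝ := (pm p).real A

lemma Pr_nonneg (p : ι → ℝ) (A : Set (ι → Bool)) : 0 ≤ Pr p A := measureReal_nonneg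
lemma Pr_le_one (p : ι → ℝ) (A : Set (ι → Bool)) : Pr p A ≤ 1 := measureReal_le_one
lemma Pr_univ (p : ι → ℝ) : Pr p Set.univ = 1 := by simp [Pr]
lemma Pr_empty (p : ι → ℝ) : Pr p ∅ = 0 := by simp [Pr]
lemma Pr_mono (p : ι → ℝ) {A B : Set (ι → Bool)} (h : A ⊆ B) : Pr p A ≤ Pr p B :=
  measureReal_mono h
lemma Pr_union_le (p : ι → ℝ) (A B : Set (ι → Bool)) : Pr p (A ∪ B) ≤ Pr p A + Pr p B :=
  measureReal_union_le A B
lemma Pr_biUnion_le (p : ι → ℝ) {α : Type*} (s : Finset α) (A : α → Set (ι → Bool)) :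
    Pr p (⋃ a ∈ s, A a) ≤ ∑ a ∈ s, Pr p (A a) :=
  measureReal_biUnion_finset_le s A

/-- `A` is a local event depending only on the finite index set `S`. -/
structure LD (A : Set (ι → Bool)) (S : Set ι) : Prop where
  fin : S.Finite
  dep : ∀ ω ω' : ι → Bool, (∀ i ∈ S, ω i = ω' i) → ω ∈ A → ω' ∈ A

namespace LD
variable {A B : Set (ι → Bool)} {S T : Set ι}

lemma iff (h : LD A S) {ω ω' : ι → Bool} (hω : ∀ i ∈ S, ω i = ω' i) : ω ∈ A ↔ ω' ∈ A :=
  ⟨h.dep _ _ hω, h.dep _ _ fun i hi => (hω i hi).symm⟩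

lemma mono (h : LD A S) (hT : T.Finite) (hST : S ⊆ T) : LD A T :=
  ⟨hT, fun _ _ hw => h.dep _ _ fun i hi => hw i (hST hi)⟩

lemma compl (h : LD A S) : LD Aᶜ S :=
  ⟨h.fin, fun _ _ hw hA hA' => hA (h.dep _ _ (fun i hi => (hw i hi).symm) hA')⟩

lemma inter (h : LD A S) (h' : LD B S) : LD (A ∩ B) S :=
  ⟨h.fin, fun _ _ hw hA => ⟨h.dep _ _ hw hA.1, h'.dep _ _ hw hA.2⟩⟩

lemma union (h : LD A S) (h' : LD B S) : LD (A ∪ B) S :=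
  ⟨h.fin, fun _ _ hw hA => hA.imp (h.dep _ _ hw) (h'.dep _ _ hw)⟩

lemma inter' (h : LD A S) (h' : LD B T) : LD (A ∩ B) (S ∪ T) :=
  (h.mono (h.fin.union h'.fin) Set.subset_union_left).inter
    (h'.mono (h.fin.union h'.fin) Set.subset_union_right)

lemma meas (h : LD A S) : MeasurableSet A := by
  classical
  set F := h.fin.toFinset
  have : A = (fun (ω : ι → Bool) (i : F) => ω i) ⁻¹'
      ((fun (ω : ι → Bool) (i : F) => ω i) '' A) := by
    apply Set.Subset.antisymm (Set.subset_preimage_image _ _)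
    rintro ω ⟨ω', h', he⟩
    refine h.dep _ _ (fun i hi => ?_) h'
    exact congrFun he ⟨i, h.fin.mem_toFinset.2 hi⟩
  rw [this]
  exact (measurable_pi_lambda _ fun i => measurable_pi_apply _) (Set.toFinite _).measurableSet

end LD

lemma Pr_compl (p : ι → ℝ) {A : Set (ι → Bool)} {S : Set ι} (h : LD A S) :
    Pr p Aᶜ = 1 - Pr p A := probReal_compl_eq_one_sub h.meas

/-- (T): reindexing along an injective map. -/
lemma Pr_comp (p : ι → ℝ) {g : κ → ι} (hg : Function.Injective g) {A : Set (κ → Bool)}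
    {S : Set κ} (h : LD A S) : Pr p {ω | (fun k => ω (g k)) ∈ A} = Pr (fun k => p (g k)) A := by
  have := Measure.map_infinitePi_infinitePi_of_inj (P := fun i => bern (p i)) hg
  unfold Pr pm
  rw [← this, map_measureReal_apply (by fun_prop) h.meas]
  rfl

lemma LD.comp {A : Set (κ → Bool)} {S : Set κ} (h : LD A S) (g : κ → ι) :
    LD {ω : ι → Bool | (fun k => ω (g k)) ∈ A} (g '' S) :=
  ⟨h.fin.image _, fun ω ω' hw hA => h.dep _ _ (fun i hi => hw _ ⟨i, hi, rfl⟩) hA⟩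

/-- Independence. -/
lemma Pr_inter (p : ι → ℝ) {A B : Set (ι → Bool)} {S T : Set ι} (hA : LD A S) (hB : LD B T)
    (hST : Disjoint S T) : Pr p (A ∩ B) = Pr p A * Pr p B := by
  classical
  have hi : iIndepFun (fun (i : ι) (ω : ι → Bool) => ω i) (pm p) :=
    iIndepFun_infinitePi (P := fun i => bern (p i)) (X := fun _ b => b) (fun _ => measurable_id)
  have hd : Disjoint hA.fin.toFinset hB.fin.toFinset := by
    rw [Set.Finite.disjoint_toFinset]; exact hST
  have := hi.indepFun_finset _ _ hd (fun i => measurable_pi_apply i)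
  have key : ∀ {A : Set (ι → Bool)} {S : Set ι} (h : LD A S),
      A = (fun (ω : ι → Bool) (i : h.fin.toFinset) => ω i) ⁻¹'
      ((fun (ω : ι → Bool) (i : h.fin.toFinset) => ω i) '' A) := by
    intro A S h
    apply Set.Subset.antisymm (Set.subset_preimage_image _ _)
    rintro ω ⟨ω', h', he⟩
    refine h.dep _ _ (fun i hi => ?_) h'
    exact congrFun he ⟨i, h.fin.mem_toFinset.2 hi⟩
  have h2 := this.measure_inter_preimage_eq_mul _ _ (Set.toFinite
    ((fun (ω : ι → Bool) (i : hA.fin.toFinset) => ω i) '' A)).measurableSet (Set.toFinite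
    ((fun (ω : ι → Bool) (i : hB.fin.toFinset) => ω i) '' B)).measurableSet
  rw [← key hA, ← key hB] at h2
  unfold Pr Measure.real
  rw [h2, ENNReal.toReal_mul]

lemma LD.biInter {α : Type*} (s : Finset α) {A : α → Set (ι → Bool)} {S : α → Set ι}
    (h : ∀ a ∈ s, LD (A a) (S a)) : LD (⋂ a ∈ s, A a) (⋃ a ∈ s, S a) := by
  refine ⟨Set.Finite.biUnion s.finite_toSet fun a ha => (h a ha).fin, fun ω ω' hw hA => ?_⟩
  simp only [Set.mem_iInter] at hA ⊢
  exact fun a ha => (h a ha).dep _ _ (fun i hi => hw i (Set.mem_biUnion ha hi)) (hA a ha)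

lemma Pr_biInter (p : ι → ℝ) {α : Type*} (s : Finset α) {A : α → Set (ι → Bool)} {S : α → Set ι}
    (h : ∀ a ∈ s, LD (A a) (S a)) (hd : ∀ a ∈ s, ∀ b ∈ s, a ≠ b → Disjoint (S a) (S b)) :
    Pr p (⋂ a ∈ s, A a) = ∏ a ∈ s, Pr p (A a) := by
  classical
  induction s using Finset.induction_on with
  | empty => simp [Pr_univ]
  | insert a s ha ih =>
    rw [Finset.prod_insert ha, Finset.set_biInter_insert,
      Pr_inter p (h a (by simp)) (LD.biInter s fun b hb => h b (by simp [hb])), ih]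
    · exact fun b hb => h b (by simp [hb])
    · exact fun b hb c hc => hd b (by simp [hb]) c (by simp [hc])
    · simp only [Set.disjoint_iUnion_right]
      intro b hb
      exact hd a (by simp) b (by simp [hb]) (by rintro rfl; exact ha hb)

/-- decomposition along a finite family of disjoint local events -/
lemma Pr_sum_disjoint (p : ι → ℝ) {α : Type*} (s : Finset α) {A : α → Set (ι → Bool)}
    {S : α → Set ι} (h : ∀ a ∈ s, LD (A a) (S a))
    (hd : ∀ a ∈ s, ∀ b ∈ s, a ≠ b → Disjoint (A a) (A b)) :
    Pr p (⋃ a ∈ s, A a) = ∑ a ∈ s, Pr p (A a) := by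
  unfold Pr
  exact measureReal_biUnion_finset (fun a ha b hb hab => hd a ha b hb hab)
    (fun a ha => (h a ha).meas)

lemma Pr_add (p : ι → ℝ) {A B : Set (ι → Bool)} {T : Set ι} (hB : LD B T) (hd : Disjoint A B) :
    Pr p (A ∪ B) = Pr p A + Pr p B := measureReal_union hd hB.meas

lemma Pr_coord (p : ι → ℝ) (i : ι) : Pr p {ω | ω i = true} = cl (p i) := by
  have := Measure.infinitePi_map_eval (fun i => bern (p i)) i
  rw [← bern_true (p i), ← this, map_measureReal_apply (by fun_prop) (by simp)]
  rfl

lemma LD_coord (i : ι) (b : Bool) : LD {ω : ι → Bool | ω i = b} {i} :=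
  ⟨Set.finite_singleton i, fun ω ω' hw hA => by
    have := hw i rfl
    simp only [Set.mem_ofPred_eq] at *; rw [← this, hA]⟩

lemma Pr_coord_false (p : ι → ℝ) (i : ι) : Pr p {ω | ω i = false} = 1 - cl (p i) := by
  rw [← Pr_coord, ← Pr_compl p (LD_coord i true)]
  congr 1; ext ω; simp

lemma LD_all (s : Finset ι) (b : Bool) : LD {ω : ι → Bool | ∀ i ∈ s, ω i = b} s :=
  ⟨s.finite_toSet, fun ω ω' hw hA i hi => by rw [← hw i hi]; exact hA i hi⟩

lemma Pr_all_true (p : ι → ℝ) (s : Finset ι) :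
    Pr p {ω | ∀ i ∈ s, ω i = true} = ∏ i ∈ s, cl (p i) := by
  have := Pr_biInter p s (A := fun i => {ω : ι → Bool | ω i = true}) (S := fun i => {i})
    (fun i _ => LD_coord i true) (by intro a _ b _ hab; simpa using hab)
  rw [Finset.prod_congr rfl fun i _ => (Pr_coord p i).symm, ← this]
  congr 1; ext ω; simp

lemma Pr_all_false (p : ι → ℝ) (s : Finset ι) :
    Pr p {ω | ∀ i ∈ s, ω i = false} = ∏ i ∈ s, (1 - cl (p i)) := by
  have := Pr_biInter p s (A := fun i => {ω : ι → Bool | ω i = false}) (S := fun i => {i})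
    (fun i _ => LD_coord i false) (by intro a _ b _ hab; simpa using hab)
  rw [Finset.prod_congr rfl fun i _ => (Pr_coord_false p i).symm, ← this]
  congr 1; ext ω; simp

/-- increasing events -/
def Inc (A : Set (ι → Bool)) : Prop := ∀ ω ω' : ι → Bool, (∀ i, ω i = true → ω' i = true) →
  ω ∈ A → ω' ∈ A

lemma pm_finite [Fintype ι] [DecidableEq ι] (p : ι → ℝ) (A : Set (ι → Bool)) [DecidablePred (· ∈ A)] :
    Pr p A = ∑ ω : ι → Bool, (∏ i, (if ω i then cl (p i) else 1 - cl (p i))) *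
      (if ω ∈ A then 1 else 0) := by
  classical
  have h1 : ∀ ω : ι → Bool, (pm p).real {ω} = ∏ i, (if ω i then cl (p i) else 1 - cl (p i)) := by
    intro ω
    unfold pm Measure.real
    rw [Measure.infinitePi_singleton_of_fintype, ENNReal.toReal_prod]
    exact Finset.prod_congr rfl fun i _ => bern_real_singleton _ _
  have h2 : A = ⋃ ω ∈ (Finset.univ.filter (· ∈ A)), {ω} := by ext; simp
  unfold Pr
  conv_lhs => rw [h2]
  rw [measureReal_biUnion_finset]
  · rw [Finset.sum_filter]
    refine Finset.sum_congr rfl fun ω _ => ?_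
    simp [h1]
  · intro a _ b _ hab; simpa [Function.onFun] using hab
  · intro _ _; exact (Set.toFinite _).measurableSet

lemma harris_fin [Fintype ι] (p : ι → ℝ) {A B : Set (ι → Bool)} (hA : Inc A) (hB : Inc B) :
    Pr p A * Pr p B ≤ Pr p (A ∩ B) := by
  classical
  have := fkg (α := ι → Bool) (β := ℝ)
    (μ := fun ω => ∏ i, (if ω i then cl (p i) else 1 - cl (p i)))
    (f := fun ω => if ω ∈ A then 1 else 0) (g := fun ω => if ω ∈ B then 1 else 0)
    (fun ω => Finset.prod_nonneg fun i _ => by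
      have := cl_nonneg (p i); have := cl_le_one (p i); dsimp; split_ifs <;> linarith)
    (fun ω => by dsimp; split_ifs <;> norm_num) (fun ω => by dsimp; split_ifs <;> norm_num)
    (fun ω ω' h => by
      dsimp; by_cases h1 : ω ∈ A
      · have : ω' ∈ A := hA ω ω' (fun i hi => by have := h i; rw [hi] at this; exact top_le_iff.1 this) h1
        simp [h1, this]
      · simp [h1]; split_ifs <;> norm_num)
    (fun ω ω' h => by
      dsimp; by_cases h1 : ω ∈ B
      · have : ω' ∈ B := hB ω ω' (fun i hi => by have := h i; rw [hi] at this; exact top_le_iff.1 this) h1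
        simp [h1, this]
      · simp [h1]; split_ifs <;> norm_num)
    (fun a b => by
      rw [← Finset.prod_mul_distrib, ← Finset.prod_mul_distrib]
      apply le_of_eq
      refine Finset.prod_congr rfl fun i _ => ?_
      simp only [Pi.inf_apply, Pi.sup_apply]
      have e : ∀ x y : Bool, ((if x = true then cl (p i) else 1 - cl (p i)) *
          if y = true then cl (p i) else 1 - cl (p i)) =
          (if x ⊓ y = true then cl (p i) else 1 - cl (p i)) *
          if x ⊔ y = true then cl (p i) else 1 - cl (p i) := by
        intro x y; cases x <;> cases y <;> simp [mul_comm]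
      convert e (a i) (b i))
  rw [pm_finite, pm_finite, pm_finite]
  have h1 : ∑ ω : ι → Bool, (∏ i, (if ω i then cl (p i) else 1 - cl (p i))) = 1 := by
    have := pm_finite p Set.univ
    rw [Pr_univ] at this
    simpa using this.symm
  rw [h1, one_mul] at this
  refine this.trans (le_of_eq (Finset.sum_congr rfl fun ω _ => ?_))
  by_cases h1 : ω ∈ A <;> by_cases h2 : ω ∈ B <;> simp [h1, h2]

/-- extend a configuration on `S` by `false` -/
def ext0 (S : Set ι) (η : S → Bool) : ι → Bool := fun i => by
  classical exact if h : i ∈ S then η ⟨i, h⟩ else false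

lemma ext0_mem {S : Set ι} (η : S → Bool) (i : S) : ext0 S η i = η i := by
  simp [ext0]

lemma LD.eq_restrict {A : Set (ι → Bool)} {S : Set ι} (h : LD A S) :
    A = {ω | (fun k : S => ω k) ∈ {η : S → Bool | ext0 S η ∈ A}} := by
  ext ω
  exact h.iff fun i hi => (ext0_mem (S := S) (fun k => ω k) ⟨i, hi⟩).symm

lemma Pr_restrict (p : ι → ℝ) {A : Set (ι → Bool)} {S : Set ι} (h : LD A S) :
    Pr p A = Pr (fun i : S => p i) {η : S → Bool | ext0 S η ∈ A} := by
  have : Finite S := h.fin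
  conv_lhs => rw [h.eq_restrict]
  rw [Pr_comp p Subtype.val_injective (S := Set.univ) ⟨Set.toFinite _, ?_⟩]
  intro ω ω' hw
  have : ω = ω' := funext fun i => hw i trivial
  rw [this]; exact id

lemma harris (p : ι → ℝ) {A B : Set (ι → Bool)} {S : Set ι} (hA : LD A S) (hB : LD B S)
    (iA : Inc A) (iB : Inc B) : Pr p A * Pr p B ≤ Pr p (A ∩ B) := by
  have : Finite S := hA.fin
  have : Fintype S := Fintype.ofFinite _
  rw [Pr_restrict p hA, Pr_restrict p hB, Pr_restrict p (hA.inter hB)]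
  have key : ∀ A : Set (ι → Bool), Inc A → Inc {η : S → Bool | ext0 S η ∈ A} := by
    intro A hA ω ω' hw
    refine hA _ _ fun i hi => ?_
    by_cases h : i ∈ S
    · rw [ext0_mem ω ⟨i, h⟩] at hi
      rw [ext0_mem ω' ⟨i, h⟩]; exact hw _ hi
    · simp [ext0, h] at hi
  exact harris_fin _ (key A iA) (key B iB)

/-- decreasing events -/
def Dec (A : Set (ι → Bool)) : Prop := Inc Aᶜ

lemma harris_dec (p : ι → ℝ) {A B : Set (ι → Bool)} {S : Set ι} (hA : LD A S) (hB : LD B S)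
    (iA : Dec A) (iB : Dec B) : Pr p A * Pr p B ≤ Pr p (A ∩ B) := by
  have h := harris p hA.compl hB.compl iA iB
  have e : Aᶜ ∩ Bᶜ = (A ∪ B)ᶜ := by simp
  rw [e, Pr_compl p hA, Pr_compl p hB, Pr_compl p (hA.union hB)] at h
  have e2 : Pr p (A ∪ B) = Pr p A + Pr p B - Pr p (A ∩ B) := by
    have := measureReal_union_add_inter (μ := pm p) (s := A) hB.meas
    unfold Pr; linarith
  rw [e2] at h
  nlinarith

lemma harris_dec_pow (p : ι → ℝ) {α : Type*} (s : Finset α) {A : α → Set (ι → Bool)} {S : Set ι}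
    (hS : S.Finite) (hA : ∀ a ∈ s, LD (A a) S) (iA : ∀ a ∈ s, Dec (A a)) {x : ℝ} (hx : 0 ≤ x)
    (hp : ∀ a ∈ s, x ≤ Pr p (A a)) : x ^ s.card ≤ Pr p (⋂ a ∈ s, A a) := by
  classical
  suffices h : (LD (⋂ a ∈ s, A a) S ∧ Dec (⋂ a ∈ s, A a)) ∧ x ^ s.card ≤ Pr p (⋂ a ∈ s, A a) from
    h.2
  induction s using Finset.induction_on with
  | empty => exact ⟨⟨⟨hS, by simp⟩, by simp [Dec, Inc]⟩, by simp [Pr_univ]⟩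
  | insert a s ha ih =>
    obtain ⟨⟨h1, h2⟩, h3⟩ := ih (fun b hb => hA b (by simp [hb])) (fun b hb => iA b (by simp [hb]))
      (fun b hb => hp b (by simp [hb]))
    rw [Finset.set_biInter_insert]
    refine ⟨⟨(hA a (by simp)).inter h1, ?_⟩, ?_⟩
    · intro ω ω' hw hω
      rw [Set.compl_inter] at hω ⊢
      exact hω.imp (iA a (by simp) ω ω' hw) (h2 ω ω' hw)
    · rw [Finset.card_insert_of_notMem ha, pow_succ']
      exact (mul_le_mul (hp a (by simp)) h3 (by positivity) (Pr_nonneg _ _)).trans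
        (harris_dec p (hA a (by simp)) h1 (iA a (by simp)) h2)

/-- OR map with mask. -/
def orMap {τ : Type*} (M : ι → Finset τ) (ω : ι × τ → Bool) : ι → Bool := fun i => by
  classical exact decide (∃ t ∈ M i, ω (i, t) = true)

lemma orMap_true {τ : Type*} (M : ι → Finset τ) (ω : ι × τ → Bool) (i : ι) :
    orMap M ω i = true ↔ ∃ t ∈ M i, ω (i, t) = true := by simp [orMap]

lemma pm_orMap {τ : Type*} (M : ι → Finset τ) (p : ι × τ → ℝ)
    {A : Set (ι → Bool)} {S : Set ι} (h : LD A S) :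
    Pr p {ω | orMap M ω ∈ A} = Pr (fun i => 1 - ∏ t ∈ M i, (1 - cl (p (i, t)))) A := by
  classical
  have h1 := Measure.infinitePi_map_curry (fun (i : ι) (t : τ) => bern (p (i, t)))
  let f : ι → (τ → Bool) → Bool := fun i η => decide (∃ t ∈ M i, η t = true)
  have hset : ∀ i, f i ⁻¹' {false} = {η : τ → Bool | ∀ t ∈ M i, η t = false} := by
    intro i; ext η; simp [f]
  have hf : ∀ i, Measurable (f i) := by
    intro i
    apply measurable_to_bool
    have : f i ⁻¹' {true} = (f i ⁻¹' {false})ᶜ := by ext η; simp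
    rw [this, hset]
    exact (LD_all (M i) false).compl.meas
  have h2 := Measure.infinitePi_map_pi (fun i => Measure.infinitePi fun t => bern (p (i, t))) hf
  rw [← h1, Measure.map_map (by fun_prop) (by fun_prop)] at h2
  have h3 : ∀ i, (Measure.infinitePi fun t => bern (p (i, t))).map (f i) =
      bern (1 - ∏ t ∈ M i, (1 - cl (p (i, t)))) := by
    intro i
    have : IsProbabilityMeasure ((Measure.infinitePi fun t => bern (p (i, t))).map (f i)) :=
      Measure.isProbabilityMeasure_map (hf i).aemeasurable
    have hb : ∀ t ∈ M i, 0 ≤ 1 - cl (p (i, t)) := fun t _ => by linarith [cl_le_one (p (i,t))]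
    apply bern_ext
    · have := Finset.prod_le_one hb (fun t _ => by linarith [cl_nonneg (p (i, t))])
      linarith
    · linarith [Finset.prod_nonneg hb]
    · rw [map_measureReal_apply (hf i) (by simp), hset]
      have := Pr_all_false (fun t => p (i, t)) (M i)
      unfold Pr pm at this
      rw [this]; ring
  simp_rw [h3] at h2
  unfold Pr
  unfold pm
  rw [← h2, map_measureReal_apply _ h.meas]
  · rfl
  · refine Measurable.comp (measurable_pi_lambda _ fun i => (hf i).comp (measurable_pi_apply i))
      (by fun_prop)

lemma Pr_le_of_le {p q : ι → ℝ} (h : ∀ i, p i ≤ q i) {A : Set (ι → Bool)} {S : Set ι}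
    (hA : LD A S) (iA : Inc A) : Pr p A ≤ Pr q A := by
  classical
  -- coupling
  let r : ι × Bool → ℝ := fun x => if x.2 then cl (p x.1)
    else if cl (p x.1) = 1 then 0 else (cl (q x.1) - cl (p x.1)) / (1 - cl (p x.1))
  have h1 := pm_orMap (fun _ : ι => {true}) r hA
  have h2 := pm_orMap (fun _ : ι => Finset.univ) r hA
  have e1 : Pr (fun i => 1 - ∏ t ∈ ({true} : Finset Bool), (1 - cl (r (i, t)))) A = Pr p A := by
    unfold Pr pm
    congr 2; funext i
    simp [r, bern, cl_eq (cl_nonneg _) (cl_le_one _)]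
  have e2 : Pr (fun i => 1 - ∏ t ∈ (Finset.univ : Finset Bool), (1 - cl (r (i, t)))) A
      = Pr q A := by
    unfold Pr pm
    congr 2; funext i
    have hpq := cl_mono (h i)
    have hp0 := cl_nonneg (p i)
    have hp1 := cl_le_one (p i)
    have hq1 := cl_le_one (q i)
    have : 1 - ∏ t ∈ (Finset.univ : Finset Bool), (1 - cl (r (i, t))) = cl (q i) := by
      by_cases h1 : cl (p i) = 1
      · have : cl (q i) = 1 := by linarith
        simp [r, h1, this, cl_eq (zero_le_one) (le_refl (1:ℝ))]
      · have h1' : 0 < 1 - cl (p i) := by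
          rcases lt_or_eq_of_le hp1 with h | h
          · linarith
          · exact absurd h h1
        have h3 : cl ((cl (q i) - cl (p i)) / (1 - cl (p i))) =
          (cl (q i) - cl (p i)) / (1 - cl (p i)) :=
          cl_eq (div_nonneg (by linarith) h1'.le) ((div_le_one h1').2 (by linarith))
        simp [r, h1, cl_eq (cl_nonneg _) (cl_le_one _), h3]
        field_simp
        ring
    change bern (1 - ∏ t ∈ (Finset.univ : Finset Bool), (1 - cl (r (i, t)))) = _
    rw [this]
    simp [bern, cl_eq (cl_nonneg _) (cl_le_one _)]
  rw [← e1, ← e2, ← h1, ← h2]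
  apply Pr_mono
  intro ω hω
  refine iA _ _ (fun i hi => ?_) hω
  rw [orMap_true] at hi ⊢
  obtain ⟨t, _, ht⟩ := hi
  exact ⟨t, by simp, ht⟩

end

end Perc

open MeasureTheory ProbabilityTheory

namespace Perc

noncomputable section

/-! ### Lattice, connectivity -/

open TorusPerc (stdVec)

abbrev V (d : ℕ) := Fin d → ℤ
abbrev E (d : ℕ) := Sym2 (V d)

variable {d : ℕ}

def Adj (x y : V d) : Prop := ∃ i, y = x + stdVec d i ∨ x = y + stdVec d i

lemma Adj.symm {x y : V d} (h : Adj x y) : Adj y x := by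
  obtain ⟨i, h⟩ := h; exact ⟨i, h.symm⟩

lemma Adj.abs_le {x y : V d} (h : Adj x y) (j : Fin d) : |y j - x j| ≤ 1 := by
  obtain ⟨i, h | h⟩ := h <;> subst h <;> simp only [Pi.add_apply, stdVec] <;> split_ifs <;> simp

lemma Adj.ne {x y : V d} (h : Adj x y) : x ≠ y := by
  rintro rfl
  obtain ⟨i, h | h⟩ := h <;> simpa [stdVec] using congrFun h i

/-- one step along an open edge inside `D` -/
def stp (O : Set (E d)) (D : Set (V d)) (x y : V d) : Prop :=
  Adj x y ∧ x ∈ D ∧ y ∈ D ∧ s(x, y) ∈ O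

lemma stp.symm {O : Set (E d)} {D : Set (V d)} {x y : V d} (h : stp O D x y) : stp O D y x :=
  ⟨h.1.symm, h.2.2.1, h.2.1, by rw [Sym2.eq_swap]; exact h.2.2.2⟩

def Cn (O : Set (E d)) (D : Set (V d)) : V d → V d → Prop := Relation.ReflTransGen (stp O D)

/-- open edges of a configuration -/
def op (ω : E d → Bool) : Set (E d) := {e | ω e = true}

lemma Cn.refl (O : Set (E d)) (D : Set (V d)) (x : V d) : Cn O D x x := Relation.ReflTransGen.refl

lemma Cn.trans {O : Set (E d)} {D : Set (V d)} {x y z : V d} (h : Cn O D x y) (h' : Cn O D y z) :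
    Cn O D x z := Relation.ReflTransGen.trans h h'

lemma Cn.symm {O : Set (E d)} {D : Set (V d)} {x y : V d} (h : Cn O D x y) : Cn O D y x := by
  induction h with
  | refl => exact Cn.refl _ _ _
  | tail _ h ih => exact Relation.ReflTransGen.head h.symm ih

lemma Cn.single {O : Set (E d)} {D : Set (V d)} {x y : V d} (h : stp O D x y) : Cn O D x y :=
  Relation.ReflTransGen.single h

lemma Cn.mono' {O O' : Set (E d)} {D D' : Set (V d)} {x y : V d}
    (hh : ∀ a b, stp O D a b → stp O' D' a b) (h : Cn O D x y) : Cn O' D' x y :=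
  Relation.ReflTransGen.mono hh _ _ h

lemma stp.mono {O O' : Set (E d)} {D D' : Set (V d)} {x y : V d} (hO : O ⊆ O') (hD : D ⊆ D')
    (h : stp O D x y) : stp O' D' x y := ⟨h.1, hD h.2.1, hD h.2.2.1, hO h.2.2.2⟩

lemma Cn.mono {O O' : Set (E d)} {D D' : Set (V d)} {x y : V d} (hO : O ⊆ O') (hD : D ⊆ D')
    (h : Cn O D x y) : Cn O' D' x y := h.mono' fun _ _ h => h.mono hO hD

lemma Cn.mem {O : Set (E d)} {D : Set (V d)} {x y : V d} (h : Cn O D x y) (hx : x ∈ D) : y ∈ D := by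
  induction h with
  | refl => exact hx
  | tail _ h _ => exact h.2.2.1

/-- first exit from `S` -/
lemma Cn.exit {O : Set (E d)} {D S : Set (V d)} {x y : V d} (h : Cn O D x y) (hx : x ∈ S)
    (hy : y ∉ S) : ∃ a b, a ∈ S ∧ b ∉ S ∧ Cn O (D ∩ S) x a ∧ stp O D a b ∧ Cn O D b y := by
  induction h using Relation.ReflTransGen.head_induction_on with
  | refl => exact absurd hx hy
  | @head a c h1 h2 ih =>
    by_cases hc : c ∈ S
    · obtain ⟨a', b, ha, hb, h3, h4, h5⟩ := ih hc
      have h6 : stp O (D ∩ S) a c := ⟨h1.1, ⟨h1.2.1, hx⟩, ⟨h1.2.2.1, hc⟩, h1.2.2.2⟩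
      exact ⟨a', b, ha, hb, (Cn.single h6).trans h3, h4, h5⟩
    · exact ⟨a, c, hx, hc, Cn.refl _ _ _, h1, h2⟩

/-- last exit from `S` -/
lemma Cn.last_exit {O : Set (E d)} {D S : Set (V d)} {x y : V d} (h : Cn O D x y) (hx : x ∈ S)
    (hy : y ∉ S) : ∃ a b, a ∈ S ∧ b ∉ S ∧ Cn O D x a ∧ stp O D a b ∧ Cn O (D \ S) b y := by
  obtain ⟨b, a, hb, ha, h1, h2, h3⟩ := h.symm.exit (S := Sᶜ) hy (by simpa using hx)
  exact ⟨a, b, by simpa using ha, hb, h3.symm, h2.symm, h1.symm⟩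

/-- edges with both endpoints in `D` -/
def eIn (D : Set (V d)) : Set (E d) := {e | ∀ v ∈ e, v ∈ D}

lemma mk_mem_eIn {D : Set (V d)} {x y : V d} : s(x, y) ∈ eIn D ↔ x ∈ D ∧ y ∈ D := by
  simp [eIn]

lemma eIn_finite {D : Set (V d)} (hD : D.Finite) : (eIn D).Finite := by
  refine ((hD.prod hD).image (fun x => s(x.1, x.2))).subset ?_
  intro e he
  induction e with
  | h x y => rw [mk_mem_eIn] at he; exact ⟨(x, y), he, rfl⟩

lemma eIn_mono {D D' : Set (V d)} (h : D ⊆ D') : eIn D ⊆ eIn D' := fun _ he v hv => h (he v hv)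

lemma LD_Cn {D : Set (V d)} (hD : D.Finite) (x y : V d) :
    LD {ω : E d → Bool | Cn (op ω) D x y} (eIn D) := by
  refine ⟨eIn_finite hD, fun ω ω' hw h => ?_⟩
  refine Cn.mono' (fun a b hab => ⟨hab.1, hab.2.1, hab.2.2.1, ?_⟩) h
  have := hw s(a, b) (mk_mem_eIn.2 ⟨hab.2.1, hab.2.2.1⟩)
  have h2 := hab.2.2.2
  simp only [op, Set.mem_ofPred_eq] at h2 ⊢
  rw [← this, h2]

lemma op_mono {ω ω' : E d → Bool} (h : ∀ e, ω e = true → ω' e = true) : op ω ⊆ op ω' := h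

lemma Inc_Cn (D : Set (V d)) (x y : V d) : Inc {ω : E d → Bool | Cn (op ω) D x y} :=
  fun _ _ hw h => Cn.mono (op_mono hw) le_rfl h

/-! ### Boxes -/

def box (z : V d) (n : ℕ) : Set (V d) := {x | ∀ j, |x j - z j| ≤ n}
def sph (z : V d) (n : ℕ) : Set (V d) := {x | x ∈ box z n ∧ ∃ j, |x j - z j| = n}

lemma box_eq (z : V d) (n : ℕ) : box z n = Set.Icc (fun j => z j - n) (fun j => z j + n) := by
  ext x
  simp only [box, Set.mem_ofPred_eq, Set.mem_Icc, Pi.le_def, ← forall_and]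
  refine forall_congr' fun j => ?_
  rw [abs_le]; constructor <;> intro h <;> constructor <;> linarith [h.1, h.2]

lemma box_finite (z : V d) (n : ℕ) : (box z n).Finite := by
  rw [box_eq]; exact Set.finite_Icc _ _

lemma sph_finite (z : V d) (n : ℕ) : (sph z n).Finite :=
  (box_finite z n).subset fun _ h => h.1

lemma self_mem_box (z : V d) (n : ℕ) : z ∈ box z n := by intro j; simp

lemma box_mono {z : V d} {m n : ℕ} (h : m ≤ n) : box z m ⊆ box z n := by
  intro x hx j; exact (hx j).trans (by exact_mod_cast h)

lemma box_subset {z w : V d} {m n k : ℕ} (h : w ∈ box z k) (hk : m + k ≤ n) :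
    box w m ⊆ box z n := by
  intro x hx j
  have h1 := hx j
  have h2 := h j
  have : |x j - z j| ≤ |x j - w j| + |w j - z j| := abs_sub_le _ _ _
  have : ((m : ℤ) + k) ≤ n := by exact_mod_cast hk
  linarith

lemma mem_box_comm {z w : V d} {n : ℕ} : w ∈ box z n ↔ z ∈ box w n := by
  simp only [box, Set.mem_ofPred_eq]
  exact forall_congr' fun j => by rw [abs_sub_comm]

/-- a path from inside the box reaching outside hits the sphere inside the box -/
lemma Cn.hit {O : Set (E d)} {D : Set (V d)} {x w z : V d} {n : ℕ} (h : Cn O D x w)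
    (hx : x ∈ box z n) (hw : ∃ j, (n : ℤ) ≤ |w j - z j|) :
    ∃ w' ∈ sph z n, Cn O (D ∩ box z n) x w' := by
  by_cases hxs : ∃ j, |x j - z j| = n
  · exact ⟨x, ⟨hx, hxs⟩, Cn.refl _ _ _⟩
  · let S : Set (V d) := {x | ∀ j, |x j - z j| < n}
    have hxS : x ∈ S := fun j => lt_of_le_of_ne (hx j) fun h => hxs ⟨j, h⟩
    have hwS : w ∉ S := by
      obtain ⟨j, hj⟩ := hw
      intro h; exact absurd (h j) (not_lt.2 hj)
    obtain ⟨a, b, ha, hb, h1, h2, -⟩ := h.exit hxS hwS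
    have hSb : S ⊆ box z n := fun y hy j => (hy j).le
    have hbb : b ∈ box z n := by
      intro j
      have h3 := h2.1.abs_le j
      have h4 := ha j
      have : |b j - z j| ≤ |b j - a j| + |a j - z j| := abs_sub_le _ _ _
      omega
    refine ⟨b, ⟨hbb, ?_⟩, (h1.mono le_rfl (Set.inter_subset_inter_right _ hSb)).trans
      (Cn.single ⟨h2.1, ⟨h2.2.1, hSb ha⟩, ⟨h2.2.2.1, hbb⟩, h2.2.2.2⟩)⟩
    simp only [S, Set.mem_ofPred_eq, not_forall, not_lt] at hb
    obtain ⟨j, hj⟩ := hb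
    exact ⟨j, le_antisymm (hbb j) hj⟩

/-- `z` connected to the sphere of radius `n` -/
def Th (z : V d) (n : ℕ) : Set (E d → Bool) := {ω | ∃ w ∈ sph z n, Cn (op ω) (box z n) z w}

lemma LD.biUnion_ex {ι α : Type*} {s : Set α} {S : Set ι} (hS : S.Finite)
    {P : α → (ι → Bool) → Prop}
    (h : ∀ a ∈ s, LD {ω | P a ω} S) : LD {ω | ∃ a ∈ s, P a ω} S :=
  ⟨hS, fun ω ω' hw ⟨a, ha, h1⟩ => ⟨a, ha, (h a ha).dep ω ω' hw h1⟩⟩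

lemma LD_Th (z : V d) (n : ℕ) : LD (Th z n) (eIn (box z n)) :=
  LD.biUnion_ex (eIn_finite (box_finite z n)) fun w _ => LD_Cn (box_finite z n) z w

lemma Inc_Th (z : V d) (n : ℕ) : Inc (Th z n) := fun ω ω' hw ⟨w, hw1, h⟩ =>
  ⟨w, hw1, Inc_Cn _ _ _ ω ω' hw h⟩

lemma Th_of_Cn {ω : E d → Bool} {D : Set (V d)} {z w : V d} {n : ℕ} (h : Cn (op ω) D z w)
    (hw : ∃ j, (n : ℤ) ≤ |w j - z j|) : ω ∈ Th z n := by
  obtain ⟨w', h1, h2⟩ := h.hit (self_mem_box z n) hw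
  exact ⟨w', h1, h2.mono le_rfl Set.inter_subset_right⟩

lemma Th_anti (z : V d) {m n : ℕ} (h : m ≤ n) : Th z n ⊆ Th z m := by
  rintro ω ⟨w, hw, hc⟩
  refine Th_of_Cn hc ?_
  obtain ⟨j, hj⟩ := hw.2
  exact ⟨j, by rw [hj]; exact_mod_cast h⟩

/-! ### Graph automorphisms -/

/-- pull back along an automorphism -/
def pull (σ : V d → V d) (ω : E d → Bool) : E d → Bool := fun e => ω (e.map σ)

lemma Pr_pull {σ : V d → V d} (hσ : Function.Injective σ) (p : ℝ) {A : Set (E d → Bool)}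
    {S : Set (E d)} (hA : LD A S) :
    Pr (fun _ => p) {ω | pull σ ω ∈ A} = Pr (fun _ => p) A :=
  Pr_comp (fun _ => p) (Sym2.map.injective hσ) hA

lemma Cn_pull {σ : V d → V d} (hσ : ∀ x y, Adj x y → Adj (σ x) (σ y)) {ω : E d → Bool}
    {D D' : Set (V d)} (hD : ∀ x ∈ D, σ x ∈ D') {x y : V d} (h : Cn (op (pull σ ω)) D x y) :
    Cn (op ω) D' (σ x) (σ y) := by
  induction h with
  | refl => exact Cn.refl _ _ _
  | tail _ h ih =>
    refine ih.trans (Cn.single ⟨hσ _ _ h.1, hD _ h.2.1, hD _ h.2.2.1, ?_⟩)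
    have := h.2.2.2
    simpa [op, pull] using this

lemma Adj_add (z : V d) {x y : V d} (h : Adj x y) : Adj (x + z) (y + z) := by
  obtain ⟨i, h | h⟩ := h
  · exact ⟨i, Or.inl (by rw [h]; abel)⟩
  · exact ⟨i, Or.inr (by rw [h]; abel)⟩

lemma pull_pull (σ τ : V d → V d) (ω : E d → Bool) (h : ∀ x, σ (τ x) = x) :
    pull τ (pull σ ω) = ω := by
  funext e
  simp only [pull, Sym2.map_map]
  congr 1
  have : σ ∘ τ = id := funext h
  rw [this, Sym2.map_id]; rfl

lemma mem_box_add {z x a : V d} {n : ℕ} : x + a ∈ box (z + a) n ↔ x ∈ box z n := by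
  simp [box]
lemma mem_sph_add {z x a : V d} {n : ℕ} : x + a ∈ sph (z + a) n ↔ x ∈ sph z n := by
  simp [sph, mem_box_add]

lemma Pr_Th (p : ℝ) (z : V d) (n : ℕ) : Pr (fun _ => p) (Th z n) =
    Pr (fun _ => p) (Th (0 : V d) n) := by
  rw [← Pr_pull (σ := fun x => x + z) (add_left_injective z) p (LD_Th 0 n)]
  congr 1
  ext ω
  constructor
  · rintro ⟨w, hw, h⟩
    refine ⟨w - z, ?_, ?_⟩
    · rw [← mem_sph_add (a := z)]; simpa using hw
    · rw [← pull_pull (fun x => x + z) (fun x => x - z) ω (by simp)] at h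
      have := Cn_pull (σ := fun x => x - z) (fun x y h => by
        simpa [sub_eq_add_neg] using Adj_add (-z) h) (D' := box 0 n) (fun x hx => by
          rw [← mem_box_add (a := z)]; simpa using hx) h
      simpa using this
  · rintro ⟨w, hw, h⟩
    refine ⟨w + z, ?_, ?_⟩
    · have := (mem_sph_add (a := z)).2 hw
      simpa using this
    · have := Cn_pull (σ := fun x => x + z) (fun x y h => Adj_add z h) (D' := box z n)
        (fun x hx => by
          have := (mem_box_add (a := z)).2 hx
          simpa using this) h
      simpa using this

/-- one-arm probability -/
def th (d : ℕ) (n : ℕ) (p : ℝ) : ℝ := Pr (fun _ => p) (Th (0 : V d) n)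

lemma th_nonneg (n : ℕ) (p : ℝ) : 0 ≤ th d n p := Pr_nonneg _ _
lemma th_le_one (n : ℕ) (p : ℝ) : th d n p ≤ 1 := Pr_le_one _ _
lemma th_anti (p : ℝ) {m n : ℕ} (h : m ≤ n) : th d n p ≤ th d m p := Pr_mono _ (Th_anti 0 h)
lemma th_mono (n : ℕ) {p q : ℝ} (h : p ≤ q) : th d n p ≤ th d n q :=
  Pr_le_of_le (fun _ => h) (LD_Th 0 n) (Inc_Th 0 n)

/-! ### Interface with the frozen definitions -/

lemma Pr_eq_finsum {ι : Type*} [Finite ι] {p : ℝ} (h0 : 0 ≤ p) (h1 : p ≤ 1)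
    (A : Set (ι → Bool)) :
    (∑ᶠ ω ∈ A, ∏ᶠ i : ι, (if ω i then p else 1 - p)) = Pr (fun _ : ι => p) A := by
  classical
  have : Fintype ι := Fintype.ofFinite _
  rw [pm_finite, finsum_mem_eq_finite_toFinset_sum _ (Set.toFinite A), cl_eq h0 h1]
  simp_rw [finprod_eq_prod_of_fintype, mul_ite, mul_one, mul_zero]
  rw [← Finset.sum_filter]
  exact Finset.sum_congr (by ext; simp) fun _ _ => rfl

lemma stdVec_inj {i j : Fin d} (h : stdVec d i = stdVec d j) : i = j := by
  by_contra hne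
  have := congrFun h i
  simp [stdVec, hne] at this

lemma edge_inj {x y : V d} {i j : Fin d} (h : s(x, x + stdVec d i) = s(y, y + stdVec d j)) :
    x = y ∧ i = j := by
  rw [Sym2.eq_iff] at h
  rcases h with ⟨rfl, h⟩ | ⟨h1, h2⟩
  · exact ⟨rfl, stdVec_inj (add_left_cancel h)⟩
  · exfalso
    rw [h1] at h2
    have := congrFun h2 j
    simp only [Pi.add_apply, stdVec, if_true] at this
    split_ifs at this <;> omega

lemma zprob_eq {p : ℝ} (h0 : 0 ≤ p) (h1 : p ≤ 1) (M : ℕ) :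
    ZLattice.prob d M p (ZLattice.reachBoundary d M) = th d M p := by
  have hbox : ∀ x : V d, x ∈ box (0 : V d) M ↔ ∀ j, |x j| ≤ M := fun x => by simp [box]
  have hfin : {e : (Fin d → ℤ) × Fin d | ZLattice.inBox d M e}.Finite := by
    refine ((box_finite (0 : V d) M).prod (Set.finite_univ (α := Fin d))).subset ?_
    intro e he
    exact ⟨(hbox _).2 he.1, trivial⟩
  have : Finite {e : (Fin d → ℤ) × Fin d // ZLattice.inBox d M e} := hfin
  unfold ZLattice.prob
  rw [Pr_eq_finsum h0 h1]
  let g : {e : (Fin d → ℤ) × Fin d // ZLattice.inBox d M e} → E d :=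
    fun e => s(e.1.1, e.1.1 + stdVec d e.1.2)
  have hg : Function.Injective g := by
    rintro ⟨⟨x, i⟩, hx⟩ ⟨⟨y, j⟩, hy⟩ h
    have := edge_inj h
    simpa using this
  rw [← Pr_comp (fun _ => p) hg (S := Set.univ) ⟨Set.toFinite _, fun ω ω' hw h => by
    have : ω = ω' := funext fun i => hw i trivial
    rwa [← this]⟩]
  unfold th
  congr 1
  ext ω
  have hst : ∀ x y, ZLattice.step d M (fun k => ω (g k)) x y ↔ stp (op ω) (box 0 M) x y := by
    intro x y
    constructor
    · rintro (⟨i, rfl, hb, ho⟩ | ⟨i, rfl, hb, ho⟩)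
      · exact ⟨⟨i, Or.inl rfl⟩, (hbox _).2 hb.1, (hbox _).2 hb.2, ho⟩
      · exact ⟨⟨i, Or.inr rfl⟩, (hbox _).2 hb.2, (hbox _).2 hb.1, by rw [Sym2.eq_swap]; exact ho⟩
    · rintro ⟨⟨i, rfl | rfl⟩, hx, hy, ho⟩
      · exact Or.inl ⟨i, rfl, ⟨(hbox _).1 hx, (hbox _).1 hy⟩, ho⟩
      · exact Or.inr ⟨i, rfl, ⟨(hbox _).1 hy, (hbox _).1 hx⟩, by
          rw [Sym2.eq_swap] at ho; exact ho⟩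
  have hst' : ZLattice.step d M (fun k => ω (g k)) = stp (op ω) (box 0 M) := by
    funext x y; exact propext (hst x y)
  have h0b : (0 : V d) ∈ box (0 : V d) M := self_mem_box _ _
  simp only [ZLattice.reachBoundary, Set.mem_ofPred_eq, ZLattice.connected, hst', Th]
  constructor
  · rintro ⟨y, ⟨j, hj⟩, h⟩
    exact ⟨y, ⟨Cn.mem h h0b, j, by simpa using hj⟩, h⟩
  · rintro ⟨y, ⟨_, j, hj⟩, h⟩
    exact ⟨y, ⟨j, by simpa using hj⟩, h⟩

lemma theta_eq {p : ℝ} (h0 : 0 ≤ p) (h1 : p ≤ 1) : ZLattice.theta d p = ⨅ M, th d M p := by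
  unfold ZLattice.theta
  exact iInf_congr fun M => zprob_eq h0 h1 M

lemma th_bdd (p : ℝ) : BddBelow (Set.range fun M => th d M p) :=
  ⟨0, by rintro _ ⟨M, rfl⟩; exact th_nonneg _ _⟩

lemma tprob_eq {N : ℕ} (hN : 1 ≤ N) {p : ℝ} (h0 : 0 ≤ p) (h1 : p ≤ 1)
    (A : Set (TorusPerc.Config d N)) :
    TorusPerc.prob d N p A = Pr (fun _ => p) A := by
  have : NeZero N := ⟨by omega⟩
  exact Pr_eq_finsum h0 h1 A

end
end Perc

open MeasureTheory ProbabilityTheory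

namespace Perc

noncomputable section

variable {d : ℕ}

/-! ### Part 1: subcritical sharpness (Duminil-Copin–Tassion) -/

open Classical in
/-- directed boundary edges of `S` -/
def bd (S : Finset (V d)) : Finset (V d × V d) :=
  S.biUnion fun x => ((box_finite x 1).toFinset.filter fun y => Adj x y ∧ y ∉ S).image fun y => (x, y)

lemma mem_bd {S : Finset (V d)} {x y : V d} : (x, y) ∈ bd S ↔ x ∈ S ∧ y ∉ S ∧ Adj x y := by
  classical
  simp only [bd, Finset.mem_biUnion, Finset.mem_image, Finset.mem_filter, Set.Finite.mem_toFinset,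
    Prod.mk.injEq]
  constructor
  · rintro ⟨a, ha, b, ⟨_, h1, h2⟩, rfl, rfl⟩
    exact ⟨ha, h2, h1⟩
  · rintro ⟨h1, h2, h3⟩
    exact ⟨x, h1, y, ⟨fun j => by simpa using h3.abs_le j, h3, h2⟩, rfl, rfl⟩

/-- `0` connected to `x` in `S` -/
def In (S : Finset (V d)) (x : V d) : Set (E d → Bool) := {ω | Cn (op ω) S 0 x}

lemma LD_In (S : Finset (V d)) (x : V d) : LD (In S x) (eIn (S : Set (V d))) :=
  LD_Cn S.finite_toSet 0 x

def phi (p : ℝ) (S : Finset (V d)) : ℝ := ∑ e ∈ bd S, p * Pr (fun _ => p) (In S e.1)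

lemma phi_nonneg {p : ℝ} (h0 : 0 ≤ p) (S : Finset (V d)) : 0 ≤ phi p S :=
  Finset.sum_nonneg fun _ _ => mul_nonneg h0 (Pr_nonneg _ _)

lemma phi_mono {p q : ℝ} (h0 : 0 ≤ p) (h : p ≤ q) (S : Finset (V d)) : phi p S ≤ phi q S :=
  Finset.sum_le_sum fun e _ => mul_le_mul h
    (Pr_le_of_le (fun _ => h) (LD_In S e.1) (Inc_Cn _ _ _)) (Pr_nonneg _ _) (h0.trans h)

/-- the cluster of `0` in `S` is `C` -/
def Clu (S C : Finset (V d)) : Set (E d → Bool) := {ω | ∀ x, x ∈ C ↔ Cn (op ω) S 0 x}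

lemma LD_Clu (S C : Finset (V d)) :
    LD (Clu S C) {e | e ∈ eIn (S : Set (V d)) ∧ ∃ v ∈ e, v ∈ C} := by
  refine ⟨(eIn_finite S.finite_toSet).subset fun e he => he.1, fun ω ω' hw h x => ?_⟩
  have key : ∀ b c, b ∈ C → b ∈ (S : Set (V d)) → c ∈ (S : Set (V d)) → ω s(b, c) = ω' s(b, c) := by
    intro b c h1 h2 h3
    exact hw _ ⟨mk_mem_eIn.2 ⟨h2, h3⟩, b, by simp, h1⟩
  constructor
  · intro hx
    have := (h x).1 hx
    clear hx
    induction this with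
    | refl => exact Cn.refl _ _ _
    | @tail b c h1 h2 ih =>
      refine ih.trans (Cn.single ⟨h2.1, h2.2.1, h2.2.2.1, ?_⟩)
      have := h2.2.2.2
      simp only [op, Set.mem_ofPred_eq] at this ⊢
      rw [← key b c ((h b).2 h1) h2.2.1 h2.2.2.1, this]
  · intro hx
    induction hx with
    | refl => exact (h 0).2 (Cn.refl _ _ _)
    | @tail b c h1 h2 ih =>
      refine (h c).2 (((h b).1 ih).trans (Cn.single ⟨h2.1, h2.2.1, h2.2.2.1, ?_⟩))
      have := h2.2.2.2
      simp only [op, Set.mem_ofPred_eq] at this ⊢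
      rw [key b c ih h2.2.1 h2.2.2.1, this]

lemma Clu_disj (S : Finset (V d)) {C C' : Finset (V d)} (h : C ≠ C') :
    Disjoint (Clu S C) (Clu S C') := by
  rw [Set.disjoint_left]
  intro ω h1 h2
  exact h (Finset.ext fun x => (h1 x).trans (h2 x).symm)

lemma Clu_exists (S : Finset (V d)) (h0 : (0 : V d) ∈ S) (ω : E d → Bool) :
    ∃ C ∈ S.powerset, ω ∈ Clu S C := by
  classical
  refine ⟨S.filter fun x => Cn (op ω) S 0 x, by simp, fun x => ?_⟩
  simp only [Finset.mem_filter, and_iff_right_iff_imp]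
  intro h
  exact Cn.mem h h0

lemma decay_step {p : ℝ} (hp0 : 0 ≤ p) (hp1 : p ≤ 1) {S : Finset (V d)} (h0 : (0 : V d) ∈ S) {K : ℕ}
    (hS : (S : Set (V d)) ⊆ box 0 K) (L : ℕ) : th d (L + (K + 1)) p ≤ phi p S * th d L p := by
  classical
  set R := L + (K + 1) with hR
  let G : Finset (V d) → V d → Set (E d → Bool) := fun C y =>
    {ω | ∃ w ∈ {w : V d | ∃ j, (L : ℤ) ≤ |w j - y j|}, Cn (op ω) (box 0 R \ C) y w}
  have hG : ∀ C y, LD (G C y) (eIn (box (0 : V d) R \ (C : Set (V d)))) := fun C y =>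
    LD.biUnion_ex (eIn_finite ((box_finite _ _).sdiff)) fun w _ => LD_Cn ((box_finite _ _).sdiff) y w
  have hGT : ∀ C y, G C y ⊆ Th y L := by
    rintro C y ω ⟨w, hw, h⟩
    exact Th_of_Cn h hw
  have hsub : Th (0 : V d) R ⊆ ⋃ e ∈ bd S, ⋃ C ∈ S.powerset.filter (fun C => e.1 ∈ C),
      (Clu S C ∩ ({ω | ω s(e.1, e.2) = true} ∩ G C e.2)) := by
    rintro ω ⟨w, hw, hc⟩
    obtain ⟨C, hC, hω⟩ := Clu_exists S h0 ω
    have hCS : C ⊆ S := Finset.mem_powerset.1 hC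
    have h0C : (0 : V d) ∈ (C : Set (V d)) := (hω 0).2 (Cn.refl _ _ _)
    have hwC : w ∉ (C : Set (V d)) := by
      intro h
      obtain ⟨j, hj⟩ := hw.2
      have := hS (hCS h) j
      rw [hj] at this
      have : R ≤ K := by exact_mod_cast this
      omega
    obtain ⟨a, b, ha, hb, h1, h2, h3⟩ := hc.last_exit h0C hwC
    have hbS : b ∉ S := by
      intro hbS
      apply hb
      refine (hω b).2 (((hω a).1 ha).trans (Cn.single ⟨h2.1, hCS ha, hbS, h2.2.2.2⟩))
    simp only [Set.mem_iUnion]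
    refine ⟨(a, b), mem_bd.2 ⟨hCS ha, hbS, h2.1⟩, C, ?_, hω, h2.2.2.2, w, ?_, h3⟩
    · simp only [Finset.mem_filter]; exact ⟨hC, ha⟩
    · obtain ⟨j, hj⟩ := hw.2
      refine ⟨j, ?_⟩
      have h4 := hS (hCS ha) j
      have h5 := h2.1.abs_le j
      simp only [Pi.zero_apply, sub_zero] at h4 hj
      have h6 : |w j| ≤ |w j - b j| + |b j - a j| + |a j| := by
        have := abs_add_three (w j - b j) (b j - a j) (a j)
        simpa using this
      rw [hj] at h6
      have h7 : (R : ℤ) = L + (K + 1) := by rw [hR]; push_cast; ring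
      dsimp only
      linarith
  have hprob : ∀ e ∈ bd S, ∀ C ∈ S.powerset.filter (fun C => e.1 ∈ C),
      Pr (fun _ => p) (Clu S C ∩ ({ω | ω s(e.1, e.2) = true} ∩ G C e.2)) ≤
        Pr (fun _ => p) (Clu S C) * (p * th d L p) := by
    rintro ⟨x, y⟩ he C hC
    obtain ⟨hx, hy, hxy⟩ := mem_bd.1 he
    simp only [Finset.mem_filter] at hC
    rw [Pr_inter _ (LD_Clu S C) ((LD_coord s(x,y) true).inter' (hG C y)),
      Pr_inter _ (LD_coord s(x,y) true) (hG C y), Pr_coord, cl_eq hp0 hp1]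
    · refine mul_le_mul_of_nonneg_left (mul_le_mul_of_nonneg_left ?_ hp0) (Pr_nonneg _ _)
      exact (Pr_mono _ (hGT C y)).trans (le_of_eq (Pr_Th p y L))
    · rw [Set.disjoint_singleton_left, mk_mem_eIn]
      exact fun h => h.1.2 hC.2
    · rw [Set.disjoint_union_right]
      constructor
      · rw [Set.disjoint_singleton_right]
        rintro ⟨h, _⟩
        exact hy (mk_mem_eIn.1 h).2
      · rw [Set.disjoint_left]
        rintro e ⟨_, v, hv, hvC⟩ h2
        exact (h2 v hv).2 hvC
  have hsum : ∀ e ∈ bd S, ∑ C ∈ S.powerset.filter (fun C => e.1 ∈ C), Pr (fun _ => p) (Clu S C) ≤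
      Pr (fun _ => p) (In S e.1) := by
    intro e _
    rw [← Pr_sum_disjoint (fun _ => p) _ (fun C _ => LD_Clu S C)
      (fun C _ C' _ h => Clu_disj S h)]
    apply Pr_mono
    intro ω hω
    simp only [Set.mem_iUnion] at hω
    obtain ⟨C, hC, hω⟩ := hω
    simp only [Finset.mem_filter] at hC
    exact (hω e.1).1 hC.2
  calc th d R p ≤ ∑ e ∈ bd S, ∑ C ∈ S.powerset.filter (fun C => e.1 ∈ C),
        Pr (fun _ => p) (Clu S C ∩ ({ω | ω s(e.1, e.2) = true} ∩ G C e.2)) :=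
        (Pr_mono _ hsub).trans ((Pr_biUnion_le _ _ _).trans
          (Finset.sum_le_sum fun e _ => Pr_biUnion_le _ _ _))
    _ ≤ ∑ e ∈ bd S, ∑ C ∈ S.powerset.filter (fun C => e.1 ∈ C),
        Pr (fun _ => p) (Clu S C) * (p * th d L p) :=
        Finset.sum_le_sum fun e he => Finset.sum_le_sum fun C hC => hprob e he C hC
    _ ≤ ∑ e ∈ bd S, Pr (fun _ => p) (In S e.1) * (p * th d L p) := by
        refine Finset.sum_le_sum fun e he => ?_
        rw [← Finset.sum_mul]
        exact mul_le_mul_of_nonneg_right (hsum e he) (mul_nonneg hp0 (th_nonneg _ _))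
    _ = phi p S * th d L p := by
        rw [phi, Finset.sum_mul]
        exact Finset.sum_congr rfl fun e _ => by ring

lemma exp_decay {p : ℝ} (hp0 : 0 ≤ p) (hp1 : p ≤ 1) {S : Finset (V d)} (h0 : (0 : V d) ∈ S)
    (hφ : phi p S < 1) : ∃ K : ℕ, ∀ k : ℕ, th d (k * (K + 1)) p ≤ phi p S ^ k := by
  have : ∃ K : ℕ, (S : Set (V d)) ⊆ box 0 K := by
    refine ⟨S.sup fun x => Finset.univ.sup fun j => (x j).natAbs, fun x hx j => ?_⟩
    have h1 : (x j).natAbs ≤ Finset.univ.sup fun j => (x j).natAbs :=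
      Finset.le_sup (f := fun j => (x j).natAbs) (Finset.mem_univ j)
    have h2 : (Finset.univ.sup fun j => (x j).natAbs) ≤
        S.sup fun x => Finset.univ.sup fun j => (x j).natAbs :=
      Finset.le_sup (f := fun x : V d => Finset.univ.sup fun j => (x j).natAbs) hx
    have := h1.trans h2
    simp only [Pi.zero_apply, sub_zero]
    rw [Int.abs_eq_natAbs]
    exact_mod_cast this
  obtain ⟨K, hK⟩ := this
  refine ⟨K, fun k => ?_⟩
  induction k with
  | zero => simpa using th_le_one (d := d) 0 p
  | succ k ih =>
    have := decay_step hp0 hp1 h0 hK (k * (K + 1))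
    rw [pow_succ', Nat.succ_mul]
    exact this.trans (mul_le_mul_of_nonneg_left ih (phi_nonneg hp0 S))

/-- boxes as finsets -/
def bx (d n : ℕ) : Finset (V d) := (box_finite (0 : V d) n).toFinset

lemma mem_bx {n : ℕ} {x : V d} : x ∈ bx d n ↔ x ∈ box (0 : V d) n := by simp [bx]

/-- the set of points of the box not connected to the boundary is `S` -/
def Sv (n : ℕ) (S : Finset (V d)) : Set (E d → Bool) :=
  {ω | ∀ x ∈ box (0 : V d) n, x ∈ S ↔ ¬ ∃ w ∈ sph (0 : V d) n, Cn (op ω) (box 0 n) x w}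

lemma LD_Sv (n : ℕ) (S : Finset (V d)) :
    LD (Sv n S) (eIn (box (0 : V d) n) \ eIn (S : Set (V d))) := by
  refine ⟨(eIn_finite (box_finite _ _)).sdiff, fun ω ω' hw h => ?_⟩
  have key : ∀ b c, b ∉ S → b ∈ box (0 : V d) n → c ∈ box (0 : V d) n →
      ω s(b, c) = ω' s(b, c) := by
    intro b c h1 h2 h3
    exact hw _ ⟨mk_mem_eIn.2 ⟨h2, h3⟩, fun h => h1 (mk_mem_eIn.1 h).1⟩
  have hA : ∀ x ∈ box (0 : V d) n, x ∉ S → ∃ w ∈ sph (0 : V d) n, Cn (op ω') (box 0 n) x w := by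
    intro x hx hxS
    have h1 := (not_congr (h x hx)).1 hxS
    rw [not_not] at h1
    obtain ⟨w, hw1, hc⟩ := h1
    refine ⟨w, hw1, ?_⟩
    clear hx hxS
    induction hc using Relation.ReflTransGen.head_induction_on with
    | refl => exact Cn.refl _ _ _
    | @head a c h1 h2 ih =>
      refine (Cn.single ⟨h1.1, h1.2.1, h1.2.2.1, ?_⟩).trans ih
      have haS : a ∉ S := by
        rw [h a h1.2.1, not_not]
        exact ⟨w, hw1, Relation.ReflTransGen.head h1 h2⟩
      have := h1.2.2.2
      simp only [op, Set.mem_ofPred_eq] at this ⊢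
      rw [← key a c haS h1.2.1 h1.2.2.1, this]
  intro x hx
  constructor
  · rintro hxS ⟨w, hw1, hc⟩
    have hwS : w ∉ (S : Set (V d)) := by
      intro hwS
      exact (h w hw1.1).1 hwS ⟨w, hw1, Cn.refl _ _ _⟩
    obtain ⟨a, b, ha, hb, -, h2, -⟩ := hc.exit (S := (S : Set (V d))) hxS hwS
    have h3 : ∃ w ∈ sph (0 : V d) n, Cn (op ω) (box 0 n) b w := by
      have := (not_congr (h b h2.2.2.1)).1 hb
      rwa [not_not] at this
    obtain ⟨w', hw', hc'⟩ := h3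
    refine (h a h2.2.1).1 ha ⟨w', hw', Relation.ReflTransGen.head ⟨h2.1, h2.2.1, h2.2.2.1, ?_⟩ hc'⟩
    have := h2.2.2.2
    simp only [op, Set.mem_ofPred_eq] at this ⊢
    rw [Sym2.eq_swap, key b a hb h2.2.2.1 h2.2.1, Sym2.eq_swap, this]
  · intro hn
    by_contra hxS
    exact hn (hA x hx hxS)

lemma Sv_disj (n : ℕ) {S S' : Finset (V d)} (hS : S ⊆ bx d n) (hS' : S' ⊆ bx d n) (h : S ≠ S') :
    Disjoint (Sv n S) (Sv n S') := by
  rw [Set.disjoint_left]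
  intro ω h1 h2
  apply h
  ext x
  constructor
  · intro hx
    have hb := mem_bx.1 (hS hx)
    exact (h2 x hb).2 ((h1 x hb).1 hx)
  · intro hx
    have hb := mem_bx.1 (hS' hx)
    exact (h1 x hb).2 ((h2 x hb).1 hx)

lemma Sv_sum (n : ℕ) (p : ℝ) :
    ∑ S ∈ (bx d n).powerset.filter (fun S => (0 : V d) ∈ S), Pr (fun _ => p) (Sv n S)
      = 1 - th d n p := by
  classical
  rw [← Pr_sum_disjoint (fun _ => p) _ (fun S _ => LD_Sv n S), th, ← Pr_compl _ (LD_Th 0 n)]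
  · congr 1
    ext ω
    simp only [Set.mem_iUnion, Set.mem_compl_iff]
    constructor
    · rintro ⟨S, hS, hω⟩ hT
      exact (hω 0 (self_mem_box _ _)).1 (Finset.mem_filter.1 hS).2 hT
    · intro hT
      refine ⟨(bx d n).filter fun x => ¬ ∃ w ∈ sph (0 : V d) n, Cn (op ω) (box 0 n) x w, ?_, ?_⟩
      · simp only [Finset.mem_filter, Finset.mem_powerset, Finset.filter_subset, true_and]
        exact ⟨mem_bx.2 (self_mem_box _ _), hT⟩
      · intro x hx
        simp only [Finset.mem_filter, mem_bx, hx, true_and]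
  · intro S hS S' hS' h
    exact Sv_disj n (Finset.mem_powerset.1 (Finset.mem_filter.1 hS).1)
      (Finset.mem_powerset.1 (Finset.mem_filter.1 hS').1) h

end
end Perc

open MeasureTheory ProbabilityTheory

namespace Perc

noncomputable section

variable {d : ℕ}

lemma sprinkle {n M : ℕ} {p δ : ℝ} (hp0 : 0 ≤ p) (hp1 : p ≤ 1) (hδ0 : 0 ≤ δ) (hδ1 : δ ≤ 1)
    (hM : ∀ S : Finset (V d), S ⊆ bx d n → (bd S).card ≤ M) (hδM : δ * M ≤ 1 / 2)
    (hφ : ∀ S : Finset (V d), (0 : V d) ∈ S → 1 ≤ phi p S) :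
    th d n p + δ / 2 * (1 - th d n p) ≤ th d n (p + δ) := by
  classical
  let w : E d × Bool → ℝ := fun x => if x.2 then δ else p
  let g : E d → E d × Bool := fun e => (e, false)
  have hg : Function.Injective g := fun a b h => by simpa [g] using h
  let FS := (bx d n).powerset.filter (fun S => (0 : V d) ∈ S)
  let ed : V d × V d → E d := fun e => s(e.1, e.2)
  let Ot : Finset (V d) → V d × V d → Finset (E d × Bool) := fun S e =>
    (((bd S).erase e).image ed).image fun f => (f, true)
  let H1 : Finset (V d) → Set (E d × Bool → Bool) := fun S => {ω | (fun k => ω (g k)) ∈ Sv n S}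
  let H2 : Finset (V d) → V d × V d → Set (E d × Bool → Bool) := fun S e =>
    {ω | (fun k => ω (g k)) ∈ In S e.1}
  let H3 : V d × V d → Set (E d × Bool → Bool) := fun e => {ω | ω (ed e, true) = true}
  let H4 : Finset (V d) → V d × V d → Set (E d × Bool → Bool) := fun S e =>
    {ω | ∀ i ∈ Ot S e, ω i = false}
  let H : (Σ _ : Finset (V d), V d × V d) → Set (E d × Bool → Bool) := fun x =>
    H1 x.1 ∩ (H2 x.1 x.2 ∩ (H3 x.2 ∩ H4 x.1 x.2))
  let IS : Finset (Σ _ : Finset (V d), V d × V d) := FS.sigma fun S => bd S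
  have L1 : ∀ S, LD (H1 S) _ := fun S => (LD_Sv n S).comp g
  have L2 : ∀ S e, LD (H2 S e) _ := fun S e => (LD_In S e.1).comp g
  have L3 : ∀ e, LD (H3 e) _ := fun e => LD_coord (ed e, true) true
  have L4 : ∀ S e, LD (H4 S e) _ := fun S e => LD_all (Ot S e) false
  have LH : ∀ x, LD (H x) _ := fun x => (L1 x.1).inter' ((L2 x.1 x.2).inter' ((L3 x.2).inter'
    (L4 x.1 x.2)))
  -- edges of the boundary are determined
  have hed : ∀ S : Finset (V d), ∀ e ∈ bd S, ∀ f ∈ bd S, ed e = ed f → e = f := by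
    rintro S ⟨a, b⟩ he ⟨a', b'⟩ hf h
    obtain ⟨h1, h2, -⟩ := mem_bd.1 he
    obtain ⟨h3, h4, -⟩ := mem_bd.1 hf
    simp only [ed, Sym2.eq_iff] at h
    rcases h with ⟨rfl, rfl⟩ | ⟨rfl, rfl⟩
    · rfl
    · exact absurd h1 h4
  have hmemFS : ∀ S ∈ FS, S ⊆ bx d n ∧ (0 : V d) ∈ S := fun S hS => by
    simpa [FS] using hS
  have hdisj : ∀ x ∈ IS, ∀ y ∈ IS, x ≠ y → Disjoint (H x) (H y) := by
    rintro ⟨S, e⟩ hx ⟨S', e'⟩ hy hne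
    simp only [IS, Finset.mem_sigma] at hx hy
    rw [Set.disjoint_left]
    rintro ω ⟨h1, h2, h3, h4⟩ ⟨h1', h2', h3', h4'⟩
    dsimp only at h1 h2 h3 h4 h1' h2' h3' h4'
    by_cases hSS : S = S'
    · subst hSS
      have hee : e ≠ e' := by rintro rfl; exact hne rfl
      have := h4 (ed e', true) (by
        simp only [Ot, Finset.mem_image]
        exact ⟨ed e', ⟨e', Finset.mem_erase.2 ⟨hee.symm, hy.2⟩, rfl⟩, rfl⟩)
      simp only [H3, Set.mem_ofPred_eq] at h3'
      rw [h3'] at this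
      exact Bool.noConfusion this
    · exact (Set.disjoint_left.1 (Sv_disj n (hmemFS S hx.1).1 (hmemFS S' hy.1).1 hSS)) h1 h1'
  have hPr : ∀ x ∈ IS, Pr w (H x) = Pr (fun _ => p) (Sv n x.1) * (Pr (fun _ => p) (In x.1 x.2.1) *
      (δ * (1 - δ) ^ ((bd x.1).card - 1))) := by
    rintro ⟨S, e⟩ hx
    simp only [IS, Finset.mem_sigma] at hx
    dsimp only [H]
    rw [Pr_inter w (L1 S) ((L2 S e).inter' ((L3 e).inter' (L4 S e))),
      Pr_inter w (L2 S e) ((L3 e).inter' (L4 S e)), Pr_inter w (L3 e) (L4 S e)]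
    · have e1 : Pr w (H1 S) = Pr (fun _ => p) (Sv n S) := by
        rw [show Pr w (H1 S) = _ from Pr_comp w hg (LD_Sv n S)]; simp [w, g]
      have e2 : Pr w (H2 S e) = Pr (fun _ => p) (In S e.1) := by
        rw [show Pr w (H2 S e) = _ from Pr_comp w hg (LD_In S e.1)]; simp [w, g]
      have e3 : Pr w (H3 e) = δ := by
        rw [show Pr w (H3 e) = _ from Pr_coord w _]; simp [w, cl_eq hδ0 hδ1]
      have e4 : Pr w (H4 S e) = (1 - δ) ^ ((bd S).card - 1) := by
        rw [show Pr w (H4 S e) = _ from Pr_all_false w _]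
        rw [Finset.prod_image (by intro a _ b _ h; simpa using h)]
        simp only [w, if_true, cl_eq hδ0 hδ1, Finset.prod_const]
        rw [Finset.card_image_of_injOn, Finset.card_erase_of_mem hx.2]
        intro a ha b hb h
        exact hed S a (Finset.mem_of_mem_erase ha) b (Finset.mem_of_mem_erase hb) h
      rw [e1, e2, e3, e4]
    · rw [Set.disjoint_singleton_left]
      simp only [Ot, Finset.coe_image, Set.mem_image, Finset.mem_coe, Finset.mem_erase]
      rintro ⟨f, ⟨f', hf', rfl⟩, hf⟩
      exact hf'.1 (hed S f' hf'.2 e hx.2 (by simpa using hf))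
    · rw [Set.disjoint_left]
      rintro _ ⟨f, hf, rfl⟩ h
      rcases h with h | h
      · simp [g] at h
      · simp [g, Ot] at h
    · rw [Set.disjoint_left]
      rintro _ ⟨f, hf, rfl⟩ h
      rcases h with ⟨f', hf', h⟩ | h | h
      · obtain rfl := hg h
        exact hf.2 hf'
      · simp [g] at h
      · simp [g, Ot] at h
  -- inclusion
  let T : Set (E d × Bool → Bool) := {ω | (fun k => ω (g k)) ∈ Th (0 : V d) n}
  have LT : LD T _ := (LD_Th 0 n).comp g
  have hle : ∀ ω : E d × Bool → Bool, op (fun k => ω (g k)) ⊆ op (orMap (fun _ => Finset.univ) ω) :=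
    fun ω f hf => (orMap_true _ _ _).2 ⟨false, by simp, hf⟩
  have hsub : T ∪ (⋃ x ∈ IS, H x) ⊆ {ω | orMap (fun _ => Finset.univ) ω ∈ Th (0 : V d) n} := by
    rintro ω (h | h)
    · exact Inc_Th 0 n _ _ (fun i hi => hle ω hi) h
    · simp only [Set.mem_iUnion] at h
      obtain ⟨⟨S, a, b⟩, hx, h1, h2, h3, -⟩ := h
      simp only [IS, Finset.mem_sigma] at hx
      dsimp only at h1 h2 h3
      obtain ⟨ha, hb, hab⟩ := mem_bd.1 hx.2
      have haB : a ∈ box (0 : V d) n := mem_bx.1 ((hmemFS S hx.1).1 ha)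
      have h1' : ∀ x ∈ box (0 : V d) n, x ∈ S ↔ _ := h1
      have hbB : b ∈ box (0 : V d) n := by
        intro j
        by_contra hj
        have h4 := haB j
        have h5 := hab.abs_le j
        simp only [Pi.zero_apply, sub_zero, not_le] at hj h4
        have h6 : |b j| ≤ |b j - a j| + |a j| := by
          have := abs_add_le (b j - a j) (a j)
          simpa using this
        have h7 : |a j| = n := by omega
        exact (h1' a haB).1 ha ⟨a, ⟨haB, j, by simpa using h7⟩, Cn.refl _ _ _⟩
      have h8 := (not_congr (h1' b hbB)).1 hb
      rw [not_not] at h8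
      obtain ⟨w', hw', hc⟩ := h8
      refine ⟨w', hw', ?_⟩
      have hSB : (S : Set (V d)) ⊆ box (0 : V d) n := fun x hx' => mem_bx.1 ((hmemFS S hx.1).1 hx')
      have h9 : Cn (op (orMap (fun _ => Finset.univ) ω)) (box 0 n) 0 a := Cn.mono (hle ω) hSB h2
      refine h9.trans ((Cn.single ⟨hab, haB, hbB, ?_⟩).trans (Cn.mono (hle ω) le_rfl hc))
      exact (orMap_true _ _ _).2 ⟨true, by simp, h3⟩
  have hTd : Disjoint T (⋃ x ∈ IS, H x) := by
    rw [Set.disjoint_left]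
    intro ω h h'
    simp only [Set.mem_iUnion] at h'
    obtain ⟨⟨S, e⟩, hx, h1, -⟩ := h'
    simp only [IS, Finset.mem_sigma] at hx
    exact (h1 0 (self_mem_box _ _)).1 (hmemFS S hx.1).2 h
  have e0 : Pr w T = th d n p := by
    rw [show Pr w T = _ from Pr_comp w hg (LD_Th 0 n)]; simp [w, g, th]
  have hU : Pr w (⋃ x ∈ IS, H x) = ∑ x ∈ IS, Pr w (H x) :=
    Pr_sum_disjoint w IS (fun x _ => LH x) hdisj
  have hadd : Pr w (T ∪ ⋃ x ∈ IS, H x) = Pr w T + Pr w (⋃ x ∈ IS, H x) := by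
    rw [Set.union_comm, Pr_add w LT hTd.symm, add_comm]
  have hbig : Pr w {ω | orMap (fun _ => Finset.univ) ω ∈ Th (0 : V d) n} ≤ th d n (p + δ) := by
    rw [pm_orMap _ _ (LD_Th 0 n)]
    refine Pr_le_of_le (fun i => ?_) (LD_Th 0 n) (Inc_Th 0 n)
    simp only [Fintype.prod_bool, w, if_true, Bool.false_eq_true, if_false, cl_eq hp0 hp1,
      cl_eq hδ0 hδ1]
    nlinarith [mul_nonneg hp0 hδ0]
  have hlow : δ / 2 * (1 - th d n p) ≤ ∑ x ∈ IS, Pr w (H x) := by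
    rw [Finset.sum_congr rfl hPr, Finset.sum_sigma, ← Sv_sum, Finset.mul_sum]
    refine Finset.sum_le_sum fun S hS => ?_
    obtain ⟨hS1, hS2⟩ := hmemFS S hS
    dsimp only
    rw [← Finset.mul_sum, mul_comm]
    refine mul_le_mul_of_nonneg_left ?_ (Pr_nonneg _ _)
    rw [← Finset.sum_mul]
    have h1 : 1 ≤ ∑ e ∈ bd S, Pr (fun _ => p) (In S e.1) := by
      refine (hφ S hS2).trans (Finset.sum_le_sum fun e _ => ?_)
      exact mul_le_of_le_one_left (Pr_nonneg _ _) hp1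
    have h2 : 1 / 2 ≤ (1 - δ) ^ ((bd S).card - 1) := by
      have hb := one_add_mul_le_pow (a := -δ) (by linarith) ((bd S).card - 1)
      have hc : (((bd S).card - 1 : ℕ) : ℝ) ≤ M := by
        exact_mod_cast (Nat.sub_le _ _).trans (hM S hS1)
      have : δ * (((bd S).card - 1 : ℕ) : ℝ) ≤ δ * M := mul_le_mul_of_nonneg_left hc hδ0
      rw [sub_eq_add_neg]
      linarith
    have h3 : δ / 2 ≤ δ * (1 - δ) ^ ((bd S).card - 1) := by
      have := mul_le_mul_of_nonneg_left h2 hδ0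
      linarith
    calc δ / 2 ≤ 1 * (δ * (1 - δ) ^ ((bd S).card - 1)) := by linarith
      _ ≤ _ := mul_le_mul_of_nonneg_right h1 (by linarith)
  have := (Pr_mono w hsub).trans hbig
  rw [hadd, hU, e0] at this
  linarith

lemma supercrit_of_phi {p0 p1 : ℝ} (h0 : 0 ≤ p0) (h01 : p0 < p1) (h1 : p1 ≤ 1)
    (hφ : ∀ S : Finset (V d), (0 : V d) ∈ S → 1 ≤ phi p0 S) (n : ℕ) :
    1 - Real.exp (-((p1 - p0) / 2)) ≤ th d n p1 := by
  classical
  obtain ⟨M, hM⟩ : ∃ M : ℕ, ∀ S : Finset (V d), S ⊆ bx d n → (bd S).card ≤ M := by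
    refine ⟨(bx d n).powerset.sup fun S => (bd S).card, fun S hS => ?_⟩
    exact Finset.le_sup (f := fun S => (bd S).card) (Finset.mem_powerset.2 hS)
  obtain ⟨k, hk⟩ := exists_nat_gt (2 * ((M : ℝ) + 1))
  have hk0 : (0 : ℝ) < k := lt_of_le_of_lt (by positivity) hk
  set δ := (p1 - p0) / k with hδ
  have hδ0 : 0 ≤ δ := div_nonneg (by linarith) hk0.le
  have hδk : δ * k = p1 - p0 := by rw [hδ]; field_simp
  have hδM : δ * M ≤ 1 / 2 := by
    have : δ * (2 * ((M : ℝ) + 1)) ≤ δ * k := mul_le_mul_of_nonneg_left hk.le hδ0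
    nlinarith
  have hδ1 : δ ≤ 1 := by
    have : δ * (2 * ((M : ℝ) + 1)) ≤ δ * k := mul_le_mul_of_nonneg_left hk.le hδ0
    have : 0 ≤ δ * M := by positivity
    nlinarith
  have key : ∀ j : ℕ, j ≤ k → 1 - th d n (p0 + j * δ) ≤ (1 - δ / 2) ^ j := by
    intro j
    induction j with
    | zero => intro _; simp [th_nonneg]
    | succ j ih =>
      intro hj
      have ih := ih (by omega)
      have hpj : p0 + j * δ ≤ p1 := by
        have : (j : ℝ) * δ ≤ k * δ := mul_le_mul_of_nonneg_right (by exact_mod_cast (by omega)) hδ0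
        linarith
      have hpj0 : p0 ≤ p0 + j * δ := by
        have : 0 ≤ (j : ℝ) * δ := by positivity
        linarith
      have := sprinkle (d := d) (n := n) (M := M) (p := p0 + j * δ) (δ := δ) (h0.trans hpj0)
        (hpj.trans h1) hδ0 hδ1 hM hδM (fun S hS => (hφ S hS).trans (phi_mono h0 hpj0 S))
      have e : p0 + ((j + 1 : ℕ) : ℝ) * δ = p0 + j * δ + δ := by push_cast; ring
      rw [e, pow_succ]
      nlinarith
  have h2 := key k le_rfl
  have e : p0 + k * δ = p1 := by linarith
  rw [e] at h2
  have h3 : (1 - δ / 2) ^ k ≤ Real.exp (-((p1 - p0) / 2)) := by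
    have : 1 - δ / 2 ≤ Real.exp (-(δ / 2)) := by
      have := Real.add_one_le_exp (-(δ / 2)); linarith
    calc (1 - δ / 2) ^ k ≤ Real.exp (-(δ / 2)) ^ k := pow_le_pow_left₀ (by linarith) this k
      _ = Real.exp (-((p1 - p0) / 2)) := by
        rw [← Real.exp_nat_mul]; congr 1
        linarith
  linarith

/-- exponential decay below criticality -/
lemma subcrit_decay {p p1 : ℝ} (h0 : 0 ≤ p) (h01 : p < p1) (h1 : p1 ≤ 1)
    (hθ : ZLattice.theta d p1 = 0) : ∃ (K : ℕ) (r : ℝ), 0 ≤ r ∧ r < 1 ∧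
      ∀ k : ℕ, th d (k * (K + 1)) p ≤ r ^ k := by
  by_cases hφ : ∀ S : Finset (V d), (0 : V d) ∈ S → 1 ≤ phi p S
  · exfalso
    have h2 := supercrit_of_phi h0 h01 h1 hφ
    rw [theta_eq (h0.trans h01.le) h1] at hθ
    have h3 : 1 - Real.exp (-((p1 - p) / 2)) ≤ ⨅ M, th d M p1 := le_ciInf h2
    have h4 : Real.exp (-((p1 - p) / 2)) < 1 := by
      rw [Real.exp_lt_one_iff]; linarith
    linarith
  · push Not at hφ
    obtain ⟨S, hS, hφ⟩ := hφ
    obtain ⟨K, hK⟩ := exp_decay h0 (by linarith) hS hφ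
    exact ⟨K, phi p S, phi_nonneg h0 S, hφ, hK⟩

end
end Perc

open MeasureTheory ProbabilityTheory

namespace Perc

noncomputable section

open TorusPerc (stdVec)

variable {d : ℕ}

/-! ### Transfer to the torus -/

lemma Pr_compOn {ι κ : Type*} (p : ι → ℝ) {g : κ → ι} {A : Set (κ → Bool)}
    {S : Set κ} (h : LD A S) (hg : Set.InjOn g S) :
    Pr p {ω | (fun k => ω (g k)) ∈ A} = Pr (fun k => p (g k)) A := by
  have : Finite S := h.fin
  rw [Pr_restrict _ h]
  have e : {ω : ι → Bool | (fun k => ω (g k)) ∈ A} =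
      {ω | (fun k : S => ω (g k)) ∈ {η : S → Bool | ext0 S η ∈ A}} := by
    ext ω
    exact h.iff fun i hi => (ext0_mem (S := S) (fun k => ω (g k)) ⟨i, hi⟩).symm
  rw [e, Pr_comp p (g := fun k : S => g k) (S := Set.univ) ?_ ⟨Set.toFinite _, ?_⟩]
  · intro a b hab
    exact Subtype.ext (hg a.2 b.2 hab)
  · intro ω ω' hw
    have : ω = ω' := funext fun i => hw i trivial
    rw [this]; exact id

/-- lattice edges -/
def LE (d : ℕ) : Set (E d) := {e | ∃ (x : V d) (i : Fin d), e = s(x, x + stdVec d i)}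

lemma Adj.mem_LE {x y : V d} (h : Adj x y) : s(x, y) ∈ LE d := by
  obtain ⟨i, h | h⟩ := h
  · exact ⟨x, i, by rw [h]⟩
  · exact ⟨y, i, by rw [h, Sym2.eq_swap]⟩

lemma LD_Cn' {D : Set (V d)} (hD : D.Finite) (x y : V d) :
    LD {ω : E d → Bool | Cn (op ω) D x y} (eIn D ∩ LE d) := by
  refine ⟨(eIn_finite hD).inter_of_left _, fun ω ω' hw h => ?_⟩
  refine Cn.mono' (fun a b hab => ⟨hab.1, hab.2.1, hab.2.2.1, ?_⟩) h
  have := hw s(a, b) ⟨mk_mem_eIn.2 ⟨hab.2.1, hab.2.2.1⟩, hab.1.mem_LE⟩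
  have h2 := hab.2.2.2
  simp only [op, Set.mem_ofPred_eq] at h2 ⊢
  rw [← this]; exact h2

lemma LD_Th' (z : V d) (n : ℕ) : LD (Th z n) (eIn (box z n) ∩ LE d) :=
  LD.biUnion_ex ((eIn_finite (box_finite z n)).inter_of_left _)
    fun w _ => LD_Cn' (box_finite z n) z w

open Classical in
/-- image of an edge in the torus -/
def tg (hd : 0 < d) (N : ℕ) (e : E d) : TorusPerc.Edge d N :=
  if h : ∃ (x : V d) (i : Fin d), e = s(x, x + stdVec d i) then
    (TorusPerc.proj d N h.choose, h.choose_spec.choose) else (0, ⟨0, hd⟩)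

lemma tg_mk (hd : 0 < d) (N : ℕ) (x : V d) (i : Fin d) :
    tg hd N s(x, x + stdVec d i) = (TorusPerc.proj d N x, i) := by
  have h : ∃ (y : V d) (j : Fin d), s(x, x + stdVec d i) = s(y, y + stdVec d j) := ⟨x, i, rfl⟩
  unfold tg
  rw [dif_pos h]
  have := edge_inj h.choose_spec.choose_spec
  exact Prod.ext (congrArg (TorusPerc.proj d N) this.1.symm) this.2.symm

/-- lifted configuration -/
def lf (hd : 0 < d) {N : ℕ} (ω : TorusPerc.Config d N) : E d → Bool := fun e => ω (tg hd N e)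

lemma step_iff (hd : 0 < d) {N : ℕ} (ω : TorusPerc.Config d N) (x y : V d) :
    TorusPerc.step d N ω x y ↔ stp (op (lf hd ω)) Set.univ x y := by
  constructor
  · rintro (⟨i, rfl, h⟩ | ⟨i, rfl, h⟩)
    · refine ⟨⟨i, Or.inl rfl⟩, trivial, trivial, ?_⟩
      simp only [op, lf, Set.mem_ofPred_eq, tg_mk]; exact h
    · refine ⟨⟨i, Or.inr rfl⟩, trivial, trivial, ?_⟩
      simp only [op, lf, Set.mem_ofPred_eq, Sym2.eq_swap (a := y + stdVec d i), tg_mk]; exact h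
  · rintro ⟨⟨i, h | h⟩, -, -, h2⟩
    · subst h
      simp only [op, lf, Set.mem_ofPred_eq, tg_mk] at h2
      exact Or.inl ⟨i, rfl, h2⟩
    · subst h
      simp only [op, lf, Set.mem_ofPred_eq, Sym2.eq_swap (a := y + stdVec d i), tg_mk] at h2
      exact Or.inr ⟨i, rfl, h2⟩

lemma connected_iff (hd : 0 < d) {N : ℕ} (ω : TorusPerc.Config d N) (x y : V d) :
    TorusPerc.connected d N ω x y ↔ Cn (op (lf hd ω)) Set.univ x y := by
  unfold TorusPerc.connected Cn
  have : TorusPerc.step d N ω = stp (op (lf hd ω)) Set.univ := by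
    funext x y; exact propext (step_iff hd ω x y)
  rw [this]

lemma proj_inj_box {N : ℕ} {z x y : V d} {n : ℕ} (hn : 2 * n + 1 ≤ N) (hx : x ∈ box z n)
    (hy : y ∈ box z n) (h : TorusPerc.proj d N x = TorusPerc.proj d N y) : x = y := by
  funext j
  have h1 := congrFun h j
  simp only [TorusPerc.proj] at h1
  rw [ZMod.intCast_eq_intCast_iff_dvd_sub] at h1
  have h2 := abs_le.1 (hx j)
  have h3 := abs_le.1 (hy j)
  have := Int.eq_zero_of_abs_lt_dvd h1 (abs_lt.2 ⟨by omega, by omega⟩)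
  omega

lemma tg_injOn (hd : 0 < d) {N : ℕ} {z : V d} {n : ℕ} (hn : 2 * n + 1 ≤ N) :
    Set.InjOn (tg hd N) (eIn (box z n) ∩ LE d) := by
  rintro e ⟨he, x, i, rfl⟩ e' ⟨he', y, j, rfl⟩ h
  rw [tg_mk, tg_mk, Prod.mk.injEq] at h
  rw [mk_mem_eIn] at he he'
  rw [proj_inj_box hn he.1 he'.1 h.1, h.2]

lemma Pr_lf (hd : 0 < d) {N : ℕ} {p : ℝ} {z : V d} {n : ℕ} (hn : 2 * n + 1 ≤ N)
    {A : Set (E d → Bool)} (hA : LD A (eIn (box z n) ∩ LE d)) :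
    Pr (fun _ => p) {ω : TorusPerc.Config d N | lf hd ω ∈ A} = Pr (fun _ => p) A :=
  Pr_compOn (fun _ => p) hA (tg_injOn hd hn)

lemma connected_shift {N : ℕ} {ω : TorusPerc.Config d N} {x y : V d} (w : V d)
    (h : TorusPerc.connected d N ω x y) :
    TorusPerc.connected d N ω (x + (N : ℤ) • w) (y + (N : ℤ) • w) := by
  have hp : ∀ x : V d, TorusPerc.proj d N (x + (N : ℤ) • w) = TorusPerc.proj d N x := by
    intro x; funext j; simp [TorusPerc.proj]
  refine Relation.ReflTransGen.lift (fun x => x + (N : ℤ) • w) ?_ _ _ h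
  rintro a b (⟨i, rfl, h⟩ | ⟨i, rfl, h⟩)
  · refine Or.inl ⟨i, add_right_comm _ _ _, ?_⟩
    unfold TorusPerc.liftOpen at *; rw [hp]; exact h
  · refine Or.inr ⟨i, add_right_comm _ _ _, ?_⟩
    unfold TorusPerc.liftOpen at *; rw [hp]; exact h

lemma giant_bound (hd : 0 < d) {N : ℕ} (hN : 1 ≤ N) {k : ℕ} (hk : 2 * k + 1 ≤ N) (p : ℝ) :
    Pr (fun _ => p) (TorusPerc.giantEvent d N) ≤ (N : ℝ) ^ d * th d k p := by
  classical
  have hsub : TorusPerc.giantEvent d N ⊆ ⋃ x ∈ Fintype.piFinset (fun _ : Fin d => Finset.Ico (0:ℤ) N),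
      {ω | lf hd ω ∈ Th x k} := by
    rintro ω ⟨x, y, hne, hp, hc⟩
    have hc2 := connected_shift (fun j => -(x j / N)) hc
    obtain ⟨j, hj⟩ := Function.ne_iff.1 hne
    rw [connected_iff hd] at hc2
    refine Set.mem_biUnion (x := x + (N : ℤ) • (fun j => -(x j / N))) ?_ (Th_of_Cn hc2 ⟨j, ?_⟩)
    · simp only [Finset.mem_coe, Fintype.mem_piFinset, Finset.mem_Ico, Pi.add_apply, Pi.smul_apply,
        smul_eq_mul]
      intro j
      have h1 := Int.emod_add_mul_ediv (x j) N
      have h2 := Int.emod_nonneg (x j) (b := N) (by omega)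
      have h3 := Int.emod_lt_of_pos (x j) (b := N) (by omega)
      constructor <;> linarith
    · have h1 := congrFun hp j
      simp only [TorusPerc.proj] at h1
      rw [ZMod.intCast_eq_intCast_iff_dvd_sub] at h1
      have := Int.le_of_dvd (by simpa [sub_eq_zero] using fun h => hj h.symm) ((dvd_abs _ _).2 h1)
      simp only [Pi.add_apply, Pi.smul_apply, smul_eq_mul, add_sub_add_right_eq_sub]
      omega
  refine (Pr_mono _ hsub).trans ((Pr_biUnion_le _ _ _).trans ?_)
  refine (Finset.sum_le_card_nsmul _ _ (th d k p) fun x _ => ?_).trans ?_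
  · rw [Pr_lf hd hk (LD_Th' x k), Pr_Th]; exact le_rfl
  · rw [Fintype.card_piFinset]
    simp [nsmul_eq_mul]

lemma giant_inc (d N : ℕ) : Inc (TorusPerc.giantEvent d N) := by
  rintro ω ω' hw ⟨x, y, hne, hp, hc⟩
  refine ⟨x, y, hne, hp, Relation.ReflTransGen.mono ?_ _ _ hc⟩
  rintro a b (⟨i, rfl, h⟩ | ⟨i, rfl, h⟩)
  · exact Or.inl ⟨i, rfl, hw _ h⟩
  · exact Or.inr ⟨i, rfl, hw _ h⟩

lemma LD_finite {ι : Type*} [Finite ι] (A : Set (ι → Bool)) : LD A Set.univ :=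
  ⟨Set.toFinite _, fun ω ω' hw h => by
    have : ω = ω' := funext fun i => hw i trivial
    rwa [← this]⟩

lemma giant_mono {N : ℕ} (hN : 1 ≤ N) {p q : ℝ} (h : p ≤ q) :
    Pr (fun _ => p) (TorusPerc.giantEvent d N) ≤ Pr (fun _ => q) (TorusPerc.giantEvent d N) := by
  have : NeZero N := ⟨by omega⟩
  exact Pr_le_of_le (fun _ => h) (LD_finite _) (giant_inc d N)

lemma subcrit_giant (hd : 0 < d) {p p1 : ℝ} (h0 : 0 ≤ p) (h01 : p < p1) (h1 : p1 ≤ 1)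
    (hθ : ZLattice.theta d p1 = 0) :
    ∀ᶠ N : ℕ in Filter.atTop, Pr (fun _ => p) (TorusPerc.giantEvent d N) < 1 / 2 := by
  obtain ⟨K, r, hr0, hr1, hk⟩ := subcrit_decay h0 h01 h1 hθ
  set M := 2 * (K + 1) with hM
  -- k(N) = N / (M) - 1 … 2*(k*(K+1))+1 ≤ N
  have hlim : Filter.Tendsto (fun k : ℕ => ((k : ℝ) ^ d * r ^ k) * (2 * M : ℝ) ^ d) Filter.atTop (nhds 0) := by
    have := (tendsto_pow_const_mul_const_pow_of_lt_one d hr0 hr1).mul_const ((2 * M : ℝ) ^ d)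
    simpa using this
  have hev := (hlim.eventually (gt_mem_nhds (show (0:ℝ) < 1 / 2 by norm_num))).and
    (Filter.eventually_ge_atTop 1)
  have hdiv : Filter.Tendsto (fun N : ℕ => (N - 1) / M) Filter.atTop Filter.atTop := by
    have : Filter.Tendsto (fun N : ℕ => N / M) Filter.atTop Filter.atTop :=
      Nat.tendsto_div_const_atTop (by omega)
    exact this.comp (Filter.tendsto_sub_atTop_nat 1)
  filter_upwards [hdiv.eventually hev, Filter.eventually_ge_atTop 1] with N h2 hN
  obtain ⟨h2, h3⟩ := h2
  set k := (N - 1) / M with hkdef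
  have hle : k * M ≤ N - 1 := Nat.div_mul_le_self _ _
  have hlt : N - 1 < (k + 1) * M := by
    rw [add_mul, one_mul]; exact Nat.lt_div_mul_add (by omega)
  refine (giant_bound hd hN (k := k * (K + 1)) ?_ p).trans_lt (lt_of_le_of_lt ?_ h2)
  · have : k * M = 2 * (k * (K + 1)) := by rw [hM]; ring
    omega
  · have hNk : (N : ℝ) ≤ k * (2 * M) := by
      have : N ≤ k * (2 * M) := by
        have h5 : (k + 1) * M ≤ k * (2 * M) := by nlinarith
        omega
      exact_mod_cast this
    calc (N : ℝ) ^ d * th d (k * (K + 1)) p ≤ (k * (2 * M)) ^ d * r ^ k :=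
          mul_le_mul (pow_le_pow_left₀ (by positivity) hNk d) (hk k) (th_nonneg _ _) (by positivity)
      _ = _ := by rw [mul_pow]; ring

end

end Perc

open MeasureTheory ProbabilityTheory

namespace Perc

noncomputable section

/-! ### High-density site percolation on `ℤ²` by renormalisation -/

abbrev C9 := Fin 3 × Fin 3

def adjF (a b : C9) : Bool :=
  (a.1 = b.1 && (a.2.val + 1 = b.2.val || b.2.val + 1 = a.2.val)) ||
    (a.2 = b.2 && (a.1.val + 1 = b.1.val || b.1.val + 1 = a.1.val))

def nbF (b : C9) (S : C9 → Bool) : C9 → Bool :=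
  fun y => S y || (y != b && decide (∃ x, S x = true ∧ adjF x y = true))

set_option maxRecDepth 10000 in
lemma ring_decide : ∀ b c c' : C9, c ≠ b → c' ≠ b → ∃ e : C9, e ≠ b ∧
    ((nbF b)^[3] (fun x => x == c) e = true ∧ (nbF b)^[3] (fun x => x == c') e = true) := by
  decide +kernel

lemma ring_conn (b : C9) (R : C9 → C9 → Prop) (hr : ∀ x, x ≠ b → R x x) (hs : ∀ x y, R x y → R y x)
    (ht : ∀ x y z, R x y → R y z → R x z) (ha : ∀ x y, x ≠ b → y ≠ b → adjF x y = true → R x y)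
    (c c' : C9) (hc : c ≠ b) (hc' : c' ≠ b) : R c c' := by
  have key : ∀ c : C9, c ≠ b → ∀ n : ℕ, ∀ e, (nbF b)^[n] (fun x => x == c) e = true →
      e ≠ b ∧ R c e := by
    intro c hc n
    induction n with
    | zero =>
      intro e he
      simp only [Function.iterate_zero, id, beq_iff_eq] at he
      subst he; exact ⟨hc, hr _ hc⟩
    | succ n ih =>
      intro e he
      rw [Function.iterate_succ_apply', nbF, Bool.or_eq_true, Bool.and_eq_true, bne_iff_ne,
        decide_eq_true_eq] at he
      rcases he with he | ⟨h1, x, h2, h3⟩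
      · exact ih e he
      · have := ih x h2
        exact ⟨h1, ht _ _ _ this.2 (ha _ _ this.1 h1 h3)⟩
  obtain ⟨e, -, h1, h2⟩ := ring_decide b c c' hc hc'
  exact ht _ _ _ (key c hc 3 e h1).2 (hs _ _ (key c' hc' 3 e h2).2)

abbrev Z2 := ℤ × ℤ

def Adj2 (a b : Z2) : Prop :=
  (a.1 = b.1 ∧ (a.2 + 1 = b.2 ∨ b.2 + 1 = a.2)) ∨ (a.2 = b.2 ∧ (a.1 + 1 = b.1 ∨ b.1 + 1 = a.1))

lemma Adj2.symm {a b : Z2} (h : Adj2 a b) : Adj2 b a := by unfold Adj2 at *; omega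

def ch (a : Z2) (c : C9) : Z2 := (3 * a.1 + c.1.val, 3 * a.2 + c.2.val)

lemma ch_inj {a a' : Z2} {c c' : C9} (h : ch a c = ch a' c') : a = a' ∧ c = c' := by
  simp only [ch, Prod.mk.injEq] at h
  obtain ⟨h1, h2⟩ := h
  have := c.1.isLt; have := c.2.isLt; have := c'.1.isLt; have := c'.2.isLt
  refine ⟨Prod.ext (by omega) (by omega), Prod.ext (Fin.ext (by omega)) (Fin.ext (by omega))⟩

lemma ch_adj {a : Z2} {c c' : C9} (h : adjF c c' = true) : Adj2 (ch a c) (ch a c') := by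
  simp only [adjF, Bool.or_eq_true, Bool.and_eq_true, decide_eq_true_eq] at h
  simp only [Adj2, ch]
  rcases h with ⟨h1, h2⟩ | ⟨h1, h2⟩
  · left; rw [h1]; omega
  · right; rw [h1]; omega

def Good (s : Z2 → Bool) : ℕ → Z2 → Prop
  | 0, a => s a = true
  | k + 1, a => ∀ c c' : C9, c ≠ c' → Good s k (ch a c) ∨ Good s k (ch a c')

def Core (s : Z2 → Bool) : ℕ → Z2 → Set Z2
  | 0, a => {x | x = a ∧ s a = true}
  | k + 1, a => {x | Good s (k + 1) a ∧ ∃ c, x ∈ Core s k (ch a c)}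

/-- sites of block `a` at level `k` -/
def Blk : ℕ → Z2 → Set Z2
  | 0, a => {a}
  | k + 1, a => ⋃ c, Blk k (ch a c)

lemma Core_good {s : Z2 → Bool} {k : ℕ} {a x : Z2} (h : x ∈ Core s k a) : Good s k a := by
  cases k with
  | zero => exact h.2
  | succ k => exact h.1

lemma Core_sub {s : Z2 → Bool} {k : ℕ} {a x : Z2} (h : x ∈ Core s k a) : x ∈ Blk k a := by
  induction k generalizing a with
  | zero => exact h.1
  | succ k ih =>
    obtain ⟨-, c, hc⟩ := h
    exact Set.mem_iUnion.2 ⟨c, ih hc⟩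

lemma Blk_fin (k : ℕ) (a : Z2) : (Blk k a).Finite := by
  induction k generalizing a with
  | zero => exact Set.finite_singleton _
  | succ k ih => exact Set.finite_iUnion fun c => ih _

lemma Blk_iff {k : ℕ} {a x : Z2} : x ∈ Blk k a ↔
    (3 ^ k * a.1 ≤ x.1 ∧ x.1 < 3 ^ k * (a.1 + 1)) ∧ (3 ^ k * a.2 ≤ x.2 ∧ x.2 < 3 ^ k * (a.2 + 1)) := by
  induction k generalizing a with
  | zero =>
    simp only [Blk, Set.mem_singleton_iff, pow_zero, one_mul, Prod.ext_iff]
    omega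
  | succ k ih =>
    simp only [Blk, Set.mem_iUnion, ih, ch]
    have hpos : (0 : ℤ) < 3 ^ k := by positivity
    set q : ℤ := 3 ^ k with hq
    have e : (3 : ℤ) ^ (k + 1) = 3 * q := by rw [pow_succ, mul_comm]
    rw [e]
    constructor
    · rintro ⟨⟨i, j⟩, ⟨h1, h2⟩, h3, h4⟩
      have hi := i.isLt; have hj := j.isLt
      simp only at h1 h2 h3 h4
      have hi' : (i.val : ℤ) ≤ 2 := by omega
      have hj' : (j.val : ℤ) ≤ 2 := by omega
      refine ⟨⟨?_, ?_⟩, ?_, ?_⟩ <;> nlinarith [Int.natCast_nonneg i.val, Int.natCast_nonneg j.val]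
    · rintro ⟨⟨h1, h2⟩, h3, h4⟩
      have key : ∀ a x : ℤ, 3 * q * a ≤ x → x < 3 * q * (a + 1) → ∃ i : Fin 3,
          q * (3 * a + i.val) ≤ x ∧ x < q * (3 * a + i.val + 1) := by
        intro a x h1 h2
        by_cases c1 : x < q * (3 * a + 1)
        · exact ⟨0, by simp; nlinarith, by simpa using c1⟩
        · by_cases c2 : x < q * (3 * a + 2)
          · exact ⟨1, by simp; nlinarith, by simp; nlinarith⟩
          · exact ⟨2, by simp; nlinarith, by simp; nlinarith⟩
      obtain ⟨i, hi⟩ := key _ _ h1 h2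
      obtain ⟨j, hj⟩ := key _ _ h3 h4
      exact ⟨(i, j), hi, hj⟩

/-- open connection inside `G` -/
def SC (s : Z2 → Bool) : Z2 → Z2 → Prop :=
  Relation.ReflTransGen (fun a b => Adj2 a b ∧ s a = true ∧ s b = true)

lemma SC.symm {s : Z2 → Bool} {a b : Z2} (h : SC s a b) : SC s b a := by
  induction h with
  | refl => exact Relation.ReflTransGen.refl
  | tail _ h ih => exact Relation.ReflTransGen.head ⟨h.1.symm, h.2.2, h.2.1⟩ ih

lemma Core_open {s : Z2 → Bool} {k : ℕ} {a x : Z2} (h : x ∈ Core s k a) : s x = true := by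
  induction k generalizing a with
  | zero => obtain ⟨rfl, h⟩ := h; exact h
  | succ k ih => obtain ⟨-, c, hc⟩ := h; exact ih hc

lemma Core_ne {s : Z2 → Bool} {k : ℕ} {a : Z2} (h : Good s k a) : ∃ x, x ∈ Core s k a := by
  induction k generalizing a with
  | zero => exact ⟨a, rfl, h⟩
  | succ k ih =>
    rcases h (0, 0) (0, 1) (by decide) with h1 | h1
    · obtain ⟨x, hx⟩ := ih h1; exact ⟨x, h, _, hx⟩
    · obtain ⟨x, hx⟩ := ih h1; exact ⟨x, h, _, hx⟩

lemma three_pigeon {P Q : Fin 3 → Prop} (hP : ∀ i j, i ≠ j → P i ∨ P j)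
    (hQ : ∀ i j, i ≠ j → Q i ∨ Q j) : ∃ i, P i ∧ Q i := by
  have a1 := hP 0 1 (by decide); have a2 := hP 0 2 (by decide); have a3 := hP 1 2 (by decide)
  have b1 := hQ 0 1 (by decide); have b2 := hQ 0 2 (by decide); have b3 := hQ 1 2 (by decide)
  by_contra hne
  push Not at hne
  have c1 := hne 0; have c2 := hne 1; have c3 := hne 2
  tauto

lemma Core_adj {s : Z2 → Bool} {k : ℕ} {a b : Z2} (ha : Good s k a) (hb : Good s k b)
    (hab : Adj2 a b) : ∃ x ∈ Core s k a, ∃ y ∈ Core s k b, Adj2 x y := by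
  induction k generalizing a b with
  | zero => exact ⟨a, ⟨rfl, ha⟩, b, ⟨rfl, hb⟩, hab⟩
  | succ k ih =>
    have main : ∀ f g : Fin 3 → C9, Function.Injective f → Function.Injective g →
        (∀ i, Adj2 (ch a (f i)) (ch b (g i))) →
        ∃ x ∈ Core s (k + 1) a, ∃ y ∈ Core s (k + 1) b, Adj2 x y := by
      intro f g hf hg hfg
      obtain ⟨i, h1, h2⟩ := three_pigeon (P := fun i => Good s k (ch a (f i)))
        (Q := fun i => Good s k (ch b (g i))) (fun i j hij => ha _ _ (fun h => hij (hf h)))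
        (fun i j hij => hb _ _ (fun h => hij (hg h)))
      obtain ⟨x, hx, y, hy, hxy⟩ := ih h1 h2 (hfg i)
      exact ⟨x, ⟨ha, _, hx⟩, y, ⟨hb, _, hy⟩, hxy⟩
    rcases hab with ⟨h1, h2 | h2⟩ | ⟨h1, h2 | h2⟩
    · refine main (fun i => (i, 2)) (fun i => (i, 0)) (fun i j h => by simpa using h)
        (fun i j h => by simpa using h) fun i => ?_
      simp only [Adj2, ch, Fin.val_two, Fin.val_zero]; push_cast; omega
    · refine main (fun i => (i, 0)) (fun i => (i, 2)) (fun i j h => by simpa using h)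
        (fun i j h => by simpa using h) fun i => ?_
      simp only [Adj2, ch, Fin.val_two, Fin.val_zero]; push_cast; omega
    · refine main (fun i => (2, i)) (fun i => (0, i)) (fun i j h => by simpa using h)
        (fun i j h => by simpa using h) fun i => ?_
      simp only [Adj2, ch, Fin.val_two, Fin.val_zero]; push_cast; omega
    · refine main (fun i => (0, i)) (fun i => (2, i)) (fun i j h => by simpa using h)
        (fun i j h => by simpa using h) fun i => ?_
      simp only [Adj2, ch, Fin.val_two, Fin.val_zero]; push_cast; omega

/-- connection inside a set -/
def SCI (s : Z2 → Bool) (G : Set Z2) : Z2 → Z2 → Prop :=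
  Relation.ReflTransGen (fun a b => Adj2 a b ∧ (s a = true ∧ a ∈ G) ∧ (s b = true ∧ b ∈ G))

lemma SCI.symm {s : Z2 → Bool} {G : Set Z2} {a b : Z2} (h : SCI s G a b) : SCI s G b a := by
  induction h with
  | refl => exact Relation.ReflTransGen.refl
  | tail _ h ih => exact Relation.ReflTransGen.head ⟨h.1.symm, h.2.2, h.2.1⟩ ih

lemma SCI.mono {s : Z2 → Bool} {G G' : Set Z2} (hG : G ⊆ G') {a b : Z2} (h : SCI s G a b) :
    SCI s G' a b := by
  refine Relation.ReflTransGen.mono ?_ _ _ h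
  rintro x y ⟨h1, h2, h3⟩
  exact ⟨h1, ⟨h2.1, hG h2.2⟩, h3.1, hG h3.2⟩

lemma Core_conn {s : Z2 → Bool} {k : ℕ} {a x y : Z2} (hx : x ∈ Core s k a) (hy : y ∈ Core s k a) :
    SCI s (Blk k a) x y := by
  induction k generalizing a x y with
  | zero => obtain ⟨rfl, -⟩ := hx; obtain ⟨rfl, -⟩ := hy; exact Relation.ReflTransGen.refl
  | succ k ih =>
    obtain ⟨hg, c, hx⟩ := hx
    obtain ⟨-, c', hy⟩ := hy
    have hsub : ∀ c, Blk k (ch a c) ⊆ Blk (k + 1) a := fun c z hz => Set.mem_iUnion.2 ⟨c, hz⟩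
    obtain ⟨b, hb, h1, h2⟩ : ∃ b, (∀ c, c ≠ b → Good s k (ch a c)) ∧ c ≠ b ∧ c' ≠ b := by
      by_cases h : ∃ b, ¬ Good s k (ch a b)
      · obtain ⟨b, hb⟩ := h
        refine ⟨b, fun c hc => (hg c b hc).resolve_right hb, ?_, ?_⟩
        · rintro rfl; exact hb (Core_good hx)
        · rintro rfl; exact hb (Core_good hy)
      · push Not at h
        have : ∀ c c' : C9, ∃ b, c ≠ b ∧ c' ≠ b := by decide
        obtain ⟨b, hb⟩ := this c c'
        exact ⟨b, fun c _ => h c, hb⟩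
    refine (ring_conn b (fun c c' => (Good s k (ch a c) ∧ Good s k (ch a c')) ∧
      ∀ x ∈ Core s k (ch a c), ∀ y ∈ Core s k (ch a c'),
      SCI s (Blk (k + 1) a) x y) ?_ ?_ ?_ ?_ c c' h1 h2).2 x hx y hy
    · intro c hc
      exact ⟨⟨hb c hc, hb c hc⟩, fun x hx y hy => (ih hx hy).mono (hsub c)⟩
    · rintro c c' ⟨h, h'⟩
      exact ⟨h.symm, fun x hx y hy => (h' y hy x hx).symm⟩
    · rintro c c' c'' ⟨h1, h2⟩ ⟨h3, h4⟩
      refine ⟨⟨h1.1, h3.2⟩, fun x hx y hy => ?_⟩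
      obtain ⟨z, hz⟩ := Core_ne h1.2
      exact (h2 x hx z hz).trans (h4 z hz y hy)
    · intro c c' hc hc' hadj
      refine ⟨⟨hb c hc, hb c' hc'⟩, fun x hx y hy => ?_⟩
      obtain ⟨u, hu, v, hv, huv⟩ := Core_adj (hb c hc) (hb c' hc') (ch_adj (a := a) hadj)
      refine ((ih hx hu).mono (hsub c)).trans (Relation.ReflTransGen.head ⟨huv, ?_, ?_⟩
        ((ih hv hy).mono (hsub c')))
      · exact ⟨Core_open hu, hsub _ (Core_sub hu)⟩
      · exact ⟨Core_open hv, hsub _ (Core_sub hv)⟩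

lemma LD_Good (k : ℕ) (a : Z2) : LD {s : Z2 → Bool | Good s k a} (Blk k a) := by
  induction k generalizing a with
  | zero => exact LD_coord a true
  | succ k ih =>
    refine ⟨Blk_fin _ _, fun s s' hs h c c' hcc => ?_⟩
    have : ∀ c, Good s k (ch a c) → Good s' k (ch a c) := fun c hc =>
      (ih (ch a c)).dep s s' (fun i hi => hs i (Set.mem_iUnion.2 ⟨c, hi⟩)) hc
    exact (h c c' hcc).imp (this c) (this c')

lemma Blk_disj {k : ℕ} {a b : Z2} (h : a ≠ b) : Disjoint (Blk k a) (Blk k b) := by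
  rw [Set.disjoint_left]
  intro x h1 h2
  rw [Blk_iff] at h1 h2
  have hpos : (0 : ℤ) < 3 ^ k := by positivity
  have key : ∀ a b x : ℤ, 3 ^ k * a ≤ x → x < 3 ^ k * (a + 1) → 3 ^ k * b ≤ x →
      x < 3 ^ k * (b + 1) → a = b := by
    intro a b x h1 h2 h3 h4
    have h5 := lt_of_mul_lt_mul_left (h1.trans_lt h4) hpos.le
    have h6 := lt_of_mul_lt_mul_left (h3.trans_lt h2) hpos.le
    omega
  exact h (Prod.ext (key _ _ _ h1.1.1 h1.1.2 h2.1.1 h2.1.2) (key _ _ _ h1.2.1 h1.2.2 h2.2.1 h2.2.2))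

lemma Pr_bad {ε : ℝ} (h0 : 0 ≤ ε) (h1 : ε ≤ 1 / 162) (k : ℕ) (a : Z2) :
    Pr (fun _ => 1 - ε) {s : Z2 → Bool | ¬ Good s k a} ≤ ε * (1 / 2) ^ k := by
  induction k generalizing a with
  | zero =>
    have e : {s : Z2 → Bool | ¬ Good s 0 a} = {s | s a = false} := by
      ext s; simp [Good]
    rw [e, Pr_coord_false, cl_eq (by linarith) (by linarith)]; simp
  | succ k ih =>
    classical
    have hsub : {s : Z2 → Bool | ¬ Good s (k + 1) a} ⊆
        ⋃ cc ∈ (Finset.univ : Finset (C9 × C9)).filter (fun cc => cc.1 ≠ cc.2),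
        ({s | ¬ Good s k (ch a cc.1)} ∩ {s | ¬ Good s k (ch a cc.2)}) := by
      intro s hs
      simp only [Good, Set.mem_ofPred_eq] at hs
      push Not at hs
      obtain ⟨c, c', hne, h1, h2⟩ := hs
      exact Set.mem_biUnion (x := (c, c')) (by simpa using hne) ⟨h1, h2⟩
    refine (Pr_mono _ hsub).trans ((Pr_biUnion_le _ _ _).trans ?_)
    refine (Finset.sum_le_card_nsmul _ _ ((ε * (1 / 2) ^ k) * (ε * (1 / 2) ^ k)) ?_).trans ?_
    · rintro ⟨c, c'⟩ hcc
      simp only [ne_eq, Finset.mem_filter, Finset.mem_univ, true_and] at hcc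
      have l : ∀ c, LD {s : Z2 → Bool | ¬ Good s k (ch a c)} (Blk k (ch a c)) :=
        fun c => (LD_Good k (ch a c)).compl
      rw [Pr_inter _ (l c) (l c') (Blk_disj fun h => hcc (ch_inj h).2)]
      exact mul_le_mul (ih _) (ih _) (Pr_nonneg _ _) (by positivity)
    · have hc : ((Finset.univ : Finset (C9 × C9)).filter (fun cc => cc.1 ≠ cc.2)).card ≤ 81 :=
        (Finset.card_filter_le _ _).trans (by simp)
      have hh : (1 / 2 : ℝ) ^ k ≤ 1 := pow_le_one₀ (by norm_num) (by norm_num)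
      have hp : (0 : ℝ) ≤ (1 / 2) ^ k := by positivity
      rw [nsmul_eq_mul]
      calc _ ≤ (81 : ℝ) * ((ε * (1 / 2) ^ k) * (ε * (1 / 2) ^ k)) := by
            gcongr; exact_mod_cast hc
        _ = (81 * ε * (1 / 2) ^ k) * (ε * (1 / 2) ^ k) := by ring
        _ ≤ (1 / 2) * (ε * (1 / 2) ^ k) := by
            gcongr
            nlinarith
        _ = _ := by rw [pow_succ]; ring

lemma Pr_notcore {ε : ℝ} (h0 : 0 ≤ ε) (h1 : ε ≤ 1 / 162) (k : ℕ) (x : Z2) :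
    Pr (fun _ => 1 - ε) {s : Z2 → Bool | x ∉ Core s k (x.1 / 3 ^ k, x.2 / 3 ^ k)} ≤
      ε * (2 - (1 / 2) ^ k) := by
  induction k with
  | zero =>
    have e : {s : Z2 → Bool | x ∉ Core s 0 (x.1 / 3 ^ 0, x.2 / 3 ^ 0)} = {s | ¬ Good s 0 x} := by
      ext s; simp [Good, Core]
    rw [e]; refine (Pr_bad h0 h1 0 x).trans ?_
    norm_num
  | succ k ih =>
    have hsub : {s : Z2 → Bool | x ∉ Core s (k + 1) (x.1 / 3 ^ (k + 1), x.2 / 3 ^ (k + 1))} ⊆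
        {s | ¬ Good s (k + 1) (x.1 / 3 ^ (k + 1), x.2 / 3 ^ (k + 1))} ∪
        {s : Z2 → Bool | x ∉ Core s k (x.1 / 3 ^ k, x.2 / 3 ^ k)} := by
      intro s hs
      by_contra hne
      simp only [Set.mem_union, Set.mem_ofPred_eq, not_or, not_not] at hne
      refine hs ⟨hne.1, ?_⟩
      have key : ∀ y : ℤ, ∃ i : Fin 3, 3 * (y / 3 ^ (k + 1)) + i.val = y / 3 ^ k := by
        intro y
        rw [pow_succ, ← Int.ediv_ediv_of_nonneg (by positivity)]
        have h1 := Int.emod_nonneg (y / 3 ^ k) (b := 3) (by norm_num)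
        have h2 := Int.emod_lt_of_pos (y / 3 ^ k) (b := 3) (by norm_num)
        refine ⟨⟨(y / 3 ^ k % 3).toNat, by omega⟩, ?_⟩
        simp only; omega
      obtain ⟨i, hi⟩ := key x.1
      obtain ⟨j, hj⟩ := key x.2
      refine ⟨(i, j), ?_⟩
      simp only [ch, hi, hj]
      exact hne.2
    refine (Pr_mono _ hsub).trans ((Pr_union_le _ _ _).trans ?_)
    refine (add_le_add (Pr_bad h0 h1 (k + 1) _) ih).trans (le_of_eq ?_)
    rw [pow_succ]; ring

lemma site_conn {ε : ℝ} (h0 : 0 ≤ ε) (h1 : ε ≤ 1 / 162) (k : ℕ) {x y : Z2} (hx : x ∈ Blk k 0)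
    (hy : y ∈ Blk k 0) :
    1 - 4 * ε ≤ Pr (fun _ => 1 - ε) {s : Z2 → Bool | SCI s (Blk k 0) x y ∧ s x = true} := by
  have hz : ∀ x ∈ Blk k 0, (x.1 / 3 ^ k, x.2 / 3 ^ k) = (0 : Z2) := by
    intro x hx
    rw [Blk_iff] at hx
    simp only [Prod.fst_zero, Prod.snd_zero, mul_zero, zero_add, mul_one] at hx
    exact Prod.ext (Int.ediv_eq_zero_of_lt hx.1.1 hx.1.2) (Int.ediv_eq_zero_of_lt hx.2.1 hx.2.2)
  have a1 := Pr_notcore h0 h1 k x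
  have a2 := Pr_notcore h0 h1 k y
  rw [hz x hx] at a1
  rw [hz y hy] at a2
  have hsub : (Set.univ : Set (Z2 → Bool)) ⊆ {s : Z2 → Bool | SCI s (Blk k 0) x y ∧ s x = true} ∪
      ({s | x ∉ Core s k 0} ∪ {s | y ∉ Core s k 0}) := by
    intro s _
    by_cases c1 : x ∈ Core s k 0
    · by_cases c2 : y ∈ Core s k 0
      · exact Or.inl ⟨Core_conn c1 c2, Core_open c1⟩
      · exact Or.inr (Or.inr c2)
    · exact Or.inr (Or.inl c1)
  have b1 := Pr_mono (fun _ => 1 - ε) hsub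
  rw [Pr_univ] at b1
  have b2 := Pr_union_le (fun _ => 1 - ε) {s : Z2 → Bool | SCI s (Blk k 0) x y ∧ s x = true}
      ({s | x ∉ Core s k 0} ∪ {s | y ∉ Core s k 0})
  have b3 := Pr_union_le (fun _ => 1 - ε) {s : Z2 → Bool | x ∉ Core s k 0} {s | y ∉ Core s k 0}
  have hp : (0 : ℝ) ≤ (1 / 2) ^ k := by positivity
  nlinarith

/-! exploration functional -/

/-- target reached from `O` through open sites of `U` -/
def Rch (t : Z2) (O U : Finset Z2) : Set (Z2 → Bool) :=
  {s | ∃ o ∈ O, Relation.ReflTransGen (fun a b => Adj2 a b ∧ b ∈ U ∧ s b = true) o t}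

lemma LD_Rch (t : Z2) (O U : Finset Z2) : LD (Rch t O U) U := by
  refine ⟨U.finite_toSet, ?_⟩
  rintro s s' hs ⟨o, ho, h⟩
  refine ⟨o, ho, Relation.ReflTransGen.mono ?_ _ _ h⟩
  rintro a b ⟨h1, h2, h3⟩
  exact ⟨h1, h2, by rw [← hs b h2]; exact h3⟩

/-- site percolation probability -/
def Q (ε : ℝ) (t : Z2) (O U : Finset Z2) : ℝ := Pr (fun _ => 1 - ε) (Rch t O U)

lemma Q_mono (ε : ℝ) (t : Z2) {O O' : Finset Z2} (h : O ⊆ O') (U : Finset Z2) :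
    Q ε t O U ≤ Q ε t O' U :=
  Pr_mono _ fun _ ⟨o, ho, h'⟩ => ⟨o, h ho, h'⟩

lemma Q_le_one (ε : ℝ) (t : Z2) (O U : Finset Z2) : Q ε t O U ≤ 1 := Pr_le_one _ _

lemma Q_rec {ε : ℝ} (h0 : 0 ≤ ε) (h1 : ε ≤ 1) (t : Z2) (O U : Finset Z2) (v : Z2) :
    Q ε t O U ≤ (1 - ε) * Q ε t (insert v O) (U.erase v) + ε * Q ε t O (U.erase v) := by
  classical
  have hsub : Rch t O U ⊆ ({s | s v = true} ∩ Rch t (insert v O) (U.erase v)) ∪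
      ({s | s v = false} ∩ Rch t O (U.erase v)) := by
    rintro s ⟨o, ho, h⟩
    by_cases hv : s v = true
    · refine Or.inl ⟨hv, ?_⟩
      induction h with
      | refl => exact ⟨o, Finset.mem_insert_of_mem ho, Relation.ReflTransGen.refl⟩
      | @tail b c _ h ih =>
        by_cases hc : c = v
        · exact ⟨v, Finset.mem_insert_self _ _, by rw [hc]⟩
        · obtain ⟨o', ho', h'⟩ := ih
          exact ⟨o', ho', h'.tail ⟨h.1, Finset.mem_erase.2 ⟨hc, h.2.1⟩, h.2.2⟩⟩
    · refine Or.inr ⟨by simpa using hv, o, ho, Relation.ReflTransGen.mono ?_ _ _ h⟩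
      rintro a b ⟨h1, h2, h3⟩
      refine ⟨h1, Finset.mem_erase.2 ⟨?_, h2⟩, h3⟩
      rintro rfl; exact hv h3
  refine (Pr_mono _ hsub).trans ((Pr_union_le _ _ _).trans ?_)
  have hd : Disjoint ({v} : Set Z2) (U.erase v : Finset Z2) := by simp
  rw [Pr_inter _ (LD_coord v true) (LD_Rch _ _ _) hd, Pr_inter _ (LD_coord v false) (LD_Rch _ _ _) hd,
    Pr_coord, Pr_coord_false, cl_eq (by linarith) (by linarith)]
  simp [Q]

lemma Q_zero (ε : ℝ) (t : Z2) (O U : Finset Z2) (ht : t ∉ O)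
    (h : ∀ o ∈ O, ∀ v ∈ U, ¬ Adj2 o v) : Q ε t O U = 0 := by
  have : Rch t O U = ∅ := by
    rw [Set.eq_empty_iff_forall_notMem]
    rintro s ⟨o, ho, h'⟩
    rcases Relation.ReflTransGen.cases_head h' with rfl | ⟨c, hc, -⟩
    · exact ht ho
    · exact h o ho c hc.2.1 hc.1
  rw [Q, this, Pr_empty]

lemma Q_lower {ε : ℝ} (h0 : 0 ≤ ε) (h1 : ε ≤ 1 / 162) (k : ℕ) {x y : Z2} (hx : x ∈ Blk k 0)
    (hy : y ∈ Blk k 0) : 1 - 4 * ε ≤ Q ε y {x} ((Blk_fin k 0).toFinset.erase x) := by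
  refine (site_conn h0 h1 k hx hy).trans (Pr_mono _ ?_)
  rintro s ⟨h, -⟩
  refine ⟨x, by simp, ?_⟩
  clear hy
  induction h with
  | refl => exact Relation.ReflTransGen.refl
  | @tail b c _ h ih =>
    by_cases hc : c = x
    · rw [hc]
    · exact ih.tail ⟨h.1, by simp [hc, h.2.2.2], h.2.2.1⟩

end

end Perc

open MeasureTheory ProbabilityTheory

namespace Perc

noncomputable section

open TorusPerc (stdVec)

variable {d : ℕ}

/-! ### Large connections in the supercritical phase -/

lemma eIn_disj {D D' : Set (V d)} (h : Disjoint D D') : Disjoint (eIn D) (eIn D') := by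
  rw [Set.disjoint_left] at h ⊢
  intro e
  induction e using Sym2.ind with
  | _ x y =>
    intro h1 h2
    rw [mk_mem_eIn] at h1 h2
    exact h h1.1 h2.1

lemma Pr_diff {ι : Type*} (p : ι → ℝ) {A B : Set (ι → Bool)} {T : Set ι} (hB : LD B T) (h : B ⊆ A) :
    Pr p (A \ B) = Pr p A - Pr p B := by
  have := Pr_add p (A := A \ B) hB Set.disjoint_sdiff_left
  rw [Set.sdiff_union_of_subset h] at this
  linarith

/-- points of `T` connected to `box z m` inside `box z n` -/
def XX (z : V d) (m n : ℕ) (T : Set (V d)) (ω : E d → Bool) : Set (V d) :=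
  {x | x ∈ T ∧ ∃ b ∈ box z m, Cn (op ω) (box z n) b x}

def BL (d m n : ℕ) : Set (E d → Bool) := {ω | (XX 0 m n (sph (0 : V d) n) ω).Nonempty}

lemma LD_XX (z : V d) (m n : ℕ) (T : Set (V d)) (P : Set (V d) → Prop) :
    LD {ω : E d → Bool | P (XX z m n T ω)} (eIn (box z n)) := by
  refine ⟨eIn_finite (box_finite _ _), fun ω ω' hw h => ?_⟩
  have : XX z m n T ω = XX z m n T ω' := by
    ext x
    have : ∀ b, Cn (op ω) (box z n) b x ↔ Cn (op ω') (box z n) b x := fun b =>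
      (LD_Cn (box_finite z n) b x).iff hw
    simp only [XX, Set.mem_ofPred_eq, this]
  simp only [Set.mem_ofPred_eq] at *
  rw [← this]; exact h

lemma LD_BL (m n : ℕ) : LD (BL d m n) (eIn (box 0 n)) := LD_XX 0 m n _ _

lemma th_tendsto (p : ℝ) : Filter.Tendsto (fun n => th d n p) Filter.atTop (nhds (⨅ n, th d n p)) :=
  tendsto_atTop_ciInf (fun _ _ h => th_anti p h) (th_bdd p)

lemma BL_of_hit {ω : E d → Bool} {m L : ℕ} (hmL : m ≤ L) {x : V d} (hx : x ∈ box (0 : V d) m)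
    (h : ω ∈ Th x (2 * L)) : ω ∈ BL d m L := by
  obtain ⟨w, hw, hc⟩ := h
  obtain ⟨j, hj⟩ := hw.2
  obtain ⟨w', hw', hc'⟩ := hc.hit (z := (0 : V d)) (n := L) (box_mono hmL hx) ⟨j, by
    have h1 := hx j
    have h2 : |w j - x j| ≤ |w j - 0| + |0 - x j| := abs_sub_le _ _ _
    have h3 : |0 - x j| = |x j - (0 : V d) j| := by rw [abs_sub_comm]; rfl
    rw [h3, hj] at h2
    have : (m : ℤ) ≤ L := by exact_mod_cast hmL
    simp only [Pi.zero_apply] at *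
    push_cast at h2
    omega⟩
  exact ⟨w', hw', x, hx, hc'.mono le_rfl Set.inter_subset_right⟩

lemma big_seed (hd : 0 < d) {p θ : ℝ} (hθ : 0 < θ) (hth : ∀ n, θ ≤ th d n p) {η : ℝ} (hη : 0 < η) :
    ∃ m : ℕ, ∀ L, m ≤ L → 1 - η ≤ Pr (fun _ => p) (BL d m L) := by
  have hθ1 : θ ≤ 1 := (hth 0).trans (th_le_one _ _)
  have hgap : ∀ (k a b : ℕ) (x : ℤ), a < b → x - (a * (2 * k + 1) : ℕ) ≤ k →
      -(k : ℤ) ≤ x - (b * (2 * k + 1) : ℕ) → False := by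
    intro k a b x h h1 h2
    have h3 : (a + 1) * (2 * k + 1) ≤ b * (2 * k + 1) := Nat.mul_le_mul_right _ h
    rw [add_mul] at h3
    omega
  obtain ⟨J, hJ⟩ := exists_pow_lt_of_lt_one (half_pos hη) (show 1 - θ < 1 by linarith)
  have hJ1 : (0 : ℝ) < J + 1 := by positivity
  have hη' : 0 < η / (2 * (J + 1)) := by positivity
  obtain ⟨k, hk⟩ : ∃ k, ∀ n, th d k p - th d n p ≤ η / (2 * (J + 1)) := by
    have h1 := (th_tendsto (d := d) p).eventually (gt_mem_nhds (show (⨅ n, th d n p) <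
      (⨅ n, th d n p) + η / (2 * (J + 1)) by linarith))
    obtain ⟨k, hk⟩ := h1.exists
    exact ⟨k, fun n => by linarith [ciInf_le (th_bdd (d := d) p) n]⟩
  let z : ℕ → V d := fun j i => if i = ⟨0, hd⟩ then (j * (2 * k + 1) : ℕ) else 0
  refine ⟨J * (2 * k + 1), fun L hL => ?_⟩
  have hz : ∀ j ∈ Finset.range J, z j ∈ box (0 : V d) (J * (2 * k + 1)) := by
    intro j hj i
    simp only [z, Pi.zero_apply, sub_zero]
    split_ifs
    · rw [Nat.abs_cast]
      exact_mod_cast Nat.mul_le_mul_right _ (Finset.mem_range.1 hj).le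
    · simp only [abs_zero]; positivity
  have hsub : (BL d (J * (2 * k + 1)) L)ᶜ ⊆ (⋂ j ∈ Finset.range J, (Th (z j) k)ᶜ) ∪
      ⋃ j ∈ Finset.range J, (Th (z j) k \ Th (z j) (2 * L + k)) := by
    intro ω hω
    by_cases h : ∃ j ∈ Finset.range J, ω ∈ Th (z j) k
    · obtain ⟨j, hj, hj2⟩ := h
      refine Or.inr (Set.mem_biUnion hj ⟨hj2, fun h3 => hω ?_⟩)
      exact BL_of_hit hL (hz j hj) (Th_anti _ (by omega) h3)
    · push Not at h
      exact Or.inl (by simpa using h)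
  have h1 : Pr (fun _ => p) (⋂ j ∈ Finset.range J, (Th (z j) k)ᶜ) ≤ η / 2 := by
    rw [Pr_biInter _ _ (S := fun j => eIn (box (z j) k)) (fun j _ => (LD_Th (z j) k).compl)]
    · refine (Finset.prod_le_prod (g := fun _ => 1 - θ) (fun _ _ => Pr_nonneg _ _)
        fun j _ => ?_).trans ?_
      · rw [Pr_compl _ (LD_Th _ _), Pr_Th]
        have := hth k
        unfold th at this; linarith
      · rw [Finset.prod_const, Finset.card_range]; exact hJ.le
    · intro a _ b _ hab
      apply eIn_disj
      rw [Set.disjoint_left]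
      intro x hx hy
      have h1 := abs_le.1 (hx ⟨0, hd⟩)
      have h2 := abs_le.1 (hy ⟨0, hd⟩)
      simp only [z, if_true] at h1 h2
      rcases Nat.lt_or_gt_of_ne hab with h | h
      · exact hgap k a b _ h h1.2 h2.1
      · exact hgap k b a _ h h2.2 h1.1
  have h2 : Pr (fun _ => p) (⋃ j ∈ Finset.range J, (Th (z j) k \ Th (z j) (2 * L + k))) ≤ η / 2 := by
    refine (Pr_biUnion_le _ _ _).trans ((Finset.sum_le_card_nsmul _ _ (η / (2 * (J + 1)))
      fun j _ => ?_).trans ?_)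
    · have h5 : Th (z j) (2 * L + k) ⊆ Th (z j) k := Th_anti _ (Nat.le_add_left _ _)
      rw [Pr_diff _ (LD_Th (z j) (2 * L + k)) h5, Pr_Th p (z j) k, Pr_Th p (z j) (2 * L + k)]
      exact hk (2 * L + k)
    · rw [Finset.card_range, nsmul_eq_mul]
      have : (J : ℝ) * (η / (2 * (J + 1))) = (J / (J + 1)) * (η / 2) := by field_simp
      rw [this]
      have h5 : (J : ℝ) / (J + 1) ≤ 1 := by rw [div_le_one hJ1]; linarith
      exact mul_le_of_le_one_left (half_pos hη).le h5
  have h3 := (Pr_mono (fun _ => p) hsub).trans (Pr_union_le _ _ _)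
  rw [Pr_compl _ (LD_BL _ _)] at h3
  linarith

/-! lots of boundary points -/

open Classical in
/-- edges leaving from `Y` -/
def lv (Y : Finset (V d)) : Finset (E d) :=
  (Y ×ˢ (Finset.univ : Finset (Fin d × Bool))).image
    fun t => s(t.1, if t.2.2 then t.1 + stdVec d t.2.1 else t.1 - stdVec d t.2.1)

lemma lv_card (Y : Finset (V d)) : (lv Y).card ≤ Y.card * (2 * d) := by
  classical
  unfold lv
  refine Finset.card_image_le.trans ?_
  rw [Finset.card_product]; simp [mul_comm]

lemma mem_lv {Y : Finset (V d)} {a b : V d} (ha : a ∈ Y) (h : Adj a b) : s(a, b) ∈ lv Y := by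
  classical
  unfold lv
  rw [Finset.mem_image]
  obtain ⟨i, h | h⟩ := h
  · exact ⟨(a, i, true), by simp [ha], by simp [h]⟩
  · exact ⟨(a, i, false), by simp [ha], by simp [h]⟩

lemma BL_anti (m : ℕ) {n n' : ℕ} (hm : m ≤ n) (h : n ≤ n') : BL d m n' ⊆ BL d m n := by
  rintro ω ⟨w, hw, b, hb, hc⟩
  obtain ⟨j, hj⟩ := hw.2
  obtain ⟨w', h1, h2⟩ := hc.hit (z := (0 : V d)) (n := n) (box_mono hm hb) ⟨j, by
    rw [hj]; exact_mod_cast h⟩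
  exact ⟨w', h1, b, hb, h2.mono le_rfl Set.inter_subset_right⟩

lemma XX_finite (z : V d) (m n : ℕ) {T : Set (V d)} (hT : T.Finite) (ω : E d → Bool) :
    (XX z m n T ω).Finite := hT.subset fun _ h => h.1

open Classical in
/-- edges leaving the box from `Y` -/
def lvo (n : ℕ) (Y : Finset (V d)) : Finset (E d) := (lv Y).filter (· ∉ eIn (box (0 : V d) n))

lemma BL_fail {ω : E d → Bool} {m n : ℕ} (hm : m ≤ n) {Y : Finset (V d)}
    (hY : XX 0 m n (sph (0 : V d) n) ω = Y) (hc : ∀ e ∈ lvo n Y, ω e = false) :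
    ω ∉ BL d m (n + 1) := by
  rintro ⟨w, hw, b, hb, h⟩
  obtain ⟨j, hj⟩ := hw.2
  have hwn : w ∉ box (0 : V d) n := fun h => by
    have := h j; rw [hj] at this; push_cast at this; omega
  obtain ⟨a, c, ha, hcn, h1, h2, -⟩ := h.exit (box_mono hm hb) hwn
  have hasph : a ∈ sph (0 : V d) n := by
    refine ⟨ha, ?_⟩
    by_contra hne
    push Not at hne
    refine hcn fun j => ?_
    have h3 := h2.1.abs_le j
    have h4 := ha j
    have h5 := hne j
    have h6 : |c j - (0 : V d) j| ≤ |c j - a j| + |a j - (0 : V d) j| := abs_sub_le _ _ _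
    omega
  have haY : a ∈ Y := by
    rw [← Finset.mem_coe, ← hY]
    exact ⟨hasph, b, hb, h1.mono le_rfl Set.inter_subset_right⟩
  have h3 := h2.2.2.2
  have := hc s(a, c) (by
    classical
    unfold lvo
    rw [Finset.mem_filter]
    exact ⟨mem_lv haY h2.1, fun h => hcn (mk_mem_eIn.1 h).2⟩)
  simp only [op, Set.mem_ofPred_eq] at h3
  rw [this] at h3; simp at h3

lemma few_le {p : ℝ} (h0 : 0 ≤ p) (h1 : p < 1) {m n : ℕ} (hm : m ≤ n) (ℓ : ℕ) :
    (1 - p) ^ (ℓ * (2 * d)) * Pr (fun _ => p) {ω | 1 ≤ (XX 0 m n (sph (0 : V d) n) ω).ncard ∧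
      (XX 0 m n (sph (0 : V d) n) ω).ncard < ℓ} ≤
    Pr (fun _ => p) (BL d m n) - Pr (fun _ => p) (BL d m (n + 1)) := by
  classical
  set I := ((sph_finite (0 : V d) n).toFinset.powerset).filter (fun Y => 1 ≤ Y.card ∧ Y.card < ℓ)
    with hI
  have hdec : {ω | 1 ≤ (XX 0 m n (sph (0 : V d) n) ω).ncard ∧
      (XX 0 m n (sph (0 : V d) n) ω).ncard < ℓ} =
      ⋃ Y ∈ I, {ω | XX 0 m n (sph (0 : V d) n) ω = (Y : Set (V d))} := by
    ext ω
    simp only [Set.mem_ofPred_eq, Set.mem_iUnion, exists_prop]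
    constructor
    · intro h
      have hf := XX_finite 0 m n (sph_finite (0 : V d) n) ω
      refine ⟨hf.toFinset, ?_, by simp⟩
      rw [Set.ncard_eq_toFinset_card _ hf] at h
      simp only [hI, Finset.mem_filter, Finset.mem_powerset]
      refine ⟨fun x hx => ?_, h⟩
      simp only [Set.Finite.mem_toFinset] at hx ⊢
      exact hx.1
    · rintro ⟨Y, hY, h⟩
      simp only [hI, Finset.mem_filter] at hY
      rw [h, Set.ncard_coe_finset]; exact hY.2
  have hLD : ∀ Y ∈ I, LD {ω : E d → Bool | XX 0 m n (sph (0 : V d) n) ω = (Y : Set (V d))}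
      (eIn (box 0 n)) := fun Y _ => LD_XX 0 m n _ (fun X => X = (Y : Set (V d)))
  have hdisj : ∀ Y ∈ I, ∀ Y' ∈ I, Y ≠ Y' →
      Disjoint {ω : E d → Bool | XX 0 m n (sph (0 : V d) n) ω = (Y : Set (V d))}
        {ω : E d → Bool | XX 0 m n (sph (0 : V d) n) ω = (Y' : Set (V d))} := by
    intro Y _ Y' _ hne
    rw [Set.disjoint_left]
    intro ω h h'
    exact hne (Finset.coe_injective (h.symm.trans h'))
  rw [hdec, Pr_sum_disjoint _ _ hLD hdisj, Finset.mul_sum,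
    ← Pr_diff _ (LD_BL m (n + 1)) (BL_anti m hm (Nat.le_succ n))]
  have hLD2 : ∀ Y ∈ I, LD ({ω : E d → Bool | XX 0 m n (sph (0 : V d) n) ω = (Y : Set (V d))} ∩
      {ω | ∀ e ∈ lvo n Y, ω e = false}) (eIn (box 0 n) ∪ (lvo n Y : Set (E d))) :=
    fun Y hY => (hLD Y hY).inter' (LD_all _ _)
  calc _ ≤ ∑ Y ∈ I, Pr (fun _ => p) ({ω : E d → Bool | XX 0 m n (sph (0 : V d) n) ω = (Y : Set (V d))} ∩
      {ω | ∀ e ∈ lvo n Y, ω e = false}) := by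
        refine Finset.sum_le_sum fun Y hY => ?_
        rw [Pr_inter _ (hLD Y hY) (LD_all (lvo n Y) false), mul_comm]
        · refine mul_le_mul_of_nonneg_left ?_ (Pr_nonneg _ _)
          rw [Pr_all_false, cl_eq h0 h1.le, Finset.prod_const]
          refine pow_le_pow_of_le_one (by linarith) (by linarith) ?_
          simp only [hI, Finset.mem_filter] at hY
          calc _ ≤ (lv Y).card := Finset.card_filter_le _ _
            _ ≤ Y.card * (2 * d) := lv_card Y
            _ ≤ _ := Nat.mul_le_mul_right _ hY.2.2.le
        · rw [Set.disjoint_left]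
          intro e he he'
          simp only [lvo, Finset.coe_filter, Set.mem_ofPred_eq] at he'
          exact he'.2 he
    _ = Pr (fun _ => p) (⋃ Y ∈ I, ({ω : E d → Bool | XX 0 m n (sph (0 : V d) n) ω = (Y : Set (V d))} ∩
      {ω | ∀ e ∈ lvo n Y, ω e = false})) := by
        rw [Pr_sum_disjoint _ _ hLD2]
        intro Y hY Y' hY' hne
        exact (hdisj Y hY Y' hY' hne).mono Set.inter_subset_left Set.inter_subset_left
    _ ≤ _ := by
        refine Pr_mono _ ?_
        intro ω hω
        simp only [Set.mem_iUnion, exists_prop] at hω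
        obtain ⟨Y, hY, h2, h3⟩ := hω
        refine ⟨?_, BL_fail hm h2 h3⟩
        simp only [hI, Finset.mem_filter] at hY
        show (XX 0 m n (sph (0 : V d) n) ω).Nonempty
        rw [h2]
        exact Finset.card_pos.1 hY.2.1

lemma few_small {p η : ℝ} (h0 : 0 ≤ p) (h1 : p < 1) (hη : 0 < η) {m : ℕ}
    (hm : ∀ L, m ≤ L → 1 - η ≤ Pr (fun _ => p) (BL d m L)) (ℓ n0 : ℕ) :
    ∃ n, n0 ≤ n ∧ Pr (fun _ => p) {ω | (XX 0 m n (sph (0 : V d) n) ω).ncard < ℓ} ≤ 2 * η := by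
  set c := (1 - p) ^ (ℓ * (2 * d)) with hc
  have hcpos : 0 < c := pow_pos (by linarith) _
  obtain ⟨n, hn0, hnm, hn⟩ : ∃ n, n0 ≤ n ∧ m ≤ n ∧
      Pr (fun _ => p) (BL d m n) - Pr (fun _ => p) (BL d m (n + 1)) ≤ c * η := by
    by_contra hne
    push Not at hne
    set n1 := max n0 m
    have : ∀ k : ℕ, Pr (fun _ => p) (BL d m (n1 + k)) ≤ 1 - k * (c * η) := by
      intro k
      induction k with
      | zero => simpa using Pr_le_one _ _
      | succ k ih =>
        have := hne (n1 + k) (by omega) (by omega)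
        push_cast
        rw [← add_assoc]; linarith
    obtain ⟨k, hk⟩ := exists_nat_gt (1 / (c * η))
    have h2 := this k
    have h3 := Pr_nonneg (fun _ => p) (BL d m (n1 + k))
    have h4 : 0 < c * η := by positivity
    rw [div_lt_iff₀ h4] at hk
    linarith
  refine ⟨n, hn0, ?_⟩
  have h2 := (few_le h0 h1 hnm ℓ).trans hn
  have h3 := le_of_mul_le_mul_left h2 hcpos
  have hsub : {ω : E d → Bool | (XX 0 m n (sph (0 : V d) n) ω).ncard < ℓ} ⊆
      (BL d m n)ᶜ ∪ {ω | 1 ≤ (XX 0 m n (sph (0 : V d) n) ω).ncard ∧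
      (XX 0 m n (sph (0 : V d) n) ω).ncard < ℓ} := by
    intro ω hω
    by_cases h : ω ∈ BL d m n
    · refine Or.inr ⟨?_, hω⟩
      exact (Set.ncard_pos (XX_finite 0 m n (sph_finite (0 : V d) n) ω)).2 h
    · exact Or.inl h
  have h4 := (Pr_mono (fun _ => p) hsub).trans (Pr_union_le _ _ _)
  rw [Pr_compl _ (LD_BL m n)] at h4
  have := hm n hnm
  linarith

/-! ### Square-root trick -/

def sg (b : Bool) : ℤ := if b then 1 else -1

lemma sg_mul (b : Bool) : sg b * sg b = 1 := by cases b <;> simp [sg]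
lemma sg_abs (b : Bool) : |sg b| = 1 := by cases b <;> simp [sg]

abbrev Tau (d : ℕ) := Fin d × (Fin d → Bool)

/-- face-orthant of the sphere -/
def Fc (τ : Tau d) (z : V d) (n : ℕ) : Set (V d) :=
  {x | x ∈ box z n ∧ sg (τ.2 τ.1) * (x τ.1 - z τ.1) = n ∧ ∀ j, 0 ≤ sg (τ.2 j) * (x j - z j)}

lemma Fc_finite (τ : Tau d) (z : V d) (n : ℕ) : (Fc τ z n).Finite :=
  (box_finite z n).subset fun _ h => h.1

lemma sph_cover {z x : V d} {n : ℕ} (h : x ∈ sph z n) : ∃ τ : Tau d, x ∈ Fc τ z n := by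
  obtain ⟨h1, i, hi⟩ := h
  have key : ∀ y : ℤ, sg (decide (0 ≤ y)) * y = |y| := by
    intro y
    by_cases h : 0 ≤ y
    · simp [sg, h, abs_of_nonneg h]
    · simp [sg, h, abs_of_neg (not_le.1 h)]
  refine ⟨(i, fun j => decide (0 ≤ x j - z j)), h1, ?_, fun j => ?_⟩
  · simp only [key]; exact hi
  · simp only [key]; exact abs_nonneg _

/-- signed permutation map sending face to face -/
def sp (τ1 τ : Tau d) (z : V d) (x : V d) : V d := fun j =>
  z j + sg (τ.2 j) * sg (τ1.2 (Equiv.swap τ1.1 τ.1 j)) * x (Equiv.swap τ1.1 τ.1 j)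

lemma sp_inj (τ1 τ : Tau d) (z : V d) : Function.Injective (sp τ1 τ z) := by
  intro x y h
  funext j
  have := congrFun h (Equiv.swap τ1.1 τ.1 j)
  simp only [sp, Equiv.swap_apply_self, add_right_inj] at this
  refine mul_left_cancel₀ ?_ this
  have h2 : ∀ b, sg b ≠ 0 := by intro b; cases b <;> simp [sg]
  exact mul_ne_zero (h2 _) (h2 _)

lemma sp_stdVec (τ1 τ : Tau d) (z x : V d) (i : Fin d) : ∃ b : Bool,
    sp τ1 τ z (x + stdVec d i) = sp τ1 τ z x + sg b • stdVec d (Equiv.swap τ1.1 τ.1 i) := by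
  set k := Equiv.swap τ1.1 τ.1 i with hk
  have hik : i = Equiv.swap τ1.1 τ.1 k := by rw [hk, Equiv.swap_apply_self]
  obtain ⟨b, hb⟩ : ∃ b, sg b = sg (τ.2 k) * sg (τ1.2 i) := by
    rcases τ.2 k with _ | _ <;> rcases τ1.2 i with _ | _
    · exact ⟨true, by simp [sg]⟩
    · exact ⟨false, by simp [sg]⟩
    · exact ⟨false, by simp [sg]⟩
    · exact ⟨true, by simp [sg]⟩
  refine ⟨b, ?_⟩
  funext j
  simp only [sp, Pi.add_apply, Pi.smul_apply, smul_eq_mul, stdVec, hb]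
  by_cases h : j = k
  · subst h
    rw [← hik]; simp; ring
  · have : Equiv.swap τ1.1 τ.1 j ≠ i := by
      intro h'; apply h; rw [← h', Equiv.swap_apply_self] at hk; exact hk.symm
    simp [h, this]

lemma sp_adj (τ1 τ : Tau d) (z x y : V d) (h : Adj x y) : Adj (sp τ1 τ z x) (sp τ1 τ z y) := by
  have key : ∀ x i, Adj (sp τ1 τ z x) (sp τ1 τ z (x + stdVec d i)) := by
    intro x i
    obtain ⟨b, hb⟩ := sp_stdVec τ1 τ z x i
    rw [hb]
    cases b
    · exact ⟨Equiv.swap τ1.1 τ.1 i, Or.inr (by simp [sg])⟩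
    · exact ⟨Equiv.swap τ1.1 τ.1 i, Or.inl (by simp [sg])⟩
  obtain ⟨i, h | h⟩ := h
  · rw [h]; exact key _ _
  · rw [h]; exact (key _ _).symm

lemma sp_box (τ1 τ : Tau d) (z x : V d) (n : ℕ) (h : x ∈ box (0 : V d) n) :
    sp τ1 τ z x ∈ box z n := by
  intro j
  have := h (Equiv.swap τ1.1 τ.1 j)
  simp only [sp, add_sub_cancel_left, abs_mul, sg_abs, one_mul]
  simpa using this

lemma sp_face (τ1 τ : Tau d) (z x : V d) (n : ℕ) (h : x ∈ Fc τ1 (0 : V d) n) :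
    sp τ1 τ z x ∈ Fc τ z n := by
  obtain ⟨h1, h2, h3⟩ := h
  have e : ∀ j, sg (τ.2 j) * (sp τ1 τ z x j - z j) =
      sg (τ1.2 (Equiv.swap τ1.1 τ.1 j)) * x (Equiv.swap τ1.1 τ.1 j) := by
    intro j
    simp only [sp, add_sub_cancel_left]
    rw [← mul_assoc, ← mul_assoc, sg_mul, one_mul]
  refine ⟨sp_box _ _ _ _ _ h1, ?_, fun j => ?_⟩
  · rw [e, Equiv.swap_apply_right]; simpa using h2
  · rw [e]; simpa using h3 (Equiv.swap τ1.1 τ.1 j)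

def few (τ : Tau d) (z : V d) (m n ℓ : ℕ) : Set (E d → Bool) :=
  {ω | (XX z m n (Fc τ z n) ω).ncard < ℓ}

lemma few_sym (p : ℝ) (τ1 τ : Tau d) (z : V d) (m n ℓ : ℕ) :
    Pr (fun _ => p) (few τ z m n ℓ) ≤ Pr (fun _ => p) (few τ1 0 m n ℓ) := by
  have hl : LD (few τ1 (0 : V d) m n ℓ) _ := LD_XX 0 m n (Fc τ1 0 n) (fun X => X.ncard < ℓ)
  rw [← Pr_pull (sp_inj τ1 τ z) p hl]
  refine Pr_mono _ fun ω hω => ?_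
  refine lt_of_le_of_lt (b := (XX z m n (Fc τ z n) ω).ncard) ?_ hω
  rw [← Set.ncard_image_of_injective _ (sp_inj τ1 τ z)]
  refine Set.ncard_le_ncard ?_ (XX_finite _ _ _ (Fc_finite _ _ _) _)
  rintro _ ⟨x, ⟨hx, b, hb, hc⟩, rfl⟩
  exact ⟨sp_face _ _ _ _ _ hx, _, sp_box _ _ _ _ _ hb,
    Cn_pull (sp_adj τ1 τ z) (fun x hx => sp_box _ _ _ _ _ hx) hc⟩

lemma XX_mono (z : V d) (m n : ℕ) (T : Set (V d)) {ω ω' : E d → Bool}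
    (h : ∀ e, ω e = true → ω' e = true) : XX z m n T ω ⊆ XX z m n T ω' :=
  fun _ ⟨h1, b, hb, hc⟩ => ⟨h1, b, hb, hc.mono (op_mono h) le_rfl⟩

lemma Dec_few (τ : Tau d) (z : V d) (m n ℓ : ℕ) : Dec (few τ z m n ℓ) := by
  intro ω ω' hw h h'
  exact h (lt_of_le_of_lt (Set.ncard_le_ncard (XX_mono _ _ _ _ hw)
    (XX_finite _ _ _ (Fc_finite _ _ _) _)) h')

lemma many (hd : 0 < d) {p θ : ℝ} (h0 : 0 ≤ p) (h1 : p < 1) (hθ : 0 < θ) (hth : ∀ n, θ ≤ th d n p)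
    {η : ℝ} (hη : 0 < η) : ∃ m : ℕ, ∀ ℓ n0 : ℕ, ∃ n, n0 ≤ n ∧ ∀ (τ : Tau d) (z : V d),
      Pr (fun _ => p) (few τ z m n ℓ) ≤ η := by
  classical
  set K := Fintype.card (Tau d) with hK
  have hKpos : K ≠ 0 := by
    rw [hK]; exact (Fintype.card_pos_iff.2 ⟨(⟨0, hd⟩, fun _ => true)⟩).ne'
  obtain ⟨m, hm⟩ := big_seed hd hθ hth (show 0 < η ^ K / 2 by positivity)
  refine ⟨m, fun ℓ n0 => ?_⟩
  obtain ⟨n, hn0, hn⟩ := few_small h0 h1 (show 0 < η ^ K / 2 by positivity) hm (K * ℓ + 1) n0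
  refine ⟨n, hn0, fun τ1 z => (few_sym p τ1 τ1 z m n ℓ).trans ?_⟩
  have key : (Pr (fun _ => p) (few τ1 0 m n ℓ)) ^ (Finset.univ : Finset (Tau d)).card ≤
      Pr (fun _ => p) (⋂ τ ∈ (Finset.univ : Finset (Tau d)), few τ (0 : V d) m n ℓ) :=
    harris_dec_pow _ _ (eIn_finite (box_finite (0 : V d) n))
      (fun τ _ => LD_XX 0 m n (Fc τ 0 n) (fun X => X.ncard < ℓ))
      (fun τ _ => Dec_few τ 0 m n ℓ) (Pr_nonneg _ _) (fun τ _ => few_sym p τ τ1 0 m n ℓ)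
  have hsub : (⋂ τ ∈ (Finset.univ : Finset (Tau d)), few τ (0 : V d) m n ℓ) ⊆
      {ω | (XX 0 m n (sph (0 : V d) n) ω).ncard < K * ℓ + 1} := by
    intro ω hω
    simp only [Finset.mem_univ, Set.iInter_true, Set.mem_iInter] at hω
    have hU : XX 0 m n (sph (0 : V d) n) ω ⊆ ⋃ τ : Tau d, XX 0 m n (Fc τ 0 n) ω := by
      rintro x ⟨hx, h⟩
      obtain ⟨τ, hτ⟩ := sph_cover hx
      exact Set.mem_iUnion.2 ⟨τ, hτ, h⟩
    have h2 := Set.ncard_le_ncard hU (Set.finite_iUnion fun τ => XX_finite _ _ _ (Fc_finite _ _ _) _)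
    have h3 : (⋃ τ : Tau d, XX 0 m n (Fc τ 0 n) ω).ncard ≤ ∑ τ : Tau d, (XX 0 m n (Fc τ 0 n) ω).ncard := by
      exact Set.ncard_iUnion_le_of_fintype _
    have h4 : ∑ τ : Tau d, (XX 0 m n (Fc τ 0 n) ω).ncard ≤ K * ℓ := by
      refine (Finset.sum_le_card_nsmul _ _ ℓ fun τ _ => (hω τ).le).trans ?_
      rw [smul_eq_mul, Finset.card_univ]
    show (XX 0 m n (sph (0 : V d) n) ω).ncard < K * ℓ + 1
    omega
  have h2 := key.trans ((Pr_mono _ hsub).trans hn)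
  rw [Finset.card_univ, ← hK] at h2
  refine le_of_pow_le_pow_left₀ hKpos hη.le (h2.trans (le_of_eq (by ring)))

end

end Perc

open MeasureTheory ProbabilityTheory

namespace Perc

noncomputable section

open TorusPerc (stdVec)

variable {d : ℕ}

/-! ### The one-step lemma -/

lemma Pr_cond_le {ι α : Type*} (p : ι → ℝ) (s : Finset α) {A B : α → Set (ι → Bool)} {S : Set ι}
    {T : α → Set ι} (hA : ∀ a ∈ s, LD (A a) S) (hB : ∀ a ∈ s, LD (B a) (T a))
    (hST : ∀ a ∈ s, Disjoint S (T a)) (hd : ∀ a ∈ s, ∀ b ∈ s, a ≠ b → Disjoint (A a) (A b)) {c : ℝ}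
    (hc0 : 0 ≤ c)
    (hc : ∀ a ∈ s, Pr p (B a) ≤ c) : Pr p (⋃ a ∈ s, A a ∩ B a) ≤ c := by
  calc _ ≤ ∑ a ∈ s, Pr p (A a ∩ B a) := Pr_biUnion_le _ _ _
    _ = ∑ a ∈ s, Pr p (A a) * Pr p (B a) :=
        Finset.sum_congr rfl fun a ha => Pr_inter p (hA a ha) (hB a ha) (hST a ha)
    _ ≤ ∑ a ∈ s, Pr p (A a) * c :=
        Finset.sum_le_sum fun a ha => mul_le_mul_of_nonneg_left (hc a ha) (Pr_nonneg _ _)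
    _ = Pr p (⋃ a ∈ s, A a) * c := by rw [← Finset.sum_mul, Pr_sum_disjoint p s hA hd]
    _ ≤ 1 * c := mul_le_mul_of_nonneg_right (Pr_le_one _ _) hc0
    _ = c := one_mul c

/-- points of the face reached from `R` in one sprinkled step -/
def Wt (R : Set (V d)) (z : V d) (n : ℕ) (T : Set (V d)) (ω f : E d → Bool) : Set (V d) :=
  {x | x ∈ T ∧ (x ∈ R ∨ ∃ a b, a ∈ R ∧ b ∉ R ∧ Adj a b ∧ a ∈ box z n ∧ b ∈ box z n ∧
    f s(a, b) = true ∧ Cn (op ω) (box z n \ R) b x)}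

lemma Wt_finite (R : Set (V d)) (z : V d) (n : ℕ) {T : Set (V d)} (hT : T.Finite)
    (ω f : E d → Bool) : (Wt R z n T ω f).Finite := hT.subset fun _ h => h.1

lemma Wt_congr (R : Set (V d)) (z : V d) (n : ℕ) (T : Set (V d)) {ω f ω' f' : E d → Bool}
    (h1 : ∀ e ∈ eIn (box z n), ω e = ω' e) (h2 : ∀ e ∈ eIn (box z n), f e = f' e) :
    Wt R z n T ω f = Wt R z n T ω' f' := by
  ext x
  simp only [Wt, Set.mem_ofPred_eq]
  refine and_congr_right fun _ => or_congr_right (exists_congr fun a => exists_congr fun b => ?_)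
  have e1 : Cn (op ω) (box z n \ R) b x ↔ Cn (op ω') (box z n \ R) b x :=
    (LD_Cn ((box_finite z n).sdiff) b x).iff fun e he => h1 e (eIn_mono Set.sdiff_subset he)
  rw [e1]
  constructor
  · rintro ⟨u1, u2, u3, u4, u5, u6, u7⟩
    exact ⟨u1, u2, u3, u4, u5, by rw [← h2 _ (mk_mem_eIn.2 ⟨u4, u5⟩)]; exact u6, u7⟩
  · rintro ⟨u1, u2, u3, u4, u5, u6, u7⟩
    exact ⟨u1, u2, u3, u4, u5, by rw [h2 _ (mk_mem_eIn.2 ⟨u4, u5⟩)]; exact u6, u7⟩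

lemma Wt_mono (R : Set (V d)) (z : V d) (n : ℕ) (T : Set (V d)) {ω f ω' f' : E d → Bool}
    (h1 : ∀ e, ω e = true → ω' e = true) (h2 : ∀ e, f e = true → f' e = true) :
    Wt R z n T ω f ⊆ Wt R z n T ω' f' := by
  rintro x ⟨hT, h | ⟨a, b, u1, u2, u3, u4, u5, u6, u7⟩⟩
  · exact ⟨hT, Or.inl h⟩
  · exact ⟨hT, Or.inr ⟨a, b, u1, u2, u3, u4, u5, h2 _ u6, u7.mono (op_mono h1) le_rfl⟩⟩

lemma XX_sub_Wt {R : Set (V d)} {z : V d} {m : ℕ} (n : ℕ) (T : Set (V d)) (hR : box z m ⊆ R)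
    (ω : E d → Bool) : XX z m n T ω ⊆ Wt R z n T ω ω := by
  rintro x ⟨hT, b, hb, hc⟩
  refine ⟨hT, ?_⟩
  by_cases hx : x ∈ R
  · exact Or.inl hx
  · obtain ⟨a, c, h1, h2, -, h4, h5⟩ := hc.last_exit (hR hb) hx
    exact Or.inr ⟨a, c, h1, h2, h4.1, h4.2.1, h4.2.2.1, h4.2.2.2, h5⟩

/-- two-field version of the few event -/
def HH (R : Set (V d)) (z : V d) (n : ℕ) (T : Set (V d)) (ℓ : ℕ) : Set (E d × Bool → Bool) :=
  {Ω | (Wt R z n T (fun e => Ω (e, false)) (fun e => Ω (e, true))).ncard < ℓ}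

lemma LD_HH (R : Set (V d)) (z : V d) (n : ℕ) (T : Set (V d)) (ℓ : ℕ) :
    LD (HH R z n T ℓ) (eIn (box z n) ×ˢ Set.univ) := by
  refine ⟨(eIn_finite (box_finite z n)).prod Set.finite_univ, fun Ω Ω' hw h => ?_⟩
  have := Wt_congr R z n T (ω := fun e => Ω (e, false)) (f := fun e => Ω (e, true))
    (ω' := fun e => Ω' (e, false)) (f' := fun e => Ω' (e, true))
    (fun e he => hw (e, false) ⟨he, trivial⟩) (fun e he => hw (e, true) ⟨he, trivial⟩)
  simp only [HH, Set.mem_ofPred_eq] at *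
  rw [← this]; exact h

def den2 (d : ℕ) (p δ : ℝ) : E d × Bool → ℝ := fun i => if i.2 then δ else p

/-- boundary edge of `R` -/
def bE (R : Set (V d)) (e : E d) : Prop := ∃ a b, a ∈ R ∧ b ∉ R ∧ e = s(a, b)

lemma stepA {p δ η : ℝ} (h0 : 0 ≤ p) (h1 : p < 1) (hδ : 0 ≤ δ) (hδ1 : δ ≤ 1) {r : ℕ} (hr : r ≠ 0)
    (hrp : (1 - δ) ^ r ≤ 1 - p) {R : Set (V d)} {z : V d} {m n ℓ : ℕ} (τ : Tau d)
    (hR : box z m ⊆ R)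
    (hf : Pr (fun _ => p) (few τ z m n (r * ℓ)) ≤ η) :
    (Pr (den2 d p δ) (HH R z n (Fc τ z n) ℓ)) ^ r ≤ η := by
  classical
  set T := Fc τ z n with hT
  let M : E d → Finset (Option (Fin r)) := fun e =>
    if bE R e then Finset.univ.image some else {none}
  let P : E d × Option (Fin r) → ℝ := fun i => if i.2 = none then p else δ
  let g : Fin r → E d × Bool → E d × Option (Fin r) := fun j i => (i.1, if i.2 then some j else none)
  have hg : ∀ j, Function.Injective (g j) := by
    rintro j ⟨e, b⟩ ⟨e', b'⟩ h
    simp only [g, Prod.mk.injEq] at h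
    obtain ⟨rfl, h⟩ := h
    cases b <;> cases b' <;> simp_all
  have hden : ∀ j, (fun k => P (g j k)) = den2 d p δ := by
    intro j; funext ⟨e, b⟩
    cases b <;> simp [P, g, den2]
  -- Harris
  have key : (Pr (den2 d p δ) (HH R z n T ℓ)) ^ (Finset.univ : Finset (Fin r)).card ≤
      Pr P (⋂ j ∈ (Finset.univ : Finset (Fin r)), {Ω | (fun k => Ω (g j k)) ∈ HH R z n T ℓ}) := by
    refine harris_dec_pow P _ (S := eIn (box z n) ×ˢ Set.univ)
      ((eIn_finite (box_finite z n)).prod Set.finite_univ) ?_ ?_ (Pr_nonneg _ _) ?_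
    · intro j _
      refine ((LD_HH R z n T ℓ).comp (g j)).mono ((eIn_finite (box_finite z n)).prod Set.finite_univ) ?_
      rintro _ ⟨⟨e, b⟩, he, rfl⟩
      exact ⟨he.1, trivial⟩
    · intro j _ Ω Ω' hw h h'
      refine h (lt_of_le_of_lt (b := (Wt R z n T (fun e => Ω' (g j (e, false)))
        (fun e => Ω' (g j (e, true)))).ncard) (Set.ncard_le_ncard ?_ (Wt_finite _ _ _ (Fc_finite _ _ _) _ _)) h')
      exact Wt_mono _ _ _ _ (fun e => hw _) (fun e => hw _)
    · intro j _
      rw [Pr_comp P (hg j) (LD_HH R z n T ℓ), hden]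
  rw [Finset.card_univ, Fintype.card_fin] at key
  refine key.trans ?_
  have hsub : (⋂ j ∈ (Finset.univ : Finset (Fin r)), {Ω : E d × Option (Fin r) → Bool |
      (fun k => Ω (g j k)) ∈ HH R z n T ℓ}) ⊆ {Ω | orMap M Ω ∈ few τ z m n (r * ℓ)} := by
    intro Ω hΩ
    simp only [Finset.mem_univ, Set.iInter_true, Set.mem_iInter] at hΩ
    have hU : XX z m n T (orMap M Ω) ⊆ ⋃ j : Fin r, Wt R z n T (fun e => Ω (e, none))
        (fun e => Ω (e, some j)) := by
      intro x hx
      have hr0 : 0 < r := Nat.pos_of_ne_zero hr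
      obtain ⟨hxT, h | ⟨a, b, u1, u2, u3, u4, u5, u6, u7⟩⟩ := XX_sub_Wt n T hR _ hx
      · exact Set.mem_iUnion.2 ⟨⟨0, hr0⟩, hxT, Or.inl h⟩
      · rw [orMap_true] at u6
        have hb : bE R s(a, b) := ⟨a, b, u1, u2, rfl⟩
        obtain ⟨t, ht, hΩt⟩ := u6
        simp only [M, if_pos hb, Finset.mem_image, Finset.mem_univ, true_and] at ht
        obtain ⟨j, rfl⟩ := ht
        refine Set.mem_iUnion.2 ⟨j, hxT, Or.inr ⟨a, b, u1, u2, u3, u4, u5, hΩt, ?_⟩⟩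
        refine Cn.mono' (fun u v huv => ⟨huv.1, huv.2.1, huv.2.2.1, ?_⟩) u7
        have h5 := huv.2.2.2
        simp only [op, Set.mem_ofPred_eq, orMap_true] at h5 ⊢
        obtain ⟨t, ht, hΩt⟩ := h5
        have hb : ¬ bE R s(u, v) := by
          rintro ⟨a, b, ha, -, h⟩
          have : a ∈ s(u, v) := by rw [h]; exact Sym2.mem_mk_left _ _
          rcases Sym2.mem_iff.1 this with rfl | rfl
          · exact huv.2.1.2 ha
          · exact huv.2.2.1.2 ha
        simp only [M, if_neg hb, Finset.mem_singleton] at ht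
        rw [← ht]; exact hΩt
    have h2 := Set.ncard_le_ncard hU (Set.finite_iUnion fun j => Wt_finite _ _ _ (Fc_finite _ _ _) _ _)
    have h3 := Set.ncard_iUnion_le_of_fintype (fun j : Fin r => Wt R z n T (fun e => Ω (e, none))
        (fun e => Ω (e, some j)))
    have h4 : ∑ j : Fin r, (Wt R z n T (fun e => Ω (e, none)) (fun e => Ω (e, some j))).ncard <
        ∑ j : Fin r, ℓ := by
      refine Finset.sum_lt_sum_of_nonempty ⟨⟨0, Nat.pos_of_ne_zero hr⟩, Finset.mem_univ _⟩ fun j _ => hΩ j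
    rw [Finset.sum_const, Finset.card_univ, Fintype.card_fin, smul_eq_mul] at h4
    show (XX z m n T (orMap M Ω)).ncard < r * ℓ
    omega
  refine (Pr_mono P hsub).trans ?_
  have hl : LD (few τ z m n (r * ℓ)) _ := LD_XX z m n (Fc τ z n) (fun X => X.ncard < r * ℓ)
  rw [pm_orMap M P hl]
  refine le_trans ?_ hf
  -- comparison for decreasing events
  have hcomp := Pr_le_of_le (p := fun _ : E d => p)
    (q := fun i => 1 - ∏ t ∈ M i, (1 - cl (P (i, t)))) (fun e => ?_) hl.compl (Dec_few τ z m n (r * ℓ))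
  · rw [Pr_compl _ hl, Pr_compl _ hl] at hcomp
    linarith
  · by_cases hb : bE R e
    · simp only [M, if_pos hb]
      rw [Finset.prod_image (by intro a _ b _ h; exact Option.some_injective _ h)]
      simp only [P, reduceCtorEq, if_false, Finset.prod_const, Finset.card_univ, Fintype.card_fin]
      rw [cl_eq hδ hδ1]; linarith
    · simp [M, if_neg hb, P, cl_eq h0 h1.le]

/-! seeds -/

lemma sep_subset {m k : ℕ} {Y : Finset (V d)} (hY : (2 * m + 1) ^ d * k ≤ Y.card) :
    ∃ Y1 ⊆ Y, k ≤ Y1.card ∧ ∀ x ∈ Y1, ∀ y ∈ Y1, x ≠ y → Disjoint (box x m) (box y m) := by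
  classical
  let f : V d → V d := fun x j => x j % (2 * m + 1 : ℕ)
  let t : Finset (V d) := Fintype.piFinset fun _ => Finset.Ico (0 : ℤ) (2 * m + 1 : ℕ)
  have hmaps : ∀ x ∈ Y, f x ∈ t := by
    intro x _
    simp only [t, f, Fintype.mem_piFinset, Finset.mem_Ico]
    exact fun j => ⟨Int.emod_nonneg _ (by omega), Int.emod_lt_of_pos _ (by omega)⟩
  have htc : t.card = (2 * m + 1) ^ d := by
    have e1 : (2 * (m:ℤ) + 1).toNat = 2 * m + 1 := by omega
    simp [t, Fintype.card_piFinset, e1]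
  have hne : t.Nonempty := by rw [← Finset.card_pos, htc]; positivity
  obtain ⟨c, -, hc⟩ := Finset.exists_le_card_fiber_of_mul_le_card_of_maps_to hmaps hne
    (by rw [htc]; exact hY)
  refine ⟨_, Finset.filter_subset _ _, hc, ?_⟩
  intro x hx y hy hne
  simp only [Finset.mem_filter] at hx hy
  obtain ⟨j, hj⟩ := Function.ne_iff.1 hne
  rw [Set.disjoint_left]
  intro u hu1 hu2
  have h1 := abs_le.1 (hu1 j)
  have h2 := abs_le.1 (hu2 j)
  have h3 : x j % (2 * m + 1 : ℕ) = y j % (2 * m + 1 : ℕ) := congrFun (hx.2.trans hy.2.symm) j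
  have h5 : ((2 * m + 1 : ℕ) : ℤ) ∣ x j - y j := Int.ModEq.dvd (Int.ModEq.symm h3)
  have h6 := Int.eq_zero_of_abs_lt_dvd h5 (abs_lt.2 ⟨by push_cast; omega, by push_cast; omega⟩)
  exact hj (by omega)

lemma box_ncard (t : V d) (m : ℕ) : (box_finite t m).toFinset.card = (2 * m + 1) ^ d := by
  classical
  have : (box_finite t m).toFinset =
      Fintype.piFinset fun j => Finset.Icc (t j - m) (t j + m) := by
    ext x
    simp only [Set.Finite.mem_toFinset, box, Set.mem_ofPred_eq, Fintype.mem_piFinset, Finset.mem_Icc]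
    refine forall_congr' fun j => ?_
    rw [abs_le]; omega
  rw [this, Fintype.card_piFinset]
  have h : ∀ j, (Finset.Icc (t j - m) (t j + m)).card = 2 * m + 1 := by
    intro j; rw [Int.card_Icc]; omega
  simp [h]

/-- edges of a ball as a finset -/
def eB (t : V d) (m : ℕ) : Finset (E d) := (eIn_finite (box_finite t m)).toFinset

lemma mem_eB {t : V d} {m : ℕ} {e : E d} : e ∈ eB t m ↔ e ∈ eIn (box t m) := by simp [eB]

lemma eB_card (t : V d) (m : ℕ) : (eB t m).card ≤ ((2 * m + 1) ^ d) ^ 2 := by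
  classical
  have : eB t m ⊆ ((box_finite t m).toFinset ×ˢ (box_finite t m).toFinset).image
      (fun x => s(x.1, x.2)) := by
    intro e
    induction e using Sym2.ind with
    | _ x y =>
      intro he
      rw [mem_eB, mk_mem_eIn] at he
      exact Finset.mem_image.2 ⟨(x, y), by simpa using he, rfl⟩
  refine (Finset.card_le_card this).trans (Finset.card_image_le.trans ?_)
  rw [Finset.card_product, box_ncard, sq]

lemma no_seed {ι : Type*} (P : ι → ℝ) {g : E d → ι} (hg : Function.Injective g) {δ : ℝ} (hδ : 0 ≤ δ)
    (hδ1 : δ ≤ 1)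
    (hP : ∀ e, P (g e) = δ) {m k : ℕ} {Y : Finset (V d)} (hY : (2 * m + 1) ^ d * k ≤ Y.card) :
    Pr P {Ω | ∀ t ∈ Y, ¬ ∀ e ∈ eB t m, Ω (g e) = true} ≤
      (1 - δ ^ (((2 * m + 1) ^ d) ^ 2)) ^ k := by
  classical
  obtain ⟨Y1, hsub, hk, hd⟩ := sep_subset hY
  have hl : ∀ t, LD {Ω : ι → Bool | ¬ ∀ e ∈ eB t m, Ω (g e) = true} (((eB t m).image g : Finset ι) : Set ι) := by
    intro t
    have := (LD_all ((eB t m).image g) true).compl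
    convert this using 1
    ext Ω; simp
  have h1 : Pr P {Ω | ∀ t ∈ Y, ¬ ∀ e ∈ eB t m, Ω (g e) = true} ≤
      Pr P (⋂ t ∈ Y1, {Ω | ¬ ∀ e ∈ eB t m, Ω (g e) = true}) := by
    refine Pr_mono _ fun Ω hΩ => ?_
    simp only [Set.mem_iInter]
    exact fun t ht => hΩ t (hsub ht)
  refine h1.trans ?_
  rw [Pr_biInter P Y1 (fun t _ => hl t)]
  · have hδp : δ ^ (((2 * m + 1) ^ d) ^ 2) ≤ 1 := pow_le_one₀ hδ hδ1
    have h2 : ∀ t ∈ Y1, Pr P {Ω | ¬ ∀ e ∈ eB t m, Ω (g e) = true} ≤ 1 - δ ^ (((2 * m + 1) ^ d) ^ 2) := by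
      intro t _
      have e1 : {Ω : ι → Bool | ¬ ∀ e ∈ eB t m, Ω (g e) = true} =
          {Ω | ∀ i ∈ (eB t m).image g, Ω i = true}ᶜ := by ext Ω; simp
      rw [e1, Pr_compl _ (LD_all _ _), Pr_all_true, Finset.prod_image (fun a _ b _ h => hg h)]
      simp only [hP, Finset.prod_const, cl_eq hδ hδ1]
      have := pow_le_pow_of_le_one hδ hδ1 (eB_card t m)
      linarith
    refine (Finset.prod_le_prod (fun _ _ => Pr_nonneg _ _) h2).trans ?_
    rw [Finset.prod_const]
    exact pow_le_pow_of_le_one (by linarith) (by linarith [pow_nonneg hδ (((2 * m + 1) ^ d) ^ 2)]) hk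
  · intro a ha b hb hab
    have := eIn_disj (hd a ha b hb hab)
    rw [Set.disjoint_left] at this ⊢
    intro i h1 h2
    simp only [Finset.coe_image, Set.mem_image, Finset.mem_coe, mem_eB] at h1 h2
    obtain ⟨e, he, rfl⟩ := h1
    obtain ⟨e', he', h⟩ := h2
    rw [hg h] at he'
    exact this he he'

/-- three-field success event -/
def Sx (m n : ℕ) (R : Set (V d)) (z : V d) (τ : Tau d) : Set (E d × Fin 3 → Bool) :=
  {Ω | ∃ t ∈ Wt R z n (Fc τ z n) (fun e => Ω (e, 0)) (fun e => Ω (e, 1)),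
    ∀ e ∈ eB t m, Ω (e, 2) = true}

lemma LD_Sx (m n : ℕ) (R : Set (V d)) (z : V d) (τ : Tau d) :
    LD (Sx m n R z τ) (eIn (box z (n + m)) ×ˢ Set.univ) := by
  refine ⟨(eIn_finite (box_finite z _)).prod Set.finite_univ, ?_⟩
  rintro Ω Ω' hw ⟨t, ht, he⟩
  have hsub : eIn (box z n) ⊆ eIn (box z (n + m)) := eIn_mono (box_mono (by omega))
  refine ⟨t, ?_, fun e hee => ?_⟩
  · rw [← Wt_congr R z n _ (ω := fun e => Ω (e, 0)) (f := fun e => Ω (e, 1))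
      (fun e he => hw (e, 0) ⟨hsub he, trivial⟩)
      (fun e he => hw (e, 1) ⟨hsub he, trivial⟩)]
    exact ht
  · rw [← hw (e, 2) ⟨?_, trivial⟩]
    · exact he e hee
    · rw [mem_eB] at hee
      exact eIn_mono (box_subset ht.1.1 (by omega)) hee

def den3 (d : ℕ) (p δ : ℝ) : E d × Fin 3 → ℝ := fun i => if i.2 = 0 then p else δ

lemma step_prob (hd : 0 < d) {p θ : ℝ} (h0 : 0 ≤ p) (h1 : p < 1) (hθ : 0 < θ)
    (hth : ∀ n, θ ≤ th d n p) {δ ε : ℝ} (hδ : 0 < δ) (hδ1 : δ ≤ 1) (hε : 0 < ε) :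
    ∃ m : ℕ, ∀ n0 : ℕ, ∃ n, n0 ≤ n ∧ ∀ (R : Set (V d)) (z : V d) (τ : Tau d), box z m ⊆ R →
      1 - ε ≤ Pr (den3 d p δ) (Sx m n R z τ) := by
  classical
  obtain ⟨r, hr⟩ := exists_pow_lt_of_lt_one (show 0 < 1 - p by linarith) (show 1 - δ < 1 by linarith)
  have hrp : (1 - δ) ^ (r + 1) ≤ 1 - p :=
    (pow_le_pow_of_le_one (by linarith) (by linarith) (Nat.le_succ r)).trans hr.le
  obtain ⟨m, hm⟩ := many hd h0 h1 hθ hth (show 0 < (ε / 2) ^ (r + 1) by positivity)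
  refine ⟨m, fun n0 => ?_⟩
  set M := ((2 * m + 1) ^ d) ^ 2
  have hδM : 0 < δ ^ M := by positivity
  have hδM1 : δ ^ M ≤ 1 := pow_le_one₀ hδ.le hδ1
  obtain ⟨k, hk⟩ := exists_pow_lt_of_lt_one (half_pos hε) (show 1 - δ ^ M < 1 by linarith)
  set ℓ := (2 * m + 1) ^ d * k with hℓ
  obtain ⟨n, hn0, hn⟩ := hm ((r + 1) * ℓ) n0
  refine ⟨n, hn0, fun R z τ hR => ?_⟩
  have hA := stepA h0 h1 hδ.le hδ1 (Nat.succ_ne_zero r) hrp τ hR (hn τ z)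
  have hA' : Pr (den2 d p δ) (HH R z n (Fc τ z n) ℓ) ≤ ε / 2 :=
    le_of_pow_le_pow_left₀ (Nat.succ_ne_zero r) (by positivity) hA
  set T := Fc τ z n with hT
  let g : E d × Bool → E d × Fin 3 := fun i => (i.1, if i.2 then 1 else 0)
  have hg : Function.Injective g := by
    rintro ⟨e, b⟩ ⟨e', b'⟩ h
    simp only [g, Prod.mk.injEq] at h
    obtain ⟨rfl, h⟩ := h
    cases b <;> cases b' <;> simp_all
  have hden : (fun k => den3 d p δ (g k)) = den2 d p δ := by
    funext ⟨e, b⟩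
    cases b <;> simp [den3, g, den2]
  have hB : Pr (den3 d p δ) {Ω | (fun k => Ω (g k)) ∈ HH R z n T ℓ} ≤ ε / 2 := by
    rw [Pr_comp _ hg (LD_HH R z n T ℓ), hden]; exact hA'
  let Wf : (E d × Fin 3 → Bool) → Set (V d) := fun Ω =>
    Wt R z n T (fun e => Ω (e, 0)) (fun e => Ω (e, 1))
  let I : Finset (Finset (V d)) := ((Fc_finite τ z n).toFinset.powerset).filter (fun Y => ℓ ≤ Y.card)
  have hC : Pr (den3 d p δ) (⋃ Y ∈ I, {Ω | Wf Ω = (Y : Set (V d))} ∩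
      {Ω | ∀ t ∈ Y, ¬ ∀ e ∈ eB t m, Ω (e, 2) = true}) ≤ ε / 2 := by
    refine Pr_cond_le _ I (S := eIn (box z n) ×ˢ {0, 1})
      (T := fun Y => ((Y.biUnion fun t => (eB t m).image fun e => (e, (2 : Fin 3)) :
        Finset (E d × Fin 3)) : Set (E d × Fin 3))) ?_ ?_ ?_ ?_ (half_pos hε).le ?_
    · intro Y _
      refine ⟨(eIn_finite (box_finite z n)).prod (Set.toFinite _), fun Ω Ω' hw h => ?_⟩
      show Wf Ω' = _
      rw [← show Wf Ω = (Y : Set (V d)) from h]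
      exact (Wt_congr R z n T (fun e he => hw (e, 0) ⟨he, by simp⟩)
        (fun e he => hw (e, 1) ⟨he, by simp⟩)).symm
    · intro Y _
      refine ⟨Finset.finite_toSet _, fun Ω Ω' hw h t ht hc => h t ht fun e he => ?_⟩
      rw [hw (e, 2)]
      · exact hc e he
      · simp only [Finset.coe_biUnion, Set.mem_iUnion, Finset.mem_coe, Finset.mem_image]
        exact ⟨t, ht, e, he, rfl⟩
    · intro Y _
      rw [Set.disjoint_left]
      rintro ⟨e, i⟩ h2 h3
      simp only [Finset.coe_biUnion, Set.mem_iUnion, Finset.mem_coe, Finset.mem_image,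
        Prod.mk.injEq] at h3
      obtain ⟨t, ht, e', he', -, rfl⟩ := h3
      simp at h2
    · intro Y _ Y' _ hne
      rw [Set.disjoint_left]
      intro Ω h h'
      exact hne (Finset.coe_injective (h.symm.trans h'))
    · intro Y hY
      simp only [I, Finset.mem_filter] at hY
      refine (no_seed (den3 d p δ) (g := fun e => (e, 2)) (fun a b h => by simpa using h) hδ.le hδ1
        (fun e => by simp [den3]) (hℓ ▸ hY.2)).trans hk.le
  have hsub : (Sx m n R z τ)ᶜ ⊆ {Ω | (fun k => Ω (g k)) ∈ HH R z n T ℓ} ∪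
      (⋃ Y ∈ I, {Ω | Wf Ω = (Y : Set (V d))} ∩
      {Ω | ∀ t ∈ Y, ¬ ∀ e ∈ eB t m, Ω (e, 2) = true}) := by
    intro Ω hΩ
    have hf : (Wf Ω).Finite := Wt_finite _ _ _ (Fc_finite _ _ _) _ _
    by_cases hc : (Wf Ω).ncard < ℓ
    · exact Or.inl hc
    · right
      refine Set.mem_biUnion (x := hf.toFinset) ?_ ⟨by simp, ?_⟩
      · simp only [I, Finset.coe_filter, Finset.mem_powerset, Set.mem_ofPred_eq]
        refine ⟨fun x hx => ?_, ?_⟩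
        · simp only [Set.Finite.mem_toFinset] at hx ⊢
          exact hx.1
        · rw [← Set.ncard_eq_toFinset_card _ hf]; omega
      · intro t ht hs
        exact hΩ ⟨t, by simpa using ht, hs⟩
  have := (Pr_mono (den3 d p δ) hsub).trans (Pr_union_le _ _ _)
  rw [Pr_compl _ (LD_Sx m n R z τ)] at this
  linarith

end

end Perc

open MeasureTheory ProbabilityTheory

namespace Perc

noncomputable section

open TorusPerc (stdVec)

variable {d : ℕ}

/-! ### Dynamic comparison with site percolation -/

lemma box_conn (t : V d) (m : ℕ) {x : V d} (hx : x ∈ box t m) : Cn (eIn (box t m)) (box t m) t x := by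
  obtain ⟨k, hk⟩ : ∃ k, ∑ j, (x j - t j).natAbs = k := ⟨_, rfl⟩
  induction k using Nat.strong_induction_on generalizing x with
  | _ k ih =>
    by_cases hxt : x = t
    · rw [hxt]; exact Cn.refl _ _ _
    obtain ⟨i, hi⟩ := Function.ne_iff.1 hxt
    have key : ∀ y : V d, Adj y x → (∀ j, j ≠ i → y j = x j) →
        (y i - t i).natAbs < (x i - t i).natAbs → Cn (eIn (box t m)) (box t m) t x := by
      intro y hy h1 h2
      have hyb : y ∈ box t m := by
        intro j
        have hxj := hx j
        by_cases hj : j = i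
        · subst hj; rw [Int.abs_eq_natAbs] at hxj ⊢; omega
        · rw [h1 j hj]; exact hxj
      have hlt : ∑ j, (y j - t j).natAbs < ∑ j, (x j - t j).natAbs := by
        refine Finset.sum_lt_sum (fun j _ => ?_) ⟨i, Finset.mem_univ _, h2⟩
        by_cases hj : j = i
        · subst hj; exact h2.le
        · rw [h1 j hj]
      exact (ih _ (hk ▸ hlt) hyb rfl).trans (Cn.single ⟨hy, hyb, hx, mk_mem_eIn.2 ⟨hyb, hx⟩⟩)
    rcases lt_or_gt_of_ne hi with h | h
    · refine key (x + stdVec d i) ⟨i, Or.inr rfl⟩ (fun j hj => by simp [stdVec, hj]) ?_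
      simp only [Pi.add_apply, stdVec, if_true]; omega
    · refine key (x - stdVec d i) ⟨i, Or.inl (by simp)⟩ (fun j hj => by simp [stdVec, hj]) ?_
      simp only [Pi.sub_apply, stdVec, if_true]; omega

abbrev Fld := Option (Z2 × Bool)

/-- edges available to the exploration -/
def oo (rng : Z2 → Set (E d)) (R : Set (V d)) (U : Set Z2) (Ω : E d × Fld → Bool) : Set (E d) :=
  {e | ((∀ x ∈ e, x ∉ R) ∧ Ω (e, none) = true) ∨
    ∃ v ∈ U, e ∈ rng v ∧ ∃ b, Ω (e, some (v, b)) = true}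

lemma oo_mono {rng : Z2 → Set (E d)} {R R' : Set (V d)} {U U' : Set Z2} (hR : R ⊆ R') (hU : U ⊆ U')
    (Ω : E d × Fld → Bool) : oo rng R' U Ω ⊆ oo rng R U' Ω := by
  rintro e (⟨h1, h2⟩ | ⟨v, hv, h⟩)
  · exact Or.inl ⟨fun x hx hxR => h1 x hx (hR hxR), h2⟩
  · exact Or.inr ⟨v, hU hv, h⟩

def Cl (rng : Z2 → Set (E d)) (D R : Set (V d)) (U : Set Z2) (Ω : E d × Fld → Bool) : Set (V d) :=
  {x | ∃ a ∈ R, Cn (oo rng R U Ω) D a x}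

lemma sub_Cl (rng : Z2 → Set (E d)) (D R : Set (V d)) (U : Set Z2) (Ω : E d × Fld → Bool) :
    R ⊆ Cl rng D R U Ω := fun x hx => ⟨x, hx, Cn.refl _ _ _⟩

lemma Cl_sub {rng : Z2 → Set (E d)} {D R : Set (V d)} (hR : R ⊆ D) (U : Set Z2)
    (Ω : E d × Fld → Bool) : Cl rng D R U Ω ⊆ D := fun _ ⟨_, ha, h⟩ => h.mem (hR ha)

/-- explored index set -/
def S1 (D ρ : Set (V d)) (v : Z2) : Set (E d × Fld) :=
  {i | i.1 ∈ eIn D ∧ ((i.2 = none ∧ ∃ x ∈ i.1, x ∈ ρ) ∨ ∃ b, i.2 = some (v, b))}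

/-- unexplored index set -/
def S2 (D ρ : Set (V d)) (U : Set Z2) : Set (E d × Fld) :=
  {i | i.1 ∈ eIn D ∧ ((i.2 = none ∧ ∀ x ∈ i.1, x ∉ ρ) ∨ ∃ v ∈ U, ∃ b, i.2 = some (v, b))}

lemma S12_disj (D ρ : Set (V d)) {v : Z2} {U : Set Z2} (hv : v ∉ U) :
    Disjoint (S1 D ρ v) (S2 D ρ U) := by
  rw [Set.disjoint_left]
  rintro ⟨e, f⟩ ⟨-, h1⟩ ⟨-, h2⟩
  dsimp only at h1 h2
  rcases h1 with ⟨rfl, x, hx, hxρ⟩ | ⟨b, rfl⟩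
  · rcases h2 with ⟨-, h⟩ | ⟨w, _, b, h⟩
    · exact h x hx hxρ
    · simp at h
  · rcases h2 with ⟨h, -⟩ | ⟨w, hw, b', h⟩
    · simp at h
    · simp only [Option.some.injEq, Prod.mk.injEq] at h
      rw [h.1] at hv; exact hv hw

lemma S1_fin {D : Set (V d)} (hD : D.Finite) (ρ : Set (V d)) (v : Z2) : (S1 D ρ v).Finite := by
  refine ((eIn_finite hD).prod (Set.toFinite ({none, some (v, true), some (v, false)} : Set Fld))).subset ?_
  rintro ⟨e, f⟩ ⟨h1, h2⟩
  refine ⟨h1, ?_⟩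
  dsimp only at h2 ⊢
  rcases h2 with ⟨rfl, -⟩ | ⟨b, rfl⟩
  · simp
  · cases b <;> simp

lemma S2_fin {D : Set (V d)} (hD : D.Finite) (ρ : Set (V d)) {U : Set Z2} (hU : U.Finite) :
    (S2 D ρ U).Finite := by
  refine ((eIn_finite hD).prod (((hU.prod (Set.finite_univ (α := Bool))).image some).insert none)).subset ?_
  rintro ⟨e, f⟩ ⟨h1, h2⟩
  refine ⟨h1, ?_⟩
  dsimp only at h2 ⊢
  rcases h2 with ⟨rfl, -⟩ | ⟨v, hv, b, rfl⟩
  · simp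
  · simp [hv]

lemma LD_ClEq (rng : Z2 → Set (E d)) {D : Set (V d)} (hD : D.Finite) (R ρ : Set (V d)) (v : Z2) :
    LD {Ω | Cl rng D R {v} Ω = ρ} (S1 D ρ v) := by
  refine ⟨S1_fin hD ρ v, ?_⟩
  intro Ω Ω' hw h
  replace h : Cl rng D R {v} Ω = ρ := h
  -- steps from ρ are the same
  have key : ∀ a b, a ∈ ρ → (stp (oo rng R {v} Ω) D a b ↔ stp (oo rng R {v} Ω') D a b) := by
    intro a b ha
    have : ∀ (hab : a ∈ D ∧ b ∈ D), (s(a, b) ∈ oo rng R {v} Ω ↔ s(a, b) ∈ oo rng R {v} Ω') := by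
      intro hab
      have he : s(a, b) ∈ eIn D := mk_mem_eIn.2 hab
      have e1 : Ω (s(a, b), none) = Ω' (s(a, b), none) :=
        hw _ ⟨he, Or.inl ⟨rfl, a, by simp, ha⟩⟩
      have e2 : ∀ c, Ω (s(a, b), some (v, c)) = Ω' (s(a, b), some (v, c)) := fun c =>
        hw _ ⟨he, Or.inr ⟨c, rfl⟩⟩
      simp only [oo, Set.mem_ofPred_eq, e1, Set.mem_singleton_iff, exists_eq_left, e2]
    constructor
    · rintro ⟨h1, h2, h3, h4⟩
      exact ⟨h1, h2, h3, (this ⟨h2, h3⟩).1 h4⟩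
    · rintro ⟨h1, h2, h3, h4⟩
      exact ⟨h1, h2, h3, (this ⟨h2, h3⟩).2 h4⟩
  show Cl rng D R {v} Ω' = ρ
  apply Set.Subset.antisymm
  · rintro x ⟨a, ha, hx⟩
    induction hx with
    | refl => rw [← h]; exact sub_Cl _ _ _ _ _ ha
    | @tail b c _ hs ih =>
      have hs' := (key b c ih).2 hs
      rw [← h] at ih ⊢
      obtain ⟨a', ha', h'⟩ := ih
      exact ⟨a', ha', h'.trans (Cn.single hs')⟩
  · intro x hx
    rw [← h] at hx
    obtain ⟨a, ha, hx⟩ := hx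
    refine ⟨a, ha, ?_⟩
    induction hx with
    | refl => exact Cn.refl _ _ _
    | @tail b c hb hs ih =>
      have hbρ : b ∈ ρ := by rw [← h]; exact ⟨a, ha, hb⟩
      exact ih.trans (Cn.single ((key b c hbρ).1 hs))

/-- success event -/
def Suc (rng : Z2 → Set (E d)) (D R : Set (V d)) (U : Set Z2) (T : Set (V d)) :
    Set (E d × Fld → Bool) := {Ω | ∃ t ∈ T, t ∈ Cl rng D R U Ω}

lemma LD_Suc (rng : Z2 → Set (E d)) {D : Set (V d)} (hD : D.Finite) (R : Set (V d)) {U : Set Z2}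
    (hU : U.Finite) (T : Set (V d)) : LD (Suc rng D R U T) (S2 D R U) := by
  refine ⟨S2_fin hD R hU, ?_⟩
  rintro Ω Ω' hw ⟨t, ht, a, ha, h⟩
  refine ⟨t, ht, a, ha, h.mono' ?_⟩
  rintro x y ⟨h1, h2, h3, h4⟩
  refine ⟨h1, h2, h3, ?_⟩
  have he : s(x, y) ∈ eIn D := mk_mem_eIn.2 ⟨h2, h3⟩
  rcases h4 with ⟨h5, h6⟩ | ⟨v, hv, h5, b, h6⟩
  · exact Or.inl ⟨h5, by rw [← hw _ ⟨he, Or.inl ⟨rfl, h5⟩⟩]; exact h6⟩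
  · exact Or.inr ⟨v, hv, h5, b, by rw [← hw _ ⟨he, Or.inr ⟨v, hv, b, rfl⟩⟩]; exact h6⟩

lemma Suc_step {rng : Z2 → Set (E d)} {D R ρ : Set (V d)} {U : Set Z2} {v : Z2} (hv : v ∈ U)
    (T : Set (V d)) {Ω : E d × Fld → Bool} (h1 : Cl rng D R {v} Ω = ρ)
    (h2 : Ω ∈ Suc rng D ρ (U \ {v}) T) : Ω ∈ Suc rng D R U T := by
  obtain ⟨t, ht, a, ha, h⟩ := h2
  have hR : R ⊆ ρ := h1 ▸ sub_Cl _ _ _ _ _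
  rw [← h1] at ha
  obtain ⟨a', ha', h'⟩ := ha
  exact ⟨t, ht, a', ha', (h'.mono (oo_mono le_rfl (by simpa using hv) Ω) le_rfl).trans
    (h.mono (oo_mono hR Set.sdiff_subset Ω) le_rfl)⟩

lemma Pr_cond_ge {ι α : Type*} (p : ι → ℝ) (s : Finset α) {A B : α → Set (ι → Bool)}
    {S T : α → Set ι} {X : Set (ι → Bool)} (hA : ∀ a ∈ s, LD (A a) (S a))
    (hB : ∀ a ∈ s, LD (B a) (T a)) (hST : ∀ a ∈ s, Disjoint (S a) (T a))
    (hd : ∀ a ∈ s, ∀ b ∈ s, a ≠ b → Disjoint (A a) (A b)) (hX : ∀ a ∈ s, A a ∩ B a ⊆ X) :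
    ∑ a ∈ s, Pr p (A a) * Pr p (B a) ≤ Pr p X := by
  calc ∑ a ∈ s, Pr p (A a) * Pr p (B a) = ∑ a ∈ s, Pr p (A a ∩ B a) :=
        Finset.sum_congr rfl fun a ha => (Pr_inter p (hA a ha) (hB a ha) (hST a ha)).symm
    _ = Pr p (⋃ a ∈ s, A a ∩ B a) := (Pr_sum_disjoint p s
        (fun a ha => (hA a ha).inter' (hB a ha)) fun a ha b hb hab =>
          (hd a ha b hb hab).mono Set.inter_subset_left Set.inter_subset_left).symm
    _ ≤ Pr p X := Pr_mono p (Set.iUnion₂_subset hX)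

def denO (d : ℕ) (p δ : ℝ) : E d × Fld → ℝ := fun i => if i.2 = none then p else δ

/-- field embedding -/
def gv (v : Z2) : E d × Fin 3 → E d × Fld := fun i =>
  (i.1, if i.2 = 0 then none else some (v, decide (i.2 = 1)))

lemma gv_inj (v : Z2) : Function.Injective (gv (d := d) v) := by
  rintro ⟨e, i⟩ ⟨e', i'⟩ h
  simp only [gv, Prod.mk.injEq] at h
  obtain ⟨rfl, h⟩ := h
  congr 1
  fin_cases i <;> fin_cases i' <;> simp_all

/-- good outcome of a step -/
def gd (τ : Tau d) (z : V d) (n m : ℕ) (ρ : Set (V d)) : Prop := ∃ t ∈ Fc τ z n, box t m ⊆ ρ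

lemma step_good {rng : Z2 → Set (E d)} {D R : Set (V d)} {p δ ε : ℝ} {m n : ℕ} {z : V d} {τ : Tau d}
    {v : Z2} (hs : 1 - ε ≤ Pr (den3 d p δ) (Sx m n R z τ)) (hD : box z (n + m) ⊆ D)
    (hr : eIn (box z (n + m)) ⊆ rng v) :
    1 - ε ≤ Pr (denO d p δ) {Ω | gd τ z n m (Cl rng D R {v} Ω)} := by
  have e : (fun i => denO d p δ (gv v i)) = den3 d p δ := by
    funext i; simp only [denO, gv, den3]
    by_cases h : i.2 = 0 <;> simp [h]
  rw [← e, ← Pr_comp (denO d p δ) (gv_inj v) (LD_Sx m n R z τ)] at hs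
  refine hs.trans (Pr_mono _ ?_)
  rintro Ω ⟨t, ⟨htF, ht⟩, hσ⟩
  simp only [gv] at ht hσ
  refine ⟨t, htF, ?_⟩
  have hzn : box z n ⊆ box z (n + m) := box_mono (by omega)
  have htC : t ∈ Cl rng D R {v} Ω := by
    rcases ht with ht | ⟨a, b, ha, hb, hab, haz, hbz, hF, hc⟩
    · exact sub_Cl _ _ _ _ _ ht
    · refine ⟨a, ha, (Cn.single ⟨hab, hD (hzn haz), hD (hzn hbz), ?_⟩).trans (hc.mono' ?_)⟩
      · exact Or.inr ⟨v, rfl, hr (mk_mem_eIn.2 ⟨hzn haz, hzn hbz⟩), true, by simpa using hF⟩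
      · rintro x y ⟨h1, h2, h3, h4⟩
        refine ⟨h1, hD (hzn h2.1), hD (hzn h3.1), Or.inl ⟨?_, by simpa [op] using h4⟩⟩
        intro w hw
        rcases Sym2.mem_iff.1 hw with rfl | rfl
        · exact h2.2
        · exact h3.2
  intro x hx
  obtain ⟨a, ha, h⟩ := htC
  have hsub : box t m ⊆ box z (n + m) := box_subset htF.1 (by omega)
  refine ⟨a, ha, h.trans ((box_conn t m hx).mono' ?_)⟩
  rintro u w ⟨h1, h2, h3, h4⟩
  refine ⟨h1, hD (hsub h2), hD (hsub h3), Or.inr ⟨v, rfl, hr (eIn_mono hsub h4), false, ?_⟩⟩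
  simpa using hσ _ (mem_eB.2 h4)

/-- centers -/
def cen (i0 i1 : Fin d) (n : ℕ) (v : Z2) : V d := fun j =>
  if j = i0 then n * v.1 else if j = i1 then n * v.2 else 0

lemma dir_exists {i0 i1 : Fin d} (hi : i0 ≠ i1) {u v : Z2} (h : Adj2 u v) (n : ℕ) {z : V d}
    (hz : z ∈ box (cen i0 i1 n u) n) : ∃ τ : Tau d, ∀ t ∈ Fc τ z n, t ∈ box (cen i0 i1 n v) n := by
  -- direction and sign
  obtain ⟨i, s, hs⟩ : ∃ (i : Fin d) (s : Bool), ∀ j, cen i0 i1 n v j = cen i0 i1 n u j +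
      if j = i then sg s * n else 0 := by
    rcases h with ⟨h1, h2 | h2⟩ | ⟨h1, h2 | h2⟩
    · refine ⟨i1, true, fun j => ?_⟩
      by_cases hj : j = i1
      · subst hj; simp [cen, hi.symm, sg, ← h2, mul_add]
      · simp [cen, hj, h1]
    · refine ⟨i1, false, fun j => ?_⟩
      by_cases hj : j = i1
      · subst hj; simp [cen, hi.symm, sg, ← h2, mul_add]
      · simp [cen, hj, h1]
    · refine ⟨i0, true, fun j => ?_⟩
      by_cases hj : j = i0
      · subst hj; simp [cen, sg, ← h2, mul_add]
      · simp [cen, hj, h1]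
    · refine ⟨i0, false, fun j => ?_⟩
      by_cases hj : j = i0
      · subst hj; simp [cen, sg, ← h2, mul_add]
      · simp [cen, hj, h1]
  refine ⟨(i, fun j => if j = i then s else decide (z j - cen i0 i1 n u j < 0)), ?_⟩
  rintro t ⟨h1, h2, h3⟩ j
  have hzj := abs_le.1 (hz j)
  have h1j := abs_le.1 (h1 j)
  have h3j := h3 j
  rw [abs_le, hs j]
  by_cases hj : j = i
  · subst hj
    simp only [if_true] at h2 ⊢
    have : t j - z j = sg s * n := by
      rw [← h2, ← mul_assoc, sg_mul, one_mul]
    omega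
  · simp only [hj, if_false] at h3j ⊢
    by_cases hn : z j - cen i0 i1 n u j < 0
    · simp only [hn, decide_true, sg, if_true] at h3j; omega
    · simp only [hn, decide_false, sg, Bool.false_eq_true, if_false] at h3j; omega

end

end Perc

open MeasureTheory ProbabilityTheory

namespace Perc

noncomputable section

open TorusPerc (stdVec)

variable {d : ℕ}

def rg (i0 i1 : Fin d) (n : ℕ) (v : Z2) : Set (E d) := eIn (box (cen i0 i1 n v) (4 * n))

lemma cen_adj (i0 i1 : Fin d) (n : ℕ) {u v : Z2} (h : Adj2 u v) :
    cen i0 i1 n u ∈ box (cen i0 i1 n v) n := by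
  intro j
  unfold cen
  have hn : |(n : ℤ)| = n := Nat.abs_cast n
  rcases h with ⟨h1, h2 | h2⟩ | ⟨h1, h2 | h2⟩ <;> rw [h1, ← h2] <;> split_ifs <;>
    simp [mul_add]

/-- the exploration dominates site percolation -/
lemma dyn_aux {i0 i1 : Fin d} (hi : i0 ≠ i1) {D : Set (V d)} (hD : D.Finite) {p δ ε : ℝ}
    (hε : 0 ≤ ε) (hε1 : ε ≤ 1) {m n : ℕ} (hmn : m ≤ n)
    (hs : ∀ (R : Set (V d)) (z : V d) (τ : Tau d), box z m ⊆ R →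
      1 - ε ≤ Pr (den3 d p δ) (Sx m n R z τ)) (t : Z2) (k : ℕ) :
    ∀ (U O : Finset Z2) (R : Set (V d)), U.card = k → R ⊆ D →
      (∀ v ∈ U, box (cen i0 i1 n v) (4 * n) ⊆ D) →
      (∀ u ∈ O, ∃ z ∈ box (cen i0 i1 n u) n, box z m ⊆ R) →
      Q ε t O U ≤ Pr (denO d p δ) (Suc (rg i0 i1 n) D R U (box (cen i0 i1 n t) n)) := by
  classical
  induction k with
  | zero =>
    intro U O R hU hR hG hO
    by_cases ht : t ∈ O
    · obtain ⟨z, hz, hzR⟩ := hO t ht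
      have : Suc (rg i0 i1 n) D R U (box (cen i0 i1 n t) n) = Set.univ :=
        Set.eq_univ_of_forall fun Ω => ⟨z, hz, sub_Cl _ _ _ _ _ (hzR (self_mem_box z m))⟩
      rw [this, Pr_univ]; exact Q_le_one _ _ _ _
    · rw [Q_zero ε t O U ht (by
        rw [Finset.card_eq_zero] at hU; rw [hU]; simp)]
      exact Pr_nonneg _ _
  | succ k ih =>
    intro U O R hU hR hG hO
    by_cases ht : t ∈ O
    · obtain ⟨z, hz, hzR⟩ := hO t ht
      have : Suc (rg i0 i1 n) D R U (box (cen i0 i1 n t) n) = Set.univ :=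
        Set.eq_univ_of_forall fun Ω => ⟨z, hz, sub_Cl _ _ _ _ _ (hzR (self_mem_box z m))⟩
      rw [this, Pr_univ]; exact Q_le_one _ _ _ _
    by_cases hadj : ∀ o ∈ O, ∀ v ∈ U, ¬ Adj2 o v
    · rw [Q_zero ε t O U ht hadj]; exact Pr_nonneg _ _
    push Not at hadj
    obtain ⟨u, hu, v, hv, huv⟩ := hadj
    obtain ⟨z, hz, hzR⟩ := hO u hu
    obtain ⟨τ, hτ⟩ := dir_exists hi huv n hz
    set T := box (cen i0 i1 n t) n
    set Pp := denO d p δ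
    set rng := rg (d := d) i0 i1 n
    have hb1 : box z (n + m) ⊆ box (cen i0 i1 n v) (4 * n) := by
      have h1 : z ∈ box (cen i0 i1 n v) (2 * n) := box_subset (cen_adj i0 i1 n huv) (by omega) hz
      exact box_subset h1 (by omega)
    have hgood := step_good (rng := rng) (D := D) (R := R) (v := v) (hs R z τ hzR)
      (hb1.trans (hG v hv)) (eIn_mono hb1)
    -- decompose over the explored cluster
    let s : Finset (Set (V d)) := (hD.finite_subsets).toFinset
    have hCl : ∀ Ω, Cl rng D R {v} Ω ∈ s := fun Ω => by
      simp only [s, Set.Finite.mem_toFinset, Set.mem_ofPred_eq]; exact Cl_sub hR _ _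
    let A : Set (V d) → Set (E d × Fld → Bool) := fun ρ => {Ω | Cl rng D R {v} Ω = ρ}
    have hA : ∀ ρ, LD (A ρ) (S1 D ρ v) := fun ρ => LD_ClEq rng hD R ρ v
    have hAd : ∀ ρ ∈ s, ∀ ρ' ∈ s, ρ ≠ ρ' → Disjoint (A ρ) (A ρ') := by
      intro ρ _ ρ' _ hne
      rw [Set.disjoint_left]
      intro Ω h1 h2
      exact hne (Eq.trans (Eq.symm h1) h2)
    have hsum := Pr_cond_ge Pp s (A := A)
      (B := fun ρ => Suc rng D ρ ((U.erase v : Finset Z2) : Set Z2) T)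
      (X := Suc rng D R U T) (fun ρ _ => hA ρ)
      (fun ρ _ => LD_Suc rng hD ρ (Finset.finite_toSet _) T)
      (fun ρ _ => S12_disj D ρ (by simp)) hAd (by
        rintro ρ - Ω ⟨h1, h2⟩
        rw [Finset.coe_erase] at h2
        exact Suc_step (Finset.mem_coe.2 hv) T h1 h2)
    refine le_trans ?_ hsum
    set Q1 := Q ε t (insert v O) (U.erase v)
    set Q0 := Q ε t O (U.erase v)
    have hQ : Q0 ≤ Q1 := Q_mono ε t (Finset.subset_insert v O) _
    have hcard : (U.erase v).card = k := by rw [Finset.card_erase_of_mem hv]; omega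
    have hG' : ∀ w ∈ U.erase v, box (cen i0 i1 n w) (4 * n) ⊆ D := fun w hw =>
      hG w (Finset.mem_of_mem_erase hw)
    have hterm : ∀ ρ ∈ s, Pr Pp (A ρ) * (if gd τ z n m ρ then Q1 else Q0) ≤
        Pr Pp (A ρ) * Pr Pp (Suc rng D ρ ((U.erase v : Finset Z2) : Set Z2) T) := by
      intro ρ hρ
      by_cases hne : (A ρ).Nonempty
      · have hρD : ρ ⊆ D := by simpa [s] using hρ
        have hRρ : R ⊆ ρ := by
          obtain ⟨Ω, hΩ⟩ := hne
          have hΩ' : Cl rng D R {v} Ω = ρ := hΩ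
          rw [← hΩ']; exact sub_Cl _ _ _ _ _
        refine mul_le_mul_of_nonneg_left ?_ (Pr_nonneg _ _)
        have hO' : ∀ u ∈ O, ∃ z ∈ box (cen i0 i1 n u) n, box z m ⊆ ρ := fun u hu => by
          obtain ⟨z, h1, h2⟩ := hO u hu
          exact ⟨z, h1, h2.trans hRρ⟩
        split_ifs with hg
        · refine ih (U.erase v) (insert v O) ρ hcard hρD hG' ?_
          intro w hw
          rcases Finset.mem_insert.1 hw with rfl | hw
          · obtain ⟨t', ht', h'⟩ := hg
            exact ⟨t', hτ t' ht', h'⟩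
          · exact hO' w hw
        · exact ih (U.erase v) O ρ hcard hρD hG' hO'
      · rw [Set.not_nonempty_iff_eq_empty.1 hne, Pr_empty]; simp
    refine le_trans ?_ (Finset.sum_le_sum hterm)
    have htot : ∑ ρ ∈ s, Pr Pp (A ρ) = 1 := by
      rw [← Pr_sum_disjoint Pp s (fun ρ _ => hA ρ) hAd, ← Pr_univ Pp]
      congr 1
      refine Set.eq_univ_of_forall fun Ω => ?_
      simp only [Set.mem_iUnion]
      exact ⟨_, hCl Ω, rfl⟩
    have hgs : 1 - ε ≤ ∑ ρ ∈ s.filter (gd τ z n m), Pr Pp (A ρ) := by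
      rw [← Pr_sum_disjoint Pp _ (fun ρ _ => hA ρ) fun ρ h ρ' h' =>
        hAd ρ (Finset.mem_of_mem_filter ρ h) ρ' (Finset.mem_of_mem_filter ρ' h')]
      refine hgood.trans (Pr_mono _ ?_)
      intro Ω hΩ
      simp only [Set.mem_iUnion, Finset.mem_filter]
      exact ⟨_, ⟨hCl Ω, hΩ⟩, rfl⟩
    have e : ∑ ρ ∈ s, Pr Pp (A ρ) * (if gd τ z n m ρ then Q1 else Q0) =
        (∑ ρ ∈ s.filter (gd τ z n m), Pr Pp (A ρ)) * (Q1 - Q0) + Q0 := by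
      have : ∀ ρ ∈ s, Pr Pp (A ρ) * (if gd τ z n m ρ then Q1 else Q0) =
          (if gd τ z n m ρ then Pr Pp (A ρ) else 0) * (Q1 - Q0) + Pr Pp (A ρ) * Q0 := by
        intro ρ _; split_ifs <;> ring
      rw [Finset.sum_congr rfl this, Finset.sum_add_distrib, ← Finset.sum_mul, ← Finset.sum_mul, htot,
        Finset.sum_filter]; ring
    rw [e]
    have hrec : Q ε t O U ≤ (1 - ε) * Q1 + ε * Q0 := Q_rec hε hε1 t O U v
    have := mul_le_mul_of_nonneg_right hgs (sub_nonneg.2 hQ)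
    linarith

/-- mask of fields relevant for an edge -/
def msk (i0 i1 : Fin d) (n : ℕ) (G : Finset Z2) (e : E d) : Finset Fld := by
  classical
  exact insert none (((G.filter fun v => e ∈ rg i0 i1 n v) ×ˢ (Finset.univ : Finset Bool)).image some)

lemma site_count {i0 i1 : Fin d} (hi : i0 ≠ i1) {n : ℕ} (hn : 0 < n) (G : Finset Z2) (e : E d)
    [DecidablePred fun v => e ∈ rg i0 i1 n v] :
    (G.filter fun v => e ∈ rg i0 i1 n v).card ≤ 81 := by
  classical
  obtain ⟨x, hx⟩ : ∃ x, x ∈ e := ⟨e.out.1, Sym2.out_fst_mem e⟩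
  have key : ∀ (a b : ℤ), |a - n * b| ≤ ((4 * n : ℕ) : ℤ) → b ∈ Finset.Icc (a / n - 4) (a / n + 4) := by
    intro a b h
    have hn' : (0 : ℤ) < n := by exact_mod_cast hn
    have h1 := Int.emod_nonneg a hn'.ne'
    have h2 := Int.emod_lt_of_pos a hn'
    have h3 := Int.mul_ediv_add_emod a n
    push_cast at h
    rw [abs_le] at h
    rw [Finset.mem_Icc]
    constructor
    · by_contra hc
      have : b + 1 ≤ a / n - 4 := by omega
      nlinarith
    · by_contra hc
      have : a / n + 4 + 1 ≤ b := by omega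
      nlinarith
  have hsub : (G.filter fun v => e ∈ rg i0 i1 n v) ⊆
      Finset.Icc (x i0 / n - 4) (x i0 / n + 4) ×ˢ Finset.Icc (x i1 / n - 4) (x i1 / n + 4) := by
    intro v hv
    have h := (Finset.mem_filter.1 hv).2 x hx
    refine Finset.mem_product.2 ⟨key _ _ ?_, key _ _ ?_⟩
    · have := h i0; simpa [cen] using this
    · have := h i1; simpa [cen, hi.symm] using this
  refine (Finset.card_le_card hsub).trans ?_
  rw [Finset.card_product, Int.card_Icc, Int.card_Icc]
  have : ∀ a : ℤ, (a + 4 + 1 - (a - 4)).toNat = 9 := fun a => by omega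
  rw [this, this]

lemma dyn {i0 i1 : Fin d} (hi : i0 ≠ i1) {D : Set (V d)} (hD : D.Finite) {p δ ε p2 : ℝ}
    (h0 : 0 ≤ p) (h1 : p ≤ 1) (hδ : 0 ≤ δ) (hδ1 : δ ≤ 1) (hp2 : p + 162 * δ ≤ p2)
    (hε : 0 ≤ ε) (hε1 : ε ≤ 1 / 162) {m n : ℕ} (hmn : m ≤ n) (hn : 0 < n)
    (hs : ∀ (R : Set (V d)) (z : V d) (τ : Tau d), box z m ⊆ R →
      1 - ε ≤ Pr (den3 d p δ) (Sx m n R z τ)) (K : ℕ) {y : Z2} (hy : y ∈ Blk K 0)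
    (hG : ∀ v ∈ Blk K 0, box (cen i0 i1 n v) (4 * n) ⊆ D) :
    1 - 4 * ε ≤ Pr (fun _ => p2) {ω : E d → Bool | ∃ a ∈ box (0 : V d) m,
      ∃ t ∈ box (cen i0 i1 n y) n, Cn (op ω) D a t} := by
  classical
  have hx : (0 : Z2) ∈ Blk K 0 := by
    rw [Blk_iff]; simp
  have hc0 : cen i0 i1 n (0 : Z2) = 0 := by
    funext j; simp [cen]
  set G := (Blk_fin K 0).toFinset with hGdef
  set A : Set (E d → Bool) := {ω : E d → Bool | ∃ a ∈ box (0 : V d) m,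
      ∃ t ∈ box (cen i0 i1 n y) n, Cn (op ω) D a t} with hAdef
  have hA : LD A (eIn D) := LD.biUnion_ex (eIn_finite hD) fun a _ =>
    LD.biUnion_ex (eIn_finite hD) fun t _ => LD_Cn hD a t
  have hAi : Inc A := fun ω ω' hw ⟨a, ha, t, ht, h⟩ => ⟨a, ha, t, ht, Inc_Cn _ _ _ ω ω' hw h⟩
  have hQ := Q_lower hε hε1 K hx hy
  have hdyn := dyn_aux hi hD (p := p) (δ := δ) hε (by linarith) hmn hs y _ (G.erase 0) {0}
    (box (0 : V d) m) rfl (by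
      have := hG 0 hx
      rw [hc0] at this
      exact (box_mono (by omega)).trans this) (by
      intro v hv
      exact hG v (by simpa [hGdef] using Finset.mem_of_mem_erase hv)) (by
      intro u hu
      rw [Finset.mem_singleton] at hu
      subst hu
      exact ⟨0, by rw [hc0]; exact self_mem_box _ _, le_rfl⟩)
  refine hQ.trans (hdyn.trans ?_)
  have hsub : Suc (rg i0 i1 n) D (box (0 : V d) m) ((G.erase 0 : Finset Z2) : Set Z2)
      (box (cen i0 i1 n y) n) ⊆ {Ω | orMap (msk i0 i1 n G) Ω ∈ A} := by
    rintro Ω ⟨t, ht, a, ha, h⟩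
    refine ⟨a, ha, t, ht, h.mono ?_ le_rfl⟩
    rintro e (⟨-, h⟩ | ⟨v, hv, he, b, h⟩)
    · show orMap _ Ω e = true
      rw [orMap_true]; exact ⟨none, by simp [msk], h⟩
    · show orMap _ Ω e = true
      rw [orMap_true]
      refine ⟨some (v, b), ?_, h⟩
      have hv' : v ∈ G := Finset.mem_of_mem_erase (Finset.mem_coe.1 hv)
      simp [msk, hv', he]
  refine (Pr_mono _ hsub).trans ?_
  rw [pm_orMap _ _ hA]
  refine Pr_le_of_le (fun e => ?_) hA hAi
  refine le_trans ?_ hp2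
  unfold msk
  rw [Finset.prod_insert (by simp), Finset.prod_image (by simp)]
  simp only [denO, if_true, reduceCtorEq, if_false, cl_eq h0 h1, cl_eq hδ hδ1, Finset.prod_const,
    Finset.card_product, Finset.card_univ, Fintype.card_bool]
  set k := (G.filter fun v => e ∈ rg i0 i1 n v).card with hk
  have hk81 : k ≤ 81 := site_count hi hn G e
  have hB : 1 + ((k * 2 : ℕ) : ℝ) * (-δ) ≤ (1 + -δ) ^ (k * 2) :=
    one_add_mul_le_pow (by linarith) _
  have hk' : (k : ℝ) ≤ 81 := by exact_mod_cast hk81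
  rw [← sub_eq_add_neg] at hB
  push_cast at hB
  have hB2 : 1 - 162 * δ ≤ (1 - δ) ^ (k * 2) := by nlinarith
  nlinarith [mul_le_mul_of_nonneg_left hB2 (sub_nonneg.2 h1), mul_nonneg h0 hδ]

end

end Perc

open MeasureTheory ProbabilityTheory

namespace Perc

noncomputable section

open TorusPerc (stdVec)

variable {d : ℕ}

def ax (i0 : Fin d) (L : ℤ) : V d := fun j => if j = i0 then L else 0

/-- long-range connection event -/
def LK (i0 : Fin d) (b L : ℕ) (w : V d) : Set (E d → Bool) :=
  {ω | ∃ a ∈ box w b, ∃ t ∈ box (w + ax i0 L) b, Cn (op ω) (box w (4 * L)) a t}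

lemma LD_LK (i0 : Fin d) (b L : ℕ) (w : V d) : LD (LK i0 b L w) (eIn (box w (4 * L)) ∩ LE d) :=
  LD.biUnion_ex ((eIn_finite (box_finite _ _)).inter_of_left _) fun a _ =>
    LD.biUnion_ex ((eIn_finite (box_finite _ _)).inter_of_left _) fun t _ =>
      LD_Cn' (box_finite _ _) a t

lemma Inc_LK (i0 : Fin d) (b L : ℕ) (w : V d) : Inc (LK i0 b L w) :=
  fun ω ω' hw ⟨a, ha, t, ht, h⟩ => ⟨a, ha, t, ht, Inc_Cn _ _ _ ω ω' hw h⟩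

lemma Pr_LK (i0 : Fin d) (b L : ℕ) (w : V d) (p : ℝ) :
    Pr (fun _ => p) (LK i0 b L 0) ≤ Pr (fun _ => p) (LK i0 b L w) := by
  rw [← Pr_pull (σ := fun x => x + w) (add_left_injective w) p (LD_LK i0 b L 0)]
  refine Pr_mono _ ?_
  rintro ω ⟨a, ha, t, ht, h⟩
  refine ⟨a + w, ?_, t + w, ?_, ?_⟩
  · have := (mem_box_add (a := w)).2 ha
    simpa using this
  · have := (mem_box_add (a := w)).2 ht
    rw [add_comm w]; simpa using this
  · refine Cn_pull (σ := fun x => x + w) (fun x y h => Adj_add w h) ?_ h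
    intro x hx
    have := (mem_box_add (a := w)).2 hx
    simpa using this

lemma long_link (hd : 2 ≤ d) {i0 i1 : Fin d} (hi : i0 ≠ i1) {p p2 θ : ℝ} (h0 : 0 ≤ p) (hp : p < p2)
    (hp2 : p2 ≤ 1) (hθ : 0 < θ) (hth : ∀ n, θ ≤ th d n p) :
    ∃ b L0 : ℕ, 10 ≤ b ∧ ∀ L, L0 ≤ L → 1 - 4 * (1 / 1000) ≤ Pr (fun _ => p2) (LK i0 b L (0 : V d)) := by
  obtain ⟨m, hm⟩ := step_prob (by omega) h0 (by linarith) hθ hth (δ := (p2 - p) / 162)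
    (ε := 1 / 1000) (by linarith) (by linarith) (by norm_num)
  obtain ⟨n, hn, hs⟩ := hm (m + 10)
  refine ⟨2 * n, 4 * n, by omega, fun L hL => ?_⟩
  set k := L / n with hk
  have hn0 : 0 < n := by omega
  have hk1 : 1 ≤ k := (Nat.le_div_iff_mul_le hn0).2 (by omega)
  have hkL : n * k ≤ L := Nat.mul_div_le L n
  have hkL' : L < n * k + n := by
    have := Nat.lt_mul_div_succ L hn0
    rw [mul_add, mul_one] at this; exact this
  set K := Nat.log 3 k + 1 with hK
  have hK1 : k < 3 ^ K := Nat.lt_pow_succ_log_self (by norm_num) k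
  have hK2 : 3 ^ K ≤ 3 * k := by
    rw [hK, pow_succ, mul_comm]
    exact Nat.mul_le_mul_left 3 (Nat.pow_log_le_self 3 (by omega))
  have hy : ((k : ℤ), (0 : ℤ)) ∈ Blk K 0 := by
    rw [Blk_iff]
    have : (k : ℤ) < 3 ^ K := by exact_mod_cast hK1
    simp [this]
  have hdyn := dyn (d := d) hi (box_finite 0 (4 * L)) (p := p) (δ := (p2 - p) / 162) (ε := 1 / 1000)
    (p2 := p2) h0 (by linarith) (by linarith) (by linarith) (by linarith) (by norm_num) (by norm_num)
    (m := m) (n := n) (by omega) hn0 hs K hy (by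
      intro v hv
      rw [Blk_iff] at hv
      simp only [Prod.fst_zero, Prod.snd_zero, mul_zero, zero_add, mul_one] at hv
      have hK2' : (3 : ℤ) ^ K ≤ 3 * k := by exact_mod_cast hK2
      have hkL2 : (n : ℤ) * k ≤ L := by exact_mod_cast hkL
      have hnn : (0 : ℤ) ≤ n := by positivity
      have hb : ∀ a : ℤ, 0 ≤ a → a < 3 ^ K → |(n : ℤ) * a| ≤ ((3 * L : ℕ) : ℤ) := by
        intro a h1 h2
        rw [abs_of_nonneg (by positivity)]
        push_cast
        nlinarith
      refine box_subset (k := 3 * L) ?_ (by omega)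
      intro j
      unfold cen
      split_ifs
      · simpa using hb _ hv.1.1 hv.1.2
      · simpa using hb _ hv.2.1 hv.2.2
      · simp)
  refine hdyn.trans (Pr_mono _ ?_)
  rintro ω ⟨a, ha, t, ht, h⟩
  refine ⟨a, box_mono (by omega) ha, t, ?_, h⟩
  refine box_subset (m := n) (k := n) ?_ (by omega) ht
  intro j
  have hkL3 : (n : ℤ) * k ≤ L := by exact_mod_cast hkL
  have hkL4 : (L : ℤ) < n * k + n := by exact_mod_cast hkL'
  unfold cen ax
  by_cases hj : j = i0
  · simp only [hj, if_true, Pi.add_apply, Pi.zero_apply, zero_add]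
    rw [abs_le]; constructor <;> linarith
  · simp [hj]

end

end Perc

open MeasureTheory ProbabilityTheory

namespace Perc

noncomputable section

open TorusPerc (stdVec)

variable {d : ℕ}

open Classical in
/-- torus edges of eleven blocks -/
def TT (hd : 0 < d) (N : ℕ) (i0 : Fin d) (b q : ℕ) (w : V d) : Finset (TorusPerc.Edge d N) :=
  (Finset.range 11).biUnion fun j =>
    ((eB (w + ax i0 (j * q : ℕ)) b).filter (· ∈ LE d)).image (tg hd N)

lemma TT_card (hd : 0 < d) (N : ℕ) (i0 : Fin d) (b q : ℕ) (w : V d) :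
    (TT hd N i0 b q w).card ≤ 11 * ((2 * b + 1) ^ d) ^ 2 := by
  classical
  refine (Finset.card_biUnion_le_card_mul _ _ (((2 * b + 1) ^ d) ^ 2) fun j _ => ?_).trans (by simp)
  exact Finset.card_image_le.trans ((Finset.card_filter_le _ _).trans (eB_card _ _))

lemma TT_disj (hd : 0 < d) {N : ℕ} {i0 i1 : Fin d} (hi : i0 ≠ i1) (b q : ℕ) {K s s' : ℕ}
    (hs : s < K) (hs' : s' < K) (hne : s ≠ s') (hK : K * (2 * b + 2) ≤ N) :
    Disjoint (TT hd N i0 b q (ax i1 (s * (2 * b + 2) : ℕ)))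
      (TT hd N i0 b q (ax i1 (s' * (2 * b + 2) : ℕ))) := by
  classical
  rw [Finset.disjoint_left]
  intro e h1 h2
  simp only [TT, Finset.mem_biUnion, Finset.mem_image, Finset.mem_filter, mem_eB] at h1 h2
  obtain ⟨j, -, _, ⟨he, x, i, rfl⟩, rfl⟩ := h1
  obtain ⟨j', -, _, ⟨he', x', i', rfl⟩, h⟩ := h2
  rw [tg_mk, tg_mk, Prod.mk.injEq] at h
  have h3 := congrFun h.1 i1
  simp only [TorusPerc.proj] at h3
  rw [ZMod.intCast_eq_intCast_iff_dvd_sub] at h3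
  have h4 := abs_le.1 ((mk_mem_eIn.1 he).1 i1)
  have h5 := abs_le.1 ((mk_mem_eIn.1 he').1 i1)
  simp only [ax, Pi.add_apply, if_true, if_neg hi.symm, add_zero] at h4 h5
  push_cast at h4 h5
  have hbig : ∀ u v : ℕ, u < v → v < K → (2 * b + 2 : ℤ) ≤ v * (2 * b + 2) - u * (2 * b + 2) ∧
      (v * (2 * b + 2) - u * (2 * b + 2) : ℤ) ≤ N - (2 * b + 2) := by
    intro u v huv hv
    have e1 : (u : ℤ) + 1 ≤ v := by exact_mod_cast huv
    have e2 : (v : ℤ) + 1 ≤ K := by exact_mod_cast hv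
    have e3 : (K : ℤ) * (2 * b + 2) ≤ N := by exact_mod_cast hK
    have e4 : (0 : ℤ) ≤ u := by positivity
    have e5 : (0 : ℤ) ≤ b := by positivity
    constructor <;> nlinarith
  rcases lt_or_gt_of_ne hne with hlt | hlt
  · have := hbig s s' hlt hs'
    have h6 : (0 : ℤ) < x' i1 - x i1 := by linarith
    have h7 : (N : ℤ) ∣ x' i1 - x i1 := by rw [← neg_sub]; exact (dvd_neg).2 h3
    have := Int.le_of_dvd h6 h7
    linarith
  · have := hbig s' s hlt hs
    have h6 : (0 : ℤ) < x i1 - x' i1 := by linarith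
    have := Int.le_of_dvd h6 h3
    linarith

lemma TT_giant (hd : 0 < d) {N : ℕ} (hN : 1 ≤ N) {i0 : Fin d} {b q : ℕ} (hb : 10 ≤ b) (hq : q = N / 10)
    (w : V d) {ω : TorusPerc.Config d N} (h1 : ∀ e ∈ TT hd N i0 b q w, ω e = true)
    (h2 : ∀ j ∈ Finset.range 10, lf hd ω ∈ LK i0 b q (w + ax i0 (j * q : ℕ))) :
    ω ∈ TorusPerc.giantEvent d N := by
  classical
  have hbx : ∀ j < 11, ∀ x ∈ box (w + ax i0 (j * q : ℕ)) b,
      Cn (op (lf hd ω)) Set.univ (w + ax i0 (j * q : ℕ)) x := by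
    intro j hj x hx
    refine (box_conn _ _ hx).mono' ?_
    rintro u v ⟨h3, h4, h5, h6⟩
    refine ⟨h3, trivial, trivial, ?_⟩
    refine h1 _ ?_
    simp only [TT, Finset.mem_biUnion, Finset.mem_range]
    exact ⟨j, hj, Finset.mem_image_of_mem _ (Finset.mem_filter.2 ⟨mem_eB.2 h6, h3.mem_LE⟩)⟩
  have hch : ∀ j ≤ 10, Cn (op (lf hd ω)) Set.univ (w + ax i0 (0 * q : ℕ)) (w + ax i0 (j * q : ℕ)) := by
    intro j
    induction j with
    | zero => intro _; exact Cn.refl _ _ _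
    | succ j ih =>
      intro hj
      obtain ⟨a, ha, t, ht, h⟩ := h2 j (by simp; omega)
      have e : w + ax i0 (j * q : ℕ) + ax i0 (q : ℕ) = w + ax i0 ((j + 1) * q : ℕ) := by
        rw [add_assoc]
        congr 1
        funext l
        simp only [ax, Pi.add_apply]
        split_ifs
        · push_cast; ring
        · rfl
      rw [e] at ht
      exact (((ih (by omega)).trans (hbx j (by omega) a ha)).trans
        (h.mono le_rfl (Set.subset_univ _))).trans (hbx (j + 1) (by omega) t ht).symm
  have hw0 : w + ax i0 (0 * q : ℕ) = w := by
    funext l; simp [ax]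
  have hend : w + ax i0 N ∈ box (w + ax i0 (10 * q : ℕ)) b := by
    intro l
    simp only [ax, Pi.add_apply, add_sub_add_left_eq_sub]
    split_ifs
    · rw [abs_le]; constructor <;> omega
    · simp
  have hfin := (hch 10 le_rfl).trans (hbx 10 (by omega) _ hend)
  rw [hw0] at hfin
  refine ⟨w, w + ax i0 N, ?_, ?_, (connected_iff hd ω _ _).2 hfin⟩
  · intro h
    have := congrFun h i0
    simp [ax] at this
    omega
  · funext l
    simp only [TorusPerc.proj, Pi.add_apply, ax]
    split_ifs <;> simp

lemma Pr_sdiff_le {ι : Type*} [Finite ι] (p : ι → ℝ) {A B : Set (ι → Bool)} (iA : Inc A) (iB : Inc B) {η : ℝ}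
    (hB : 1 - η ≤ Pr p B) : Pr p (A \ B) ≤ Pr p A * η := by
  have h1 := harris p (LD_finite A) (LD_finite B) iA iB
  have h2 := Pr_diff p (LD_finite (A ∩ B)) (A := A) Set.inter_subset_left
  have e : A \ (A ∩ B) = A \ B := by
    ext x; constructor
    · rintro ⟨h1, h2⟩; exact ⟨h1, fun h => h2 ⟨h1, h⟩⟩
    · rintro ⟨h1, h2⟩; exact ⟨h1, fun h => h2 h.2⟩
  rw [e] at h2
  have := mul_le_mul_of_nonneg_left hB (Pr_nonneg p A)
  linarith

lemma supercrit_giant (hd : 2 ≤ d) {p p2 : ℝ} (h0 : 0 ≤ p) (hp : p < p2) (hp2 : p2 ≤ 1)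
    (hθ : 0 < ZLattice.theta d p) :
    ∀ᶠ N : ℕ in Filter.atTop, 1 / 2 < Pr (fun _ => p2) (TorusPerc.giantEvent d N) := by
  classical
  have hd0 : 0 < d := by omega
  let i0 : Fin d := ⟨0, hd0⟩
  let i1 : Fin d := ⟨1, by omega⟩
  have hi : i0 ≠ i1 := by simp [i0, i1]
  have hth : ∀ n, ZLattice.theta d p ≤ th d n p := by
    intro n; rw [theta_eq h0 (by linarith)]; exact ciInf_le (th_bdd p) n
  obtain ⟨b, L0, hb, hL⟩ := long_link hd hi h0 hp hp2 hθ hth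
  set M := 11 * ((2 * b + 1) ^ d) ^ 2 with hM
  have hp2pos : 0 < p2 := by linarith
  set c0 : ℝ := p2 ^ M with hc0
  have hc0pos : 0 < c0 := by positivity
  obtain ⟨K, hK⟩ := exists_nat_gt (2 / c0)
  have hK' : 2 < K * c0 := by rwa [div_lt_iff₀ hc0pos] at hK
  filter_upwards [Filter.eventually_ge_atTop (10 * L0 + 10 + K * (2 * b + 2))] with N hN
  have hN1 : 1 ≤ N := by omega
  have : NeZero N := ⟨by omega⟩
  set q := N / 10 with hq
  have hqL : L0 ≤ q := by omega
  have hq8 : 2 * (4 * q) + 1 ≤ N := by omega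
  let P : TorusPerc.Edge d N → ℝ := fun _ => p2
  let w : ℕ → V d := fun s => ax i1 (s * (2 * b + 2) : ℕ)
  let S : ℕ → Set (TorusPerc.Config d N) := fun s => {ω | ∀ e ∈ TT hd0 N i0 b q (w s), ω e = true}
  let F : ℕ → ℕ → Set (TorusPerc.Config d N) := fun s j =>
    {ω | lf hd0 ω ∈ LK i0 b q (w s + ax i0 (j * q : ℕ))}
  set A := TorusPerc.giantEvent d N
  have hS1 : ∀ s, c0 ≤ Pr P (S s) := by
    intro s
    have : Pr P (S s) = p2 ^ (TT hd0 N i0 b q (w s)).card := by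
      show Pr P {ω | ∀ e ∈ TT hd0 N i0 b q (w s), ω e = true} = _
      rw [Pr_all_true]; simp [P, cl_eq hp2pos.le hp2]
    rw [this]
    exact pow_le_pow_of_le_one hp2pos.le hp2 (TT_card _ _ _ _ _ _)
  have hSi : ∀ s, Inc (S s) := fun s ω ω' hw h e he => hw e (h e he)
  have hFi : ∀ s j, Inc (F s j) := fun s j ω ω' hw h => Inc_LK _ _ _ _ _ _ (fun e he => hw _ he) h
  have hF : ∀ s j, 1 - 4 / 1000 ≤ Pr P (F s j) := by
    intro s j
    have e1 : Pr P (F s j) = Pr (fun _ => p2) (LK i0 b q (w s + ax i0 (j * q : ℕ))) :=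
      Pr_lf hd0 hq8 (LD_LK _ _ _ _)
    rw [e1]
    have := hL q hqL
    have h2 := Pr_LK i0 b q (w s + ax i0 (j * q : ℕ)) p2
    linarith
  have hSA : ∀ s, Pr P (S s \ A) ≤ Pr P (S s) * (40 / 1000) := by
    intro s
    have hsub : S s \ A ⊆ ⋃ j ∈ Finset.range 10, S s \ F s j := by
      rintro ω ⟨h1, h2⟩
      by_contra hcon
      simp only [Set.mem_iUnion, not_exists] at hcon
      refine h2 (TT_giant hd0 hN1 hb hq (w s) h1 fun j hj => ?_)
      by_contra hc
      exact hcon j hj ⟨h1, hc⟩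
    refine (Pr_mono P hsub).trans ((Pr_biUnion_le _ _ _).trans ?_)
    refine (Finset.sum_le_sum fun j _ => Pr_sdiff_le P (hSi s) (hFi s j) (hF s j)).trans ?_
    simp only [Finset.sum_const, Finset.card_range, nsmul_eq_mul]
    push_cast
    linarith
  -- choose the number of translates
  have hex : ∃ k, 2 ≤ ∑ s ∈ Finset.range k, Pr P (S s) := by
    refine ⟨K, hK'.le.trans ?_⟩
    have := Finset.card_nsmul_le_sum (Finset.range K) (fun s => Pr P (S s)) c0 fun s _ => hS1 s
    simpa using this
  set k := Nat.find hex with hk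
  have hk2 : 2 ≤ ∑ s ∈ Finset.range k, Pr P (S s) := Nat.find_spec hex
  have hkK : k ≤ K := Nat.find_min' hex (by
    refine hK'.le.trans ?_
    have := Finset.card_nsmul_le_sum (Finset.range K) (fun s => Pr P (S s)) c0 fun s _ => hS1 s
    simpa using this)
  have hk3 : ∑ s ∈ Finset.range k, Pr P (S s) ≤ 3 := by
    rcases Nat.eq_zero_or_pos k with h | h
    · rw [h] at hk2; simp at hk2; linarith
    · have hlt := Nat.find_min hex (m := k - 1) (by omega)
      push Not at hlt
      have e : k = (k - 1) + 1 := by omega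
      rw [e, Finset.sum_range_succ]
      have := Pr_le_one P (S (k - 1))
      linarith
  have hnone : Pr P (⋂ s ∈ Finset.range k, (S s)ᶜ) ≤ 1 / 4 := by
    rw [Pr_biInter P (Finset.range k) (A := fun s => (S s)ᶜ)
      (S := fun s => ((TT hd0 N i0 b q (w s) : Finset _) : Set (TorusPerc.Edge d N)))
      (fun s _ => (LD_all _ true).compl) (by
        intro s hs s' hs' hne
        rw [Finset.mem_range] at hs hs'
        rw [Finset.disjoint_coe]
        exact TT_disj hd0 hi b q (K := K) (by omega) (by omega) hne (by omega))]
    have e1 : ∀ s, Pr P (S s)ᶜ = 1 - Pr P (S s) := fun s => Pr_compl P (LD_finite _)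
    calc ∏ s ∈ Finset.range k, Pr P (S s)ᶜ ≤ ∏ s ∈ Finset.range k, Real.exp (-Pr P (S s)) := by
          refine Finset.prod_le_prod (fun s _ => Pr_nonneg _ _) fun s _ => ?_
          rw [e1]; exact Real.one_sub_le_exp_neg _
      _ = Real.exp (-∑ s ∈ Finset.range k, Pr P (S s)) := by
          rw [← Real.exp_sum, Finset.sum_neg_distrib]
      _ ≤ Real.exp (-2) := Real.exp_le_exp.2 (by linarith)
      _ ≤ 1 / 4 := by
          have h1 := Real.exp_one_gt_d9
          have h2 : Real.exp (-2) = (Real.exp 1 * Real.exp 1)⁻¹ := by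
            rw [← Real.exp_add, ← Real.exp_neg]; norm_num
          rw [h2, one_div]
          exact inv_anti₀ (by norm_num) (by nlinarith)
  have hfinal : Pr P Aᶜ ≤ 1 / 4 + 3 * (40 / 1000) := by
    have hsub : Aᶜ ⊆ (⋂ s ∈ Finset.range k, (S s)ᶜ) ∪ ⋃ s ∈ Finset.range k, S s \ A := by
      intro ω hω
      by_cases h : ∃ s ∈ Finset.range k, ω ∈ S s
      · obtain ⟨s, hs, h⟩ := h
        exact Or.inr (Set.mem_biUnion hs ⟨h, hω⟩)
      · push Not at h
        exact Or.inl (Set.mem_iInter₂.2 h)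
    refine (Pr_mono P hsub).trans ((Pr_union_le _ _ _).trans (add_le_add hnone ?_))
    refine (Pr_biUnion_le _ _ _).trans ((Finset.sum_le_sum fun s _ => hSA s).trans ?_)
    rw [← Finset.sum_mul]
    exact mul_le_mul_of_nonneg_right hk3 (by norm_num)
  rw [Pr_compl P (LD_finite A)] at hfinal
  show 1 / 2 < Pr P A
  linarith

end

end Perc

/-- Fix `d ≥ 2`, and for each `N ≥ 1` let `λ(N) ∈ [0,1]` satisfy
`ℙ_{λ(N)}(A^□) = 1/2` for bond percolation on the torus `T^d_N`.
Then `λ(N) → p̂_c(d)` as `N → ∞`. -/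
theorem torus_threshold_tendsto_hatPc (d : ℕ) (hd : 2 ≤ d) (lam : ℕ → ℝ)
    (hmem : ∀ N : ℕ, 1 ≤ N → lam N ∈ Set.Icc (0 : ℝ) 1)
    (hhalf : ∀ N : ℕ, 1 ≤ N →
      TorusPerc.prob d N (lam N) (TorusPerc.giantEvent d N) = 1 / 2) :
    Filter.Tendsto lam Filter.atTop (nhds (ZLattice.hatPc d)) := by
  have hhalf' : ∀ N, 1 ≤ N → Perc.Pr (fun _ => lam N) (TorusPerc.giantEvent d N) = 1 / 2 := by
    intro N hN
    rw [← Perc.tprob_eq hN (hmem N hN).1 (hmem N hN).2]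
    exact hhalf N hN
  have hbdd : BddAbove {p : ℝ | p ∈ Set.Icc (0 : ℝ) 1 ∧ ZLattice.theta d p = 0} :=
    ⟨1, fun p hp => hp.1.2⟩
  rw [tendsto_order]
  constructor
  · intro a ha
    by_cases ha0 : a < 0
    · filter_upwards [Filter.eventually_ge_atTop 1] with N hN
      exact lt_of_lt_of_le ha0 (hmem N hN).1
    · push Not at ha0
      have hne : {p : ℝ | p ∈ Set.Icc (0 : ℝ) 1 ∧ ZLattice.theta d p = 0}.Nonempty := by
        by_contra h
        rw [Set.not_nonempty_iff_eq_empty] at h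
        rw [ZLattice.hatPc, h, Real.sSup_empty] at ha
        linarith
      obtain ⟨p1, ⟨hp1, hθ⟩, hap⟩ := exists_lt_of_lt_csSup hne ha
      filter_upwards [Perc.subcrit_giant (by omega) ha0 hap hp1.2 hθ, Filter.eventually_ge_atTop 1]
        with N h1 hN
      by_contra hc
      push Not at hc
      have := Perc.giant_mono (d := d) hN hc
      rw [hhalf' N hN] at this
      linarith
  · intro a ha
    by_cases ha1 : 1 < a
    · filter_upwards [Filter.eventually_ge_atTop 1] with N hN
      exact lt_of_le_of_lt (hmem N hN).2 ha1
    · push Not at ha1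
      have hpc0 : 0 ≤ ZLattice.hatPc d := Real.sSup_nonneg fun x hx => hx.1.1
      obtain ⟨p, hp1, hp2⟩ := exists_between ha
      have hp0 : 0 ≤ p := by linarith
      have hθ : 0 < ZLattice.theta d p := by
        have hnn : 0 ≤ ZLattice.theta d p := by
          rw [Perc.theta_eq hp0 (by linarith)]
          exact Real.iInf_nonneg fun M => Perc.th_nonneg M p
        refine lt_of_le_of_ne hnn fun h => ?_
        exact absurd (le_csSup hbdd ⟨⟨hp0, by linarith⟩, h.symm⟩) (not_le.2 hp1)
      filter_upwards [Perc.supercrit_giant hd hp0 hp2 ha1 hθ, Filter.eventually_ge_atTop 1]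
        with N h1 hN
      by_contra hc
      push Not at hc
      have := Perc.giant_mono (d := d) hN hc
      rw [hhalf' N hN] at this
      linarith
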